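/- For every k ≥ 4, every 3-connected nonbipartite graph of minimum degree at least k and order at least k+2 contains k cycles of consecutive lengths. -/

import Mathlib

open SimpleGraph

/-- `G` is `k`-connected: more than `k` vertices, and deleting any set of fewer than
`k` vertices leaves a connected graph. -/
def KConnected {V : Type*} (G : SimpleGraph V) (k : ℕ) : Prop :=
  k < Nat.card V ∧ ∀ S : Set V, S.Finite → S.ncard < k → (G.induce Sᶜ).Connected

/-- `G + xy`: the graph `G` with the edge `xy` added (equal to `G` if already present). -/
def AddEdge {V : Type*} (G : SimpleGraph V) (x y : V) : SimpleGraph V :=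
  G ⊔ SimpleGraph.fromEdgeSet {s(x, y)}

/-- `G` has a cycle of length `n`. -/
def HasCycleLength {V : Type*} (G : SimpleGraph V) (n : ℕ) : Prop :=
  ∃ (v : V) (c : G.Walk v v), c.IsCycle ∧ c.length = n

/-- `G` contains `k` cycles of consecutive lengths. -/
def HasConsecCycles {V : Type*} (G : SimpleGraph V) (k : ℕ) : Prop :=
  ∃ m : ℕ, ∀ i < k, HasCycleLength G (m + i)

namespace ConsecCycles

set_option linter.unusedSectionVars false

section Infrastructure
variable {V : Type*} [DecidableEq V]

/-- `PathOn G S a b`: there is an `a`–`b` path in `G` whose vertex set is exactly `S`. -/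
inductive PathOn (G : SimpleGraph V) : Finset V → V → V → Prop
  | single (a : V) : PathOn G {a} a a
  | cons {a b c : V} {S : Finset V} :
      G.Adj a b → a ∉ S → PathOn G S b c → PathOn G (insert a S) a c

variable {G : SimpleGraph V}

namespace PathOn

theorem left_mem {S : Finset V} {a b : V} (h : PathOn G S a b) : a ∈ S := by
  cases h <;> simp

theorem right_mem {S : Finset V} {a b : V} (h : PathOn G S a b) : b ∈ S := by
  induction h with
  | single a => simp
  | cons _ _ _ ih => simp [ih]

theorem card_pos {S : Finset V} {a b : V} (h : PathOn G S a b) : 0 < S.card :=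
  Finset.card_pos.2 ⟨a, h.left_mem⟩

theorem append {S T : Finset V} {a b c d : V} (h : PathOn G S a b) (h' : PathOn G T c d)
    (hbc : G.Adj b c) (hd : Disjoint S T) : PathOn G (S ∪ T) a d := by
  induction h with
  | single a =>
    rw [Finset.singleton_union]
    exact cons hbc (by simpa using hd) h'
  | cons hab haS _ ih =>
    rw [Finset.insert_union]
    rw [Finset.disjoint_insert_left] at hd
    exact cons hab (by simp [haS, hd.1]) (ih hbc hd.2)

theorem symm {S : Finset V} {a b : V} (h : PathOn G S a b) : PathOn G S b a := by
  induction h with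
  | single a => exact single a
  | @cons a b c S hab haS _ ih =>
    have := ih.append (single a) hab.symm (by simpa using haS)
    rwa [Finset.union_comm, Finset.singleton_union] at this

theorem single' {S : Finset V} {a b : V} (h : PathOn G S a b) (h1 : S.card = 1) : a = b := by
  obtain ⟨x, rfl⟩ := Finset.card_eq_one.1 h1
  have := h.left_mem
  have := h.right_mem
  simp_all

theorem suffix {S : Finset V} {a b x : V} (h : PathOn G S a b) (hx : x ∈ S) :
    ∃ T ⊆ S, PathOn G T x b := by
  induction h with
  | single a =>
    obtain rfl : x = a := by simpa using hx
    exact ⟨{x}, subset_rfl, single x⟩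
  | @cons a b c S hab haS hp ih =>
    rcases Finset.mem_insert.1 hx with rfl | hx
    · exact ⟨_, subset_rfl, cons hab haS hp⟩
    · obtain ⟨T, hT, h⟩ := ih hx
      exact ⟨T, hT.trans (Finset.subset_insert _ _), h⟩

/-- Cut a path at its first vertex in `B`. -/
theorem firstHit {S B : Finset V} {a b : V} (h : PathOn G S a b) (hb : b ∈ B) :
    ∃ T ⊆ S, ∃ b' ∈ B, PathOn G T a b' ∧ ∀ x ∈ T, x ∈ B → x = b' := by
  induction h with
  | single a => exact ⟨{a}, subset_rfl, a, hb, single a, by simp⟩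
  | @cons a b c S hab haS hp ih =>
    by_cases haB : a ∈ B
    · exact ⟨{a}, by simp, a, haB, single a, by simp⟩
    · obtain ⟨T, hT, b', hb', h, hh⟩ := ih hb
      refine ⟨insert a T, Finset.insert_subset_insert _ hT, b', hb', cons hab (fun h => haS (hT h)) h,
        fun x hx hxB => ?_⟩
      rcases Finset.mem_insert.1 hx with rfl | hx
      · exact absurd hxB haB
      · exact hh x hx hxB

/-- A path splits at each of its vertices. -/
theorem split {S : Finset V} {a b x : V} (h : PathOn G S a b) (hx : x ∈ S) :
    ∃ S₁ S₂, S₁ ∪ S₂ = S ∧ S₁ ∩ S₂ = {x} ∧ PathOn G S₁ a x ∧ PathOn G S₂ x b := by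
  induction h with
  | single a =>
    obtain rfl : x = a := by simpa using hx
    exact ⟨{x}, {x}, by simp, by simp, single x, single x⟩
  | @cons a b c S hab haS hp ih =>
    rcases Finset.mem_insert.1 hx with rfl | hxS
    · refine ⟨{x}, insert x S, by simp, by rw [Finset.inter_eq_left]; simp, single x, cons hab haS hp⟩
    · obtain ⟨S₁, S₂, h1, h2, h3, h4⟩ := ih hxS
      have ha1 : a ∉ S₁ := fun h => haS (h1 ▸ Finset.mem_union_left _ h)
      have ha2 : a ∉ S₂ := fun h => haS (h1 ▸ Finset.mem_union_right _ h)
      exact ⟨insert a S₁, S₂, by rw [Finset.insert_union, h1],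
        by rw [Finset.insert_inter_of_notMem ha2, h2], cons hab ha1 h3, h4⟩

theorem toWalk {S : Finset V} {a b : V} (h : PathOn G S a b) :
    ∃ w : G.Walk a b, w.IsPath ∧ w.length + 1 = S.card ∧ ∀ x, x ∈ w.support ↔ x ∈ S := by
  induction h with
  | single a => exact ⟨Walk.nil, by simp, by simp, by simp⟩
  | @cons a b c S hab haS hp ih =>
    obtain ⟨w, hw, hl, hs⟩ := ih
    refine ⟨Walk.cons hab w, ?_, ?_, ?_⟩
    · rw [Walk.cons_isPath_iff]
      exact ⟨hw, by rwa [hs]⟩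
    · rw [Walk.length_cons, Finset.card_insert_of_notMem haS, hl]
    · intro x; simp [hs]

end PathOn

/-- `D` is a nonempty subset of `U`, avoiding `B`, all of whose neighbours in `U` outside `D`
lie in `B`. -/
structure Sep (G : SimpleGraph V) (U B D : Finset V) : Prop where
  sub : D ⊆ U
  ne : D.Nonempty
  disj : Disjoint D B
  closed : ∀ a ∈ D, ∀ b ∈ U, G.Adj a b → b ∈ D ∨ b ∈ B

/-- The subgraph induced on `U` is connected. -/
def Conn (G : SimpleGraph V) (U : Finset V) : Prop :=
  U.Nonempty ∧ ∀ T, Sep G U ∅ T → T = U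

theorem Sep.exists_conn {U B D : Finset V} (h : Sep G U B D) {x : V} (hx : x ∈ D) :
    ∃ M ⊆ D, x ∈ M ∧ Conn G M ∧ Sep G U B M := by
  classical
  obtain ⟨M, hM, hmin⟩ := Finset.exists_min_image
    (D.powerset.filter (fun M => x ∈ M ∧ Sep G U B M)) Finset.card
    ⟨D, by simp [hx, h]⟩
  simp only [Finset.mem_filter, Finset.mem_powerset] at hM hmin
  obtain ⟨hMD, hxM, hS⟩ := hM
  refine ⟨M, hMD, hxM, ⟨⟨x, hxM⟩, fun T hT => ?_⟩, hS⟩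
  by_cases hxT : x ∈ T
  · refine Finset.eq_of_subset_of_card_le hT.sub (hmin T ⟨hT.sub.trans hMD, hxT, hT.sub.trans hS.sub,
      hT.ne, Finset.disjoint_of_subset_left hT.sub hS.disj, fun a ha b hb hab => ?_⟩)
    rcases hS.closed a (hT.sub ha) b hb hab with hbM | hbB
    · left
      simpa using hT.closed a ha b hbM hab
    · exact Or.inr hbB
  · have hlt : (M \ T).card < M.card := by
      apply Finset.card_lt_card
      refine Finset.sdiff_ssubset hT.sub hT.ne
    exfalso
    have := hmin (M \ T) ⟨Finset.sdiff_subset.trans hMD, by simp [hxM, hxT],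
      Finset.sdiff_subset.trans hS.sub, ⟨x, by simp [hxM, hxT]⟩,
      Finset.disjoint_of_subset_left Finset.sdiff_subset hS.disj, fun a ha b hb hab => by
        rw [Finset.mem_sdiff] at ha
        rcases hS.closed a ha.1 b hb hab with hbM | hbB
        · by_cases hbT : b ∈ T
          · have := hT.closed b hbT a ha.1 hab.symm
            simp [ha.2] at this
          · left; simp [hbM, hbT]
        · exact Or.inr hbB⟩
    omega

/-- The component of `U \ B` containing `x`. -/
theorem exists_component {U B : Finset V} {x : V} (hx : x ∈ U) (hxB : x ∉ B) :
    ∃ M, x ∈ M ∧ Conn G M ∧ Sep G U B M := by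
  have h : Sep G U B (U \ B) := ⟨Finset.sdiff_subset, ⟨x, by simp [hx, hxB]⟩,
    Finset.sdiff_disjoint, fun a _ b hb _ => by
      by_cases hB : b ∈ B <;> simp [hb, hB]⟩
  obtain ⟨M, -, h1, h2, h3⟩ := h.exists_conn (x := x) (by simp [hx, hxB])
  exact ⟨M, h1, h2, h3⟩

theorem Conn.path {U : Finset V} (h : Conn G U) {a b : V} (ha : a ∈ U) (hb : b ∈ U) :
    ∃ S ⊆ U, PathOn G S a b := by
  classical
  have := h.2 (U.filter (fun x => ∃ S ⊆ U, PathOn G S x b))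
    ⟨Finset.filter_subset _ _, ⟨b, by simpa [hb] using ⟨{b}, by simpa using hb, .single b⟩⟩,
      by simp, fun x hx y hy hxy => by
        simp only [Finset.mem_filter] at hx
        obtain ⟨hxU, S, hS, hp⟩ := hx
        left
        simp only [Finset.mem_filter]
        refine ⟨hy, ?_⟩
        by_cases hyS : y ∈ S
        · obtain ⟨T, hT, h⟩ := hp.suffix hyS
          exact ⟨T, hT.trans hS, h⟩
        · exact ⟨insert y S, Finset.insert_subset hy hS, .cons hxy.symm hyS hp⟩⟩
  rw [← this] at ha
  exact (Finset.mem_filter.1 ha).2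

theorem conn_singleton (a : V) : Conn G {a} := by
  refine ⟨by simp, fun T hT => ?_⟩
  exact (Finset.subset_singleton_iff.1 hT.sub).resolve_left hT.ne.ne_empty

theorem Conn.union {U W : Finset V} (hU : Conn G U) (hW : Conn G W)
    (h : ∃ a ∈ U, ∃ b ∈ W, a = b ∨ G.Adj a b) : Conn G (U ∪ W) := by
  refine ⟨hU.1.mono Finset.subset_union_left, fun T hT => ?_⟩
  have key : ∀ A : Finset V, Conn G A → A ⊆ U ∪ W → (T ∩ A).Nonempty → A ⊆ T := by
    intro A hA hAU hne
    have h1 := hA.2 (T ∩ A) ⟨Finset.inter_subset_right, hne, by simp, fun a ha b hb hab => by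
      left
      rw [Finset.mem_inter] at ha ⊢
      exact ⟨by simpa using hT.closed a ha.1 b (hAU hb) hab, hb⟩⟩
    rw [← h1]
    exact Finset.inter_subset_left
  obtain ⟨a, ha, b, hb, hab⟩ := h
  have hiff : a ∈ T ↔ b ∈ T := by
    rcases hab with rfl | hab
    · rfl
    · exact ⟨fun h => by simpa using hT.closed a h b (by simp [hb]) hab,
        fun h => by simpa using hT.closed b h a (by simp [ha]) hab.symm⟩
  obtain ⟨x, hx⟩ := hT.ne
  have hUW : U ⊆ T ∧ W ⊆ T := by
    rcases Finset.mem_union.1 (hT.sub hx) with h | h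
    · have h1 := key U hU Finset.subset_union_left ⟨x, by simp [hx, h]⟩
      exact ⟨h1, key W hW Finset.subset_union_right ⟨b, by simp [hiff.1 (h1 ha), hb]⟩⟩
    · have h1 := key W hW Finset.subset_union_right ⟨x, by simp [hx, h]⟩
      exact ⟨key U hU Finset.subset_union_left ⟨a, by simp [hiff.2 (h1 hb), ha]⟩, h1⟩
  exact hT.sub.antisymm (Finset.union_subset hUW.1 hUW.2)

theorem Conn.insert' {U : Finset V} (hU : Conn G U) {a b : V} (hb : b ∈ U) (hab : G.Adj a b) :
    Conn G (insert a U) := by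
  rw [← Finset.singleton_union]
  exact (conn_singleton a).union hU ⟨a, by simp, b, hb, Or.inr hab⟩

theorem Conn.sdiff {U D : Finset V} {c : V} (hU : Conn G U) (hD : Sep G U {c} D) (hc : c ∈ U) :
    Conn G (U \ D) := by
  have hcD : c ∉ D := by simpa using hD.disj
  refine ⟨⟨c, by simp [hc, hcD]⟩, fun T hT => ?_⟩
  have hTU : T ⊆ U := hT.sub.trans Finset.sdiff_subset
  by_cases hcT : c ∈ T
  · have : T ∪ D = U := hU.2 _ ⟨Finset.union_subset hTU hD.sub, hT.ne.mono Finset.subset_union_left,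
      by simp, fun a ha b hb hab => by
        left
        by_cases hbD : b ∈ D
        · simp [hbD]
        rcases Finset.mem_union.1 ha with ha | ha
        · have := hT.closed a ha b (by simp [hb, hbD]) hab
          simpa [hbD] using this
        · have := hD.closed a ha b hb hab
          simp only [hbD, Finset.mem_singleton, false_or] at this
          simp [this, hcT]⟩
    rw [← this]
    ext x
    have : x ∈ T → x ∉ D := fun h => (Finset.mem_sdiff.1 (hT.sub h)).2
    simp only [Finset.mem_sdiff, Finset.mem_union]
    tauto
  · have : T = U := hU.2 _ ⟨hTU, hT.ne, by simp, fun a ha b hb hab => by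
      by_cases hbD : b ∈ D
      · have h1 := Finset.mem_sdiff.1 (hT.sub ha)
        rcases hD.closed b hbD a h1.1 hab.symm with h | h
        · exact absurd h h1.2
        · rw [Finset.mem_singleton] at h
          exact absurd (h ▸ ha) hcT
      · exact hT.closed a ha b (by simp [hb, hbD]) hab⟩
    exact absurd (this ▸ hc) hcT

/-- In a connected arena every proper nonempty subset has an outgoing edge. -/
theorem Conn.exists_adj {U T : Finset V} (hU : Conn G U) (hT : T ⊆ U) (hne : T.Nonempty)
    (hTU : T ≠ U) : ∃ a ∈ T, ∃ b ∈ U, b ∉ T ∧ G.Adj a b := by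
  by_contra! h
  refine hTU (hU.2 T ⟨hT, hne, by simp, fun a ha b hb hab => ?_⟩)
  by_contra hb'
  exact h a ha b hb (by simpa using hb') hab

variable (G) in
/-- The numbers of vertices of paths inside `U` from `X` to `Y`. -/
def Ord (U X Y : Finset V) : Set ℕ :=
  {n | ∃ S a b, S ⊆ U ∧ a ∈ X ∧ b ∈ Y ∧ PathOn G S a b ∧ S.card = n}

theorem Ord.symm {U X Y : Finset V} {n : ℕ} (h : n ∈ Ord G U X Y) : n ∈ Ord G U Y X := by
  obtain ⟨S, a, b, h1, h2, h3, h4, h5⟩ := h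
  exact ⟨S, b, a, h1, h3, h2, h4.symm, h5⟩

theorem Ord.comm (U X Y : Finset V) : Ord G U X Y = Ord G U Y X :=
  Set.ext fun _ => ⟨Ord.symm, Ord.symm⟩

theorem Ord.mono {U X Y U' X' Y' : Finset V} {n : ℕ} (h : n ∈ Ord G U X Y) (hU : U ⊆ U')
    (hX : X ⊆ X') (hY : Y ⊆ Y') : n ∈ Ord G U' X' Y' := by
  obtain ⟨S, a, b, h1, h2, h3, h4, h5⟩ := h
  exact ⟨S, a, b, h1.trans hU, hX h2, hY h3, h4, h5⟩

theorem Ord.glue {H M U X A Y : Finset V} {n n' : ℕ} (hH : H ⊆ U) (hM : M ⊆ U)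
    (hHM : Disjoint H M) (hA : ∀ x ∈ A, ∃ r, G.Adj r x ∧ n ∈ Ord G H X {r})
    (h : n' ∈ Ord G M A Y) : n + n' ∈ Ord G U X Y := by
  obtain ⟨S, a, b, h1, h2, h3, h4, h5⟩ := h
  obtain ⟨r, hr, S', x, r', g1, g2, g3, g4, g5⟩ := hA a h2
  obtain rfl : r' = r := by simpa using g3
  have hd : Disjoint S' S := Finset.disjoint_of_subset_left g1 (Finset.disjoint_of_subset_right h1 hHM)
  exact ⟨S' ∪ S, x, b, Finset.union_subset (g1.trans hH) (h1.trans hM), g2, h3,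
    g4.append h4 hr hd, by rw [Finset.card_union_of_disjoint hd, g5, h5]⟩

theorem Conn.ord {U X Y : Finset V} (h : Conn G U) (hX : (U ∩ X).Nonempty)
    (hY : (U ∩ Y).Nonempty) : ∃ n, n ∈ Ord G U X Y := by
  obtain ⟨x, hx⟩ := hX
  obtain ⟨y, hy⟩ := hY
  rw [Finset.mem_inter] at hx hy
  obtain ⟨S, hS, hp⟩ := h.path hx.1 hy.1
  exact ⟨_, S, x, y, hS, hx.2, hy.2, hp, rfl⟩

theorem Ord.single {U X Y : Finset V} {a : V} (h : a ∈ U) (hX : a ∈ X) (hY : a ∈ Y) :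
    1 ∈ Ord G U X Y :=
  ⟨{a}, a, a, by simpa using h, hX, hY, .single a, by simp⟩

variable [DecidableRel G.Adj]

variable (G) in
/-- The vertices of `U` with a neighbour in `R`. -/
def nbr (U R : Finset V) : Finset V := U.filter (fun w => ∃ r ∈ R, G.Adj r w)

variable (G) in
/-- The number of neighbours of `w` in `U`. -/
def dg (U : Finset V) (w : V) : ℕ := (U.filter (fun x => G.Adj w x)).card

/-- Indicator. -/
def ind (X : Finset V) (w : V) : ℕ := if w ∈ X then 1 else 0

theorem ind_le (X : Finset V) (w : V) : ind X w ≤ 1 := by unfold ind; split <;> simp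

theorem ind_of_mem {X : Finset V} {w : V} (h : w ∈ X) : ind X w = 1 := by simp [ind, h]

theorem ind_of_notMem {X : Finset V} {w : V} (h : w ∉ X) : ind X w = 0 := by simp [ind, h]

theorem ind_mono {X Y : Finset V} {w : V} (h : w ∈ X → w ∈ Y) : ind X w ≤ ind Y w := by
  by_cases hx : w ∈ X
  · rw [ind_of_mem hx, ind_of_mem (h hx)]
  · rw [ind_of_notMem hx]; exact Nat.zero_le _

theorem mem_nbr {U R : Finset V} {w : V} : w ∈ nbr G U R ↔ w ∈ U ∧ ∃ r ∈ R, G.Adj r w := by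
  simp [nbr]

theorem mem_nbr_singleton {U : Finset V} {w c : V} : w ∈ nbr G U {c} ↔ w ∈ U ∧ G.Adj c w := by
  simp [nbr]

theorem nbr_subset (U R : Finset V) : nbr G U R ⊆ U := Finset.filter_subset _ _

theorem dg_mono {U W : Finset V} (h : U ⊆ W) (w : V) : dg G U w ≤ dg G W w :=
  Finset.card_le_card (Finset.filter_subset_filter _ h)

theorem dg_union_le (U W : Finset V) (w : V) : dg G (U ∪ W) w ≤ dg G U w + dg G W w := by
  unfold dg
  rw [Finset.filter_union]
  exact Finset.card_union_le _ _

theorem dg_le_card (U : Finset V) (w : V) : dg G U w ≤ U.card := Finset.card_filter_le _ _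

theorem dg_pos {U : Finset V} {w : V} : 0 < dg G U w ↔ ∃ x ∈ U, G.Adj w x := by
  simp [dg, Finset.card_pos, Finset.Nonempty]

theorem dg_eq_zero {U : Finset V} {w : V} : dg G U w = 0 ↔ ∀ x ∈ U, ¬ G.Adj w x := by
  simp [dg, Finset.filter_eq_empty_iff]

theorem dg_sdiff_add {U H : Finset V} (h : H ⊆ U) (w : V) :
    dg G (U \ H) w + dg G H w = dg G U w := by
  unfold dg
  rw [← Finset.card_union_of_disjoint, ← Finset.filter_union, Finset.sdiff_union_of_subset h]
  exact Finset.disjoint_filter_filter Finset.sdiff_disjoint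

/-- If all `U`-neighbours of `w` lie in `D ∪ B`. -/
theorem dg_le_of_closed {U D B : Finset V} {w : V}
    (h : ∀ b ∈ U, G.Adj w b → b ∈ D ∨ b ∈ B) : dg G U w ≤ dg G D w + dg G B w := by
  refine le_trans (Finset.card_le_card ?_) (Finset.card_union_le _ _)
  intro x hx
  simp only [Finset.mem_filter, Finset.mem_union] at hx ⊢
  rcases h x hx.1 hx.2 with h | h <;> simp [h, hx.2]

theorem dg_singleton (c w : V) : dg G {c} w = if G.Adj w c then 1 else 0 := by
  unfold dg
  rw [Finset.filter_singleton]
  split <;> simp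

theorem dg_singleton_le (c w : V) : dg G {c} w ≤ 1 := by
  rw [dg_singleton]; split <;> simp

theorem dg_singleton_of_mem {U : Finset V} {c w : V} (hw : w ∈ U) :
    dg G {c} w = ind (nbr G U {c}) w := by
  rw [dg_singleton]
  simp [ind, mem_nbr_singleton, hw, G.adj_comm]

theorem ind_nbr_pos {U R : Finset V} {w : V} (hw : w ∈ U) (h : 0 < dg G R w) :
    ind (nbr G U R) w = 1 := by
  obtain ⟨x, hx, hxw⟩ := dg_pos.1 h
  exact ind_of_mem (mem_nbr.2 ⟨hw, x, hx, hxw.symm⟩)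

theorem dg_eq_zero_of_notMem_nbr {U R : Finset V} {w : V} (hw : w ∈ U) (h : w ∉ nbr G U R) :
    dg G R w = 0 := by
  rw [dg_eq_zero]
  intro x hx hxw
  exact h (mem_nbr.2 ⟨hw, x, hx, hxw.symm⟩)

end Infrastructure

section Numeric

/-- `O` contains `p` numbers forming an arithmetic progression of difference `2`, or `p + ε`
consecutive numbers. -/
def Good (ε p : ℕ) (O : Set ℕ) : Prop :=
  (∃ m, ∀ i < p, m + 2 * i ∈ O) ∨ ∃ m, ∀ i < p + ε, m + i ∈ O

theorem Good.of_one {ε : ℕ} {O : Set ℕ} {n : ℕ} (h : n ∈ O) {p : ℕ} (hp : p ≤ 1) : Good ε p O :=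
  Or.inl ⟨n, fun i hi => by obtain rfl : i = 0 := by omega
                            simpa using h⟩

theorem Good.shift {ε p : ℕ} {O O' : Set ℕ} (h : Good ε p O) (t : ℕ)
    (hO : ∀ n ∈ O, n + t ∈ O') : Good ε p O' := by
  rcases h with ⟨m, h⟩ | ⟨m, h⟩
  · exact Or.inl ⟨m + t, fun i hi => by convert hO _ (h i hi) using 1; ring⟩
  · exact Or.inr ⟨m + t, fun i hi => by convert hO _ (h i hi) using 1; ring⟩

theorem Good.subset {ε p : ℕ} {O O' : Set ℕ} (h : Good ε p O) (hO : O ⊆ O') : Good ε p O' :=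
  h.shift 0 fun _ hn => hO hn

theorem Good.mono {ε p ε' p' : ℕ} {O : Set ℕ} (h : Good ε p O) (hp : p' ≤ p)
    (h' : p' + ε' ≤ p + ε) : Good ε' p' O := by
  rcases h with ⟨m, h⟩ | ⟨m, h⟩
  · exact Or.inl ⟨m, fun i hi => h i (by omega)⟩
  · exact Or.inr ⟨m, fun i hi => h i (by omega)⟩

/-- Sum of a good set and a progression of difference `2`. -/
theorem Good.add_two {ε ε' p p' L a : ℕ} {O O' : Set ℕ} (h : Good ε' p' O')
    (hO : ∀ n ∈ O', ∀ i < L, a + 2 * i + n ∈ O) (hp' : 1 ≤ p') (hL : 1 ≤ L)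
    (hp : p + 1 ≤ p' + L) (hε : ε ≤ ε' ∨ ε ≤ 1 ∧ 2 ≤ L) : Good ε p O := by
  rcases h with ⟨m, h⟩ | ⟨m, h⟩
  · left
    refine ⟨a + m, fun i hi => ?_⟩
    by_cases h1 : i < L
    · convert hO _ (h 0 (by omega)) i h1 using 1; ring
    · convert hO _ (h (i - (L - 1)) (by omega)) (L - 1) (by omega) using 1
      omega
  · by_cases h2 : p' + ε' ≤ 1
    · left
      refine ⟨a + m, fun i hi => ?_⟩
      convert hO _ (h 0 (by omega)) i (by omega) using 1; ring
    · right
      refine ⟨a + m, fun i hi => ?_⟩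
      by_cases h1 : i / 2 < L
      · convert hO _ (h (i % 2) (by omega)) (i / 2) h1 using 1
        omega
      · convert hO _ (h (i - 2 * (L - 1)) (by omega)) (L - 1) (by omega) using 1
        omega

/-- Sum of a good set and a progression of difference `1`. -/
theorem Good.add_one {ε ε' p p' L a : ℕ} {O O' : Set ℕ} (h : Good ε' p' O')
    (hO : ∀ n ∈ O', ∀ i < L, a + i + n ∈ O) (hp' : 1 ≤ p') (hL : 1 ≤ L)
    (hp : p + 1 + ε ≤ p' + L + ε') (hp2 : p + 1 ≤ p' + L) (hε : ε = 0 ∨ 2 ≤ L ∧ p + ε ≤ 2 * p' + L - 2) :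
    Good ε p O := by
  rcases h with ⟨m, h⟩ | ⟨m, h⟩
  · by_cases h2 : L = 1
    · left
      refine ⟨a + m, fun i hi => ?_⟩
      convert hO _ (h i (by omega)) 0 (by omega) using 1; ring
    · right
      refine ⟨a + m, fun i hi => ?_⟩
      by_cases h1 : i / 2 < p'
      · convert hO _ (h (i / 2) h1) (i % 2) (by omega) using 1
        omega
      · convert hO _ (h (p' - 1) (by omega)) (i - 2 * (p' - 1)) (by omega) using 1
        omega
  · right
    refine ⟨a + m, fun i hi => ?_⟩
    by_cases h1 : i < L
    · convert hO _ (h 0 (by omega)) i h1 using 1; ring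
    · convert hO _ (h (i - (L - 1)) (by omega)) (L - 1) (by omega) using 1
      omega

/-- Sum of a good set and two numbers at distance `1` or `2`. -/
theorem Good.add_pair {ε p m g : ℕ} {O O' : Set ℕ} (h : Good ε (p - 1) O') (hε : ε ≤ 1)
    (hO : ∀ n ∈ O', n + m ∈ O ∧ n + (m + g) ∈ O) (hg : g = 1 ∨ g = 2) (hp : 3 ≤ p) :
    Good ε p O := by
  rcases h with ⟨b, h⟩ | ⟨b, h⟩
  · rcases hg with rfl | rfl
    · right
      refine ⟨b + m, fun i hi => ?_⟩
      rcases Nat.even_or_odd' i with ⟨j, rfl | rfl⟩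
      · convert (hO _ (h j (by omega))).1 using 1; ring
      · convert (hO _ (h j (by omega))).2 using 1; ring
    · left
      refine ⟨b + m, fun i hi => ?_⟩
      by_cases h1 : i < p - 1
      · convert (hO _ (h i h1)).1 using 1; ring
      · convert (hO _ (h (i - 1) (by omega))).2 using 1; omega
  · right
    refine ⟨b + m, fun i hi => ?_⟩
    by_cases h1 : i < p - 1 + ε
    · convert (hO _ (h i h1)).1 using 1; ring
    · convert (hO _ (h (i - g) (by omega))).2 using 1; omega

end Numeric

section Core
variable {V : Type*} [DecidableEq V] {G : SimpleGraph V} [DecidableRel G.Adj]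

variable (G) in
/-- No edge of `G` inside `X`. -/
def Indep (X : Finset V) : Prop := ∀ a ∈ X, ∀ b ∈ X, ¬ G.Adj a b

variable (G) in
/-- `G` has no triangle. -/
def TriFree : Prop := ∀ a b c, G.Adj a b → G.Adj b c → ¬ G.Adj a c

variable (G) in
/-- Side condition for the sharper version `ε = 1` of the path theorem. -/
def Adm (ε : ℕ) (X Y : Finset V) : Prop :=
  ε = 0 ∨ ε = 1 ∧ TriFree G ∧ (Indep G X ∨ Indep G Y)

variable (G) in
/-- A connected arena `U` with terminal sets `X` and `Y`, every end piece of which contains a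
terminal. -/
structure Inst (U X Y : Finset V) : Prop where
  conn : Conn G U
  subX : X ⊆ U
  subY : Y ⊆ U
  neX : X.Nonempty
  neY : Y.Nonempty
  piece : ∀ c D, Sep G U {c} D → Disjoint D X → ¬ Disjoint D Y

variable (G) in
/-- The degree condition of the path theorem. -/
def DegOK (U X Y : Finset V) (p : ℕ) : Prop :=
  p ≤ 1 ∨ ∀ w ∈ U, p + 1 ≤ dg G U w + ind X w + ind Y w

variable (G) in
/-- The path theorem for arenas with fewer than `N` vertices. -/
def PathThm (ε N : ℕ) : Prop :=
  ∀ M X Y p, M.card < N → 1 ≤ p → Adm G ε X Y → Inst G M X Y → DegOK G M X Y p →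
    Good ε p (Ord G M X Y)

/-- `O` contains the sum of a good set and a progression. -/
def SumIn (ε p a δ L : ℕ) (O : Set ℕ) : Prop :=
  ∃ O', Good ε p O' ∧ ∀ n ∈ O', ∀ i < L, a + δ * i + n ∈ O

theorem SumIn.two {ε ε' p p' L a : ℕ} {O : Set ℕ} (h : SumIn ε' p' a 2 L O)
    (hp' : 1 ≤ p') (hL : 1 ≤ L) (hp : p + 1 ≤ p' + L) (hε : ε ≤ ε' ∨ ε ≤ 1 ∧ 2 ≤ L) :
    Good ε p O := by
  obtain ⟨O', h, hO⟩ := h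
  exact h.add_two hO hp' hL hp hε

theorem SumIn.one {ε ε' p p' L a : ℕ} {O : Set ℕ} (h : SumIn ε' p' a 1 L O)
    (hp' : 1 ≤ p') (hL : 1 ≤ L) (hp : p + 1 + ε ≤ p' + L + ε') (hp2 : p + 1 ≤ p' + L)
    (hε : ε = 0 ∨ 2 ≤ L ∧ p + ε ≤ 2 * p' + L - 2) : Good ε p O := by
  obtain ⟨O', h, hO⟩ := h
  exact h.add_one (by simpa using hO) hp' hL hp hp2 hε

theorem Indep.mono {X Y : Finset V} (h : Indep G Y) (hX : X ⊆ Y) : Indep G X :=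
  fun a ha b hb => h a (hX ha) b (hX hb)

theorem TriFree.indep_nbr (h : TriFree G) (U : Finset V) (c : V) : Indep G (nbr G U {c}) := by
  intro a ha b hb hab
  rw [mem_nbr_singleton] at ha hb
  exact h c a b ha.2 hab hb.2

/-- Pieces of pieces. -/
theorem Sep.trans {U B C M D : Finset V} (hM : Sep G U B M) (hD : Sep G M C D) :
    Sep G U (B ∪ C) D :=
  ⟨hD.sub.trans hM.sub, hD.ne, Finset.disjoint_union_right.2
    ⟨Finset.disjoint_of_subset_left hD.sub hM.disj, hD.disj⟩, fun a ha b hb hab => by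
      rcases hM.closed a (hD.sub ha) b hb hab with h | h
      · rcases hD.closed a ha b h hab with h | h <;> simp [h]
      · simp [h]⟩

/-- Shrinking the separator of a piece to the part it actually sees. -/
theorem Sep.shrink {U B D B' : Finset V} (h : Sep G U B D) (hd : Disjoint D B')
    (hB : ∀ a ∈ D, ∀ b ∈ B, b ∉ B' → ¬ G.Adj a b) : Sep G U B' D :=
  ⟨h.sub, h.ne, hd, fun a ha b hb hab => (h.closed a ha b hb hab).imp_right (fun h => by
    by_contra h'; exact hB a ha b h h' hab)⟩

variable (G) in
/-- A component of `U \ H` meeting `Y` without neighbours in `R`. -/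
def HangI (U H R Y M : Finset V) : Prop :=
  Sep G U H M ∧ Conn G M ∧ (M ∩ Y).Nonempty ∧ ∀ w ∈ M, w ∉ nbr G U R

variable (G) in
/-- An end piece `D`, attached at `c`, of a component `M` of `U \ H`, such that `D` avoids `Y`
and has no neighbours in `R`. -/
def HangII (U H R Y M : Finset V) (c : V) (D : Finset V) : Prop :=
  Sep G U H M ∧ Conn G M ∧ (M ∩ Y).Nonempty ∧ c ∈ M ∧ Sep G M {c} D ∧ Conn G D ∧
    Disjoint D Y ∧ ∀ w ∈ D, w ∉ nbr G U R

/-- Degree bound inside a piece. -/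
theorem Sep.dg_le {U H M : Finset V} (hM : Sep G U H M) {w : V} (hw : w ∈ M) :
    dg G (U \ H) w ≤ dg G M w := by
  refine le_trans (dg_le_of_closed (D := M) (B := ∅) ?_) (by simp [dg])
  intro b hb hab
  rw [Finset.mem_sdiff] at hb
  exact Or.inl ((hM.closed w hw b hb.1 hab).resolve_right hb.2)

theorem core_main {ε p a δ L : ℕ} {U X Y H R : Finset V} (hH : H ⊆ U) (hR : R ⊆ H)
    (hne : R.Nonempty) (hY : Y ⊆ U) (ih : PathThm G ε U.card) (hp : 1 ≤ p)
    (hadm : ε = 0 ∨ ε = 1 ∧ TriFree G ∧ Indep G Y)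
    (hdeg : p ≤ 1 ∨ ∀ w ∈ U, w ∉ H → p + 1 ≤ dg G (U \ H) w + ind (nbr G U R) w + ind Y w)
    (hord : ∀ r ∈ R, ∀ i < L, a + δ * i ∈ Ord G H X {r}) :
    SumIn ε p a δ L (Ord G U X Y) ∨ Y ⊆ H ∨ (∃ M, HangI G U H R Y M) ∨
      ∃ M c D, HangII G U H R Y M c D := by
  by_cases hYH : Y ⊆ H
  · exact Or.inr (Or.inl hYH)
  obtain ⟨y, hy, hyH⟩ := Finset.not_subset.1 hYH
  obtain ⟨M, hyM, hMc, hM⟩ := exists_component (G := G) (hY hy) hyH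
  have hMY : (M ∩ Y).Nonempty := ⟨y, by simp [hyM, hy]⟩
  by_cases hI : ∀ w ∈ M, w ∉ nbr G U R
  · exact Or.inr (Or.inr (Or.inl ⟨M, hM, hMc, hMY, hI⟩))
  push Not at hI
  obtain ⟨x, hxM, hx⟩ := hI
  by_cases hpiece : ∀ c D, Sep G M {c} D → Disjoint D (nbr G M R) → ¬ Disjoint D (M ∩ Y)
  · left
    have hnbr : ∀ w ∈ M, w ∈ nbr G U R → w ∈ nbr G M R := fun w hw h => by
      rw [mem_nbr] at h ⊢; exact ⟨hw, h.2⟩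
    refine ⟨_, ih M (nbr G M R) (M ∩ Y) p ?_ hp ?_ ⟨hMc, nbr_subset _ _, Finset.inter_subset_left,
      ⟨x, hnbr x hxM hx⟩, hMY, hpiece⟩ ?_, ?_⟩
    · refine Finset.card_lt_card ⟨hM.sub, fun h => ?_⟩
      obtain ⟨r, hr⟩ := hne
      exact Finset.disjoint_right.1 hM.disj (hR hr) (h (hH (hR hr)))
    · rcases hadm with h | ⟨h1, h2, h3⟩
      · exact Or.inl h
      · exact Or.inr ⟨h1, h2, Or.inr (h3.mono Finset.inter_subset_right)⟩
    · rcases hdeg with h | hdeg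
      · exact Or.inl h
      · refine Or.inr fun w hw => ?_
        have h1 := hdeg w (hM.sub hw) (Finset.disjoint_left.1 hM.disj hw)
        have h2 := hM.dg_le hw
        have h3 := ind_mono (hnbr w hw)
        have h4 : ind Y w ≤ ind (M ∩ Y) w := ind_mono (fun h => by simp [hw, h])
        omega
    · intro n hn i hi
      have := Ord.glue (U := U) (X := X) hH hM.sub hM.disj.symm (n := a + δ * i) (fun x hx => by
        obtain ⟨r, hr, hrx⟩ := (mem_nbr.1 hx).2
        exact ⟨r, hrx, hord r hr i hi⟩) hn
      exact Ord.mono this subset_rfl subset_rfl Finset.inter_subset_right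
  · right; right; right
    push Not at hpiece
    obtain ⟨c, D, hD, hDR, hDY⟩ := hpiece
    have hc : c ∈ M := by
      by_contra hc
      have : D = M := hMc.2 _ ⟨hD.sub, hD.ne, by simp, fun a ha b hb hab => Or.inl <|
        (hD.closed a ha b hb hab).resolve_right fun h => hc ((Finset.mem_singleton.1 h) ▸ hb)⟩
      rw [this] at hDY
      exact Finset.disjoint_left.1 hDY hyM (by simp [hyM, hy])
    obtain ⟨z, hz⟩ := hD.ne
    obtain ⟨D', hD'D, -, hD'c, hD'⟩ := hD.exists_conn hz
    refine ⟨M, c, D', hM, hMc, hMY, hc, hD', hD'c, ?_, ?_⟩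
    · rw [Finset.disjoint_left] at hDY ⊢
      intro w hw hwY
      exact hDY (hD'D hw) (by simp [hwY, hD'.sub hw])
    · intro w hw hwR
      exact Finset.disjoint_left.1 hDR (hD'D hw) (by
        rw [mem_nbr] at hwR ⊢; exact ⟨hD'.sub hw, hwR.2⟩)

variable (G) in
/-- A piece `D` of `U \ H` from which every path to `Z` extends to `Y` by `t` more vertices. -/
structure Hang (U H R Y D Z : Finset V) (t : ℕ) : Prop where
  conn : Conn G D
  sub : D ⊆ U
  disj : Disjoint D H
  noR : ∀ w ∈ D, w ∉ nbr G U R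
  subZ : Z ⊆ D
  neZ : Z.Nonempty
  ext : ∀ A n, n ∈ Ord G D A Z → n + t ∈ Ord G (U \ H) A Y
  deg : ∀ w ∈ D, dg G (U \ H) w + ind Y w ≤ dg G D w + ind Z w
  piece : ∀ c D', Sep G D {c} D' → Disjoint D' Z → Sep G U (insert c H) D' ∧ Disjoint D' Y
  whole : Sep G U H D ∨ ∃ c ∈ U, c ∉ D ∧ Sep G U (insert c H) D ∧ Disjoint D Y
  indep : TriFree G → Indep G Y → Indep G Z

theorem HangI.hang {U H R Y M : Finset V} (h : HangI G U H R Y M) :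
    Hang G U H R Y M (M ∩ Y) 0 := by
  obtain ⟨hM, hMc, hMY, hMR⟩ := h
  refine ⟨hMc, hM.sub, hM.disj, hMR, Finset.inter_subset_left, hMY, ?_, ?_, ?_, Or.inl hM,
    fun _ h => h.mono Finset.inter_subset_right⟩
  · intro A n hn
    refine Ord.mono hn ?_ subset_rfl Finset.inter_subset_right
    rw [Finset.subset_sdiff]
    exact ⟨hM.sub, hM.disj⟩
  · intro w hw
    have h2 := hM.dg_le hw
    have h4 : ind Y w ≤ ind (M ∩ Y) w := ind_mono (fun h => by simp [hw, h])
    omega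
  · intro c D' hD' hdY
    refine ⟨?_, ?_⟩
    · have := hM.trans hD'
      rwa [Finset.union_comm, ← Finset.insert_eq] at this
    · rw [Finset.disjoint_left] at hdY ⊢
      intro w hw hwY
      exact hdY hw (by simp [hwY, hD'.sub hw])

theorem HangII.hang {U H R Y M D : Finset V} {c : V} (h : HangII G U H R Y M c D) :
    ∃ t, Hang G U H R Y D (nbr G D {c}) t := by
  obtain ⟨hM, hMc, ⟨y, hy⟩, hc, hD, hDc, hDY, hDR⟩ := h
  rw [Finset.mem_inter] at hy
  have hyD : y ∉ D := fun h => Finset.disjoint_left.1 hDY h hy.2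
  have hcD : c ∉ D := by simpa using hD.disj
  have hR := hMc.sdiff hD hc
  obtain ⟨S, hS, hSp⟩ := hR.path (a := c) (b := y) (by simp [hc, hcD]) (by simp [hy.1, hyD])
  have hMH : M ⊆ U \ H := Finset.subset_sdiff.2 ⟨hM.sub, hM.disj⟩
  have hsep := hM.trans hD
  rw [Finset.union_comm, ← Finset.insert_eq] at hsep
  refine ⟨S.card, hDc, hD.sub.trans hM.sub, Finset.disjoint_of_subset_left hD.sub hM.disj, hDR,
    nbr_subset _ _, ?_, ?_, ?_, ?_, Or.inr ⟨c, hM.sub hc, hcD, hsep, hDY⟩,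
    fun h _ => h.indep_nbr _ _⟩
  · obtain ⟨a, ha, b, hb, hbD, hab⟩ := hMc.exists_adj hD.sub hD.ne (by rintro rfl; exact hcD hc)
    have := (hD.closed a ha b hb hab).resolve_left hbD
    rw [Finset.mem_singleton] at this
    subst this
    exact ⟨a, mem_nbr_singleton.2 ⟨ha, hab.symm⟩⟩
  · intro A n hn
    have h1 : S.card ∈ Ord G (M \ D) Y {c} :=
      ⟨S, y, c, hS, hy.2, by simp, hSp.symm, rfl⟩
    rw [Ord.comm] at hn ⊢
    rw [add_comm]
    exact Ord.glue (Finset.sdiff_subset.trans hMH) (hD.sub.trans hMH) Finset.sdiff_disjoint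
      (fun x hx => ⟨c, (mem_nbr_singleton.1 hx).2, h1⟩) hn
  · intro w hw
    have h1 := hM.dg_le (hD.sub hw)
    have h2 := dg_le_of_closed (hD.closed w hw)
    rw [dg_singleton_of_mem hw] at h2
    have h3 : ind Y w = 0 := ind_of_notMem (Finset.disjoint_left.1 hDY hw)
    omega
  · intro c' D' hD' hdZ
    refine ⟨?_, Finset.disjoint_of_subset_left hD'.sub hDY⟩
    refine (hsep.trans hD').shrink ?_ ?_
    · rw [Finset.disjoint_insert_right]
      exact ⟨by simpa using hD'.disj, Finset.disjoint_of_subset_left (hD'.sub.trans hD.sub) hM.disj⟩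
    · intro a ha b hb hb' hab
      simp only [Finset.mem_union, Finset.mem_insert, Finset.mem_singleton, not_or] at hb hb'
      obtain rfl : b = c := by tauto
      exact Finset.disjoint_left.1 hdZ ha (mem_nbr_singleton.2 ⟨hD'.sub ha, hab.symm⟩)

theorem hang_step {ε p a δ L t : ℕ} {U X Y H R R' D Z : Finset V} (hU : ∀ D, Sep G U ∅ D → ¬ Disjoint D H)
    (hH : H ⊆ U) (hne : H.Nonempty) (hRR : H ⊆ R ∪ R') (ih : PathThm G ε U.card) (hp : 1 ≤ p)
    (hadm : ε = 0 ∨ ε = 1 ∧ TriFree G ∧ Indep G Y)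
    (hC : ∀ c D, Sep G U {c} D → Disjoint D H → ¬ Disjoint D Y)
    (hdeg : p ≤ 1 ∨ ∀ w ∈ U, w ∉ H → w ∉ nbr G U R →
      p + 1 ≤ dg G (U \ H) w + ind (nbr G U R') w + ind Y w)
    (hord : ∀ r ∈ R', ∀ i < L, a + δ * i ∈ Ord G H X {r}) (h : Hang G U H R Y D Z t) :
    SumIn ε p (a + t) δ L (Ord G U X Y) := by
  have hcard : D.card < U.card := by
    refine Finset.card_lt_card ⟨h.sub, fun h' => ?_⟩
    obtain ⟨r, hr⟩ := hne
    exact Finset.disjoint_right.1 h.disj hr (h' (hH hr))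
  have hnbr : ∀ w ∈ D, w ∈ nbr G U R' → w ∈ nbr G D R' := fun w hw h => by
    rw [mem_nbr] at h ⊢; exact ⟨hw, h.2⟩
  have hnoH : ∀ a ∈ D, ∀ b ∈ H, a ∉ nbr G D R' → ¬ G.Adj a b := by
    intro a ha b hb hna hab
    rcases Finset.mem_union.1 (hRR hb) with h' | h'
    · exact h.noR a ha (mem_nbr.2 ⟨h.sub ha, b, h', hab.symm⟩)
    · exact hna (mem_nbr.2 ⟨ha, b, h', hab.symm⟩)
  have hX : (nbr G D R').Nonempty := by
    by_contra hemp
    rw [Finset.not_nonempty_iff_eq_empty] at hemp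
    rcases h.whole with hw | ⟨c, hcU, hcD, hw, hwY⟩
    · exact hU D (hw.shrink (by simp) fun a ha b hb _ => hnoH a ha b hb (by simp [hemp])) h.disj
    · refine hC c D (hw.shrink (by simpa using hcD) fun a ha b hb hbc => ?_) h.disj hwY
      exact hnoH a ha b ((Finset.mem_insert.1 hb).resolve_left (by simpa using hbc)) (by simp [hemp])
  refine ⟨Ord G D (nbr G D R') Z, ih _ _ _ p hcard hp ?_ ⟨h.conn, nbr_subset _ _, h.subZ, hX, h.neZ,
    ?_⟩ ?_, ?_⟩
  · rcases hadm with h' | ⟨h1, h2, h3⟩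
    · exact Or.inl h'
    · exact Or.inr ⟨h1, h2, Or.inr (h.indep h2 h3)⟩
  · intro c D' hD' hdX hdZ
    obtain ⟨h1, h2⟩ := h.piece c D' hD' hdZ
    refine hC c D' (h1.shrink hD'.disj fun a ha b hb hbc => ?_)
      (Finset.disjoint_of_subset_left hD'.sub h.disj) h2
    exact hnoH a (hD'.sub ha) b ((Finset.mem_insert.1 hb).resolve_left (by simpa using hbc))
      (Finset.disjoint_left.1 hdX ha)
  · rcases hdeg with h' | hdeg
    · exact Or.inl h'
    · refine Or.inr fun w hw => ?_
      have h1 := hdeg w (h.sub hw) (Finset.disjoint_left.1 h.disj hw) (h.noR w hw)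
      have h2 := h.deg w hw
      have h3 := ind_mono (hnbr w hw)
      omega
  · intro n hn i hi
    have := Ord.glue (U := U) (X := X) hH Finset.sdiff_subset Finset.disjoint_sdiff
      (n := a + δ * i) (fun x hx => by
        obtain ⟨r, hr, hrx⟩ := (mem_nbr.1 hx).2
        exact ⟨r, hrx, hord r hr i hi⟩) (h.ext _ _ hn)
    convert this using 1
    ring

end Core
section Structures
variable {V : Type*} [DecidableEq V] {G : SimpleGraph V} [DecidableRel G.Adj]

theorem core_hang {ε p a δ L p' a' δ' L' : ℕ} {U X Y H R R' : Finset V}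
    (hU : ∀ D, Sep G U ∅ D → ¬ Disjoint D H)
    (hC : ∀ c D, Sep G U {c} D → Disjoint D H → ¬ Disjoint D Y)
    (hH : H ⊆ U) (hR : R ⊆ H) (hne : R.Nonempty) (hRR : H ⊆ R ∪ R') (hY : Y ⊆ U)
    (ih : PathThm G ε U.card) (hp : 1 ≤ p) (hp' : 1 ≤ p')
    (hadm : ε = 0 ∨ ε = 1 ∧ TriFree G ∧ Indep G Y)
    (hdeg : p ≤ 1 ∨ ∀ w ∈ U, w ∉ H → p + 1 ≤ dg G (U \ H) w + ind (nbr G U R) w + ind Y w)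
    (hord : ∀ r ∈ R, ∀ i < L, a + δ * i ∈ Ord G H X {r})
    (hdeg' : p' ≤ 1 ∨ ∀ w ∈ U, w ∉ H → w ∉ nbr G U R →
      p' + 1 ≤ dg G (U \ H) w + ind (nbr G U R') w + ind Y w)
    (hord' : ∀ r ∈ R', ∀ i < L', a' + δ' * i ∈ Ord G H X {r}) :
    SumIn ε p a δ L (Ord G U X Y) ∨ Y ⊆ H ∨
      ∃ t, SumIn ε p' (a' + t) δ' L' (Ord G U X Y) := by
  rcases core_main hH hR hne hY ih hp hadm hdeg hord with h | h | ⟨M, h⟩ | ⟨M, c, D, h⟩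
  · exact Or.inl h
  · exact Or.inr (Or.inl h)
  · exact Or.inr (Or.inr ⟨_, hang_step hU hH (hne.mono hR) hRR ih hp' hadm hC hdeg' hord' h.hang⟩)
  · obtain ⟨t, ht⟩ := h.hang
    exact Or.inr (Or.inr ⟨_, hang_step hU hH (hne.mono hR) hRR ih hp' hadm hC hdeg' hord' ht⟩)

variable (G) in
/-- An instance in which every end piece meets both terminal sets. -/
structure SInst (U X Y : Finset V) : Prop extends Inst G U X Y where
  strong : ∀ c D, Sep G U {c} D → ¬ Disjoint D X ∧ ¬ Disjoint D Y

theorem Inst.symm {U X Y : Finset V} (h : Inst G U X Y) : Inst G U Y X :=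
  ⟨h.conn, h.subY, h.subX, h.neY, h.neX, fun c D hD h1 h2 => h.piece c D hD h2 h1⟩

theorem SInst.symm {U X Y : Finset V} (h : SInst G U X Y) : SInst G U Y X :=
  ⟨h.toInst.symm, fun c D hD => (h.strong c D hD).symm⟩

theorem DegOK.symm {U X Y : Finset V} {p : ℕ} (h : DegOK G U X Y p) : DegOK G U Y X p :=
  h.imp_right fun h w hw => by have := h w hw; omega

theorem Adm.symm {ε : ℕ} {X Y : Finset V} (h : Adm G ε X Y) : Adm G ε Y X :=
  h.imp_right fun h => ⟨h.1, h.2.1, h.2.2.symm⟩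

theorem PathThm.mono {ε N N' : ℕ} (h : PathThm G ε N) (hN : N' ≤ N) : PathThm G ε N' :=
  fun M X Y p hM => h M X Y p (hM.trans_le hN)

theorem sep_erase {U : Finset V} {x y : V} (hy : y ∈ U) (hxy : y ≠ x) :
    Sep G U {x} (U.erase x) :=
  ⟨Finset.erase_subset _ _, ⟨y, by simp [hy, hxy]⟩, by simp, fun a _ b hb _ => by
    by_cases h : b = x <;> simp [h, hb]⟩

/-- In a nontrivial strong instance there are two terminals of each kind. -/
theorem SInst.exists_ne {U X Y : Finset V} (h : SInst G U X Y) {u v : V} (hu : u ∈ U) (hv : v ∈ U)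
    (huv : u ≠ v) (x : V) : ∃ x' ∈ X, x' ≠ x := by
  have hy : ∃ y ∈ U, y ≠ x := by
    by_cases hux : u = x
    · exact ⟨v, hv, by rintro rfl; exact huv hux⟩
    · exact ⟨u, hu, hux⟩
  obtain ⟨y, hy, hyx⟩ := hy
  have := (h.strong x _ (sep_erase hy hyx)).1
  rw [Finset.not_disjoint_iff] at this
  obtain ⟨a, ha, haX⟩ := this
  exact ⟨a, haX, (Finset.mem_erase.1 ha).1⟩

theorem exists_adj_of_deg {U X Y : Finset V} (hU : U.Nonempty) {p : ℕ} (hp : 2 ≤ p)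
    (h : DegOK G U X Y p) : ∃ u ∈ U, ∃ v ∈ U, u ≠ v := by
  obtain ⟨w, hw⟩ := hU
  have h1 := (h.resolve_left (by omega)) w hw
  have := ind_le X w
  have := ind_le Y w
  obtain ⟨x, hx, hwx⟩ := dg_pos.1 (show 0 < dg G U w by omega)
  exact ⟨w, hw, x, hx, hwx.ne⟩

/-- Deleting a terminal `b ∈ Y` when the remaining part of `X` lies in `H`. -/
theorem SInst.erase {U X Y H : Finset V} (h : SInst G U X Y) {b : V} (hb : b ∈ U)
    (hX : X.erase b ⊆ H) :
    (∀ D, Sep G (U.erase b) ∅ D → ¬ Disjoint D H) ∧ ∀ c D, Sep G (U.erase b) {c} D →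
      Disjoint D H → ¬ Disjoint D (nbr G (U.erase b) {b}) := by
  have hX' : ∀ D, b ∉ D → Disjoint D H → Disjoint D X := fun D hbD hD => by
    rw [Finset.disjoint_left] at hD ⊢
    intro x hx hxX
    exact hD hx (hX (Finset.mem_erase.2 ⟨by rintro rfl; exact hbD hx, hxX⟩))
  constructor
  · intro D hD hDH
    have hbD : b ∉ D := fun h => by simpa using hD.sub h
    refine (h.strong b D ⟨hD.sub.trans (Finset.erase_subset _ _), hD.ne, by simpa using hbD,
      fun x hx y hy hxy => ?_⟩).1 (hX' D hbD hDH)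
    by_cases hyb : y = b
    · simp [hyb]
    · left
      simpa using hD.closed x hx y (Finset.mem_erase.2 ⟨hyb, hy⟩) hxy
  · intro c D hD hDH hDb
    have hbD : b ∉ D := fun h => by simpa using hD.sub h
    refine (h.strong c D ⟨hD.sub.trans (Finset.erase_subset _ _), hD.ne, hD.disj,
      fun x hx y hy hxy => ?_⟩).1 (hX' D hbD hDH)
    by_cases hyb : y = b
    · subst hyb
      exact absurd (mem_nbr_singleton.2 ⟨hD.sub hx, hxy.symm⟩) (Finset.disjoint_left.1 hDb hx)
    · exact hD.closed x hx y (Finset.mem_erase.2 ⟨hyb, hy⟩) hxy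

theorem Ord.erase_succ {U X Y : Finset V} {b : V} (hb : b ∈ U) (hbY : b ∈ Y) {n : ℕ}
    (h : n ∈ Ord G (U.erase b) (X.erase b) (nbr G (U.erase b) {b})) : n + 1 ∈ Ord G U X Y := by
  rw [Ord.comm] at h ⊢
  rw [add_comm]
  have h1 : 1 ∈ Ord G {b} Y {b} := Ord.single (by simp) hbY (by simp)
  have := Ord.glue (U := U) (by simpa using hb) (Finset.erase_subset b U) (by simp)
    (fun x hx => ⟨b, (mem_nbr_singleton.1 hx).2, h1⟩) h
  exact Ord.mono this subset_rfl subset_rfl (Finset.erase_subset _ _)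

theorem SumIn.shift {ε p a δ L t : ℕ} {O O' : Set ℕ} (h : SumIn ε p a δ L O)
    (hO : ∀ n ∈ O, n + t ∈ O') : SumIn ε p (a + t) δ L O' := by
  obtain ⟨O'', h1, h2⟩ := h
  refine ⟨O'', h1, fun n hn i hi => ?_⟩
  convert hO _ (h2 n hn i hi) using 1
  ring

/-- Final step when `X` is almost contained in the structure `H`: delete `b ∈ Y`. -/
theorem fin_step {ε p a δ L p' a' δ' L' : ℕ} {U X Y H R R' : Finset V} {b : V}
    (h : SInst G U X Y) (hb : b ∈ Y) (hX : X.erase b ⊆ H)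
    (hH : H ⊆ U.erase b) (hR : R ⊆ H) (hne : R.Nonempty) (hRR : H ⊆ R ∪ R')
    (ih : PathThm G ε U.card) (hp : 1 ≤ p) (hp' : 1 ≤ p')
    (hadm : ε = 0 ∨ ε = 1 ∧ TriFree G)
    (hdeg : p ≤ 1 ∨ ∀ w ∈ U, w ≠ b → w ∉ H →
      p + 1 + dg G H w ≤ dg G U w + ind (nbr G U R) w)
    (hord : ∀ r ∈ R, ∀ i < L, a + δ * i ∈ Ord G H (X.erase b) {r})
    (hdeg' : p' ≤ 1 ∨ ∀ w ∈ U, w ≠ b → w ∉ H → w ∉ nbr G U R →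
      p' + 1 + dg G H w ≤ dg G U w + ind (nbr G U R') w)
    (hord' : ∀ r ∈ R', ∀ i < L', a' + δ' * i ∈ Ord G H (X.erase b) {r}) :
    SumIn ε p (a + 1) δ L (Ord G U X Y) ∨ nbr G (U.erase b) {b} ⊆ H ∨
      ∃ t, SumIn ε p' (a' + t) δ' L' (Ord G U X Y) := by
  have hbU := h.subY hb
  obtain ⟨h1, h2⟩ := h.erase hbU hX
  have hdg : ∀ w ∈ U, w ≠ b → dg G U w ≤ dg G (U.erase b \ H) w + dg G H w +
      ind (nbr G (U.erase b) {b}) w := by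
    intro w hw hwb
    rw [dg_sdiff_add hH, ← dg_singleton_of_mem (Finset.mem_erase.2 ⟨hwb, hw⟩)]
    refine dg_le_of_closed fun x hx _ => ?_
    by_cases hxb : x = b <;> simp [hxb, hx]
  have hnb : ∀ w R, w ∈ U → w ≠ b → (w ∈ nbr G U R ↔ w ∈ nbr G (U.erase b) R) := by
    intro w R hw hwb
    simp [mem_nbr, hw, hwb]
  have hd1 : p ≤ 1 ∨ ∀ w ∈ U.erase b, w ∉ H → p + 1 ≤ dg G (U.erase b \ H) w +
      ind (nbr G (U.erase b) R) w + ind (nbr G (U.erase b) {b}) w := by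
    refine hdeg.imp_right fun hd w hw hwH => ?_
    rw [Finset.mem_erase] at hw
    have := hd w hw.2 hw.1 hwH
    have := hdg w hw.2 hw.1
    have := ind_mono (hnb w R hw.2 hw.1).1
    omega
  have hd2 : p' ≤ 1 ∨ ∀ w ∈ U.erase b, w ∉ H → w ∉ nbr G (U.erase b) R → p' + 1 ≤
      dg G (U.erase b \ H) w + ind (nbr G (U.erase b) R') w + ind (nbr G (U.erase b) {b}) w := by
    refine hdeg'.imp_right fun hd w hw hwH hwR => ?_
    rw [Finset.mem_erase] at hw
    have := hd w hw.2 hw.1 hwH (by rwa [hnb w R hw.2 hw.1])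
    have := hdg w hw.2 hw.1
    have := ind_mono (hnb w R' hw.2 hw.1).1
    omega
  rcases core_hang (X := X.erase b) h1 h2 hH hR hne hRR (nbr_subset _ _)
    (ih.mono (Finset.card_le_card (Finset.erase_subset _ _))) hp hp'
    (hadm.imp_right fun h => ⟨h.1, h.2, h.2.indep_nbr _ _⟩) hd1 hord hd2 hord' with
    h3 | h3 | ⟨t, h3⟩
  · exact Or.inl (h3.shift fun n hn => Ord.erase_succ hbU hb hn)
  · exact Or.inr (Or.inl h3)
  · exact Or.inr (Or.inr ⟨t + 1, by
      rw [← add_assoc]; exact h3.shift fun n hn => Ord.erase_succ hbU hb hn⟩)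

theorem Ord.snoc {U X W : Finset V} {r : V} {n : ℕ} (hW : W ⊆ U) (hrU : r ∈ U) (hr : r ∉ W)
    {r' : V} (hrr : G.Adj r' r) (h : n ∈ Ord G W X {r'}) : n + 1 ∈ Ord G U X {r} :=
  Ord.glue (Y := {r}) (A := {r}) (M := {r}) hW (by simpa using hrU) (by simpa using hr)
    (fun x hx => ⟨r', by simpa [Finset.mem_singleton.1 hx] using hrr, h⟩)
    (Ord.single (a := r) (by simp) (by simp) (by simp))

variable (G) in
/-- `K` is a clique. -/
def Clique (K : Finset V) : Prop := ∀ a ∈ K, ∀ b ∈ K, a ≠ b → G.Adj a b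

theorem Clique.mono {K K' : Finset V} (h : Clique G K) (hK : K' ⊆ K) : Clique G K' :=
  fun a ha b hb => h a (hK ha) b (hK hb)

theorem Clique.ord {K : Finset V} (h : Clique G K) {e : ℕ} {r : V} (hr : r ∈ K) (h1 : 1 ≤ e)
    (h2 : e ≤ K.card) : e ∈ Ord G K K {r} := by
  induction e, h1 using Nat.le_induction generalizing K r with
  | base => exact Ord.single hr hr (by simp)
  | succ e he ih =>
    have hc := Finset.card_erase_of_mem hr
    obtain ⟨r', hr'⟩ : (K.erase r).Nonempty := Finset.card_pos.1 (by omega)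
    have := ih (h.mono (Finset.erase_subset r K)) hr' (by omega)
    have h3 := Finset.mem_erase.1 hr'
    exact Ord.mono (Ord.snoc (Finset.erase_subset r K) hr (by simp) (h _ h3.2 _ hr h3.1) this)
      subset_rfl (Finset.erase_subset _ _) subset_rfl

variable (G) in
/-- All edges between `A` and `B` are present. -/
def Compl (A B : Finset V) : Prop := ∀ a ∈ A, ∀ b ∈ B, G.Adj a b

theorem Compl.mono {A B A' B' : Finset V} (h : Compl G A B) (hA : A' ⊆ A) (hB : B' ⊆ B) :
    Compl G A' B' := fun a ha b hb => h a (hA ha) b (hB hb)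

theorem Compl.disjoint {A B : Finset V} (h : Compl G A B) : Disjoint A B :=
  Finset.disjoint_left.2 fun x hx hx' => (h x hx x hx').ne rfl

theorem Compl.ord_aux (e : ℕ) : ∀ A B : Finset V, Compl G A B →
    ((∀ a ∈ A, e ≤ B.card → e + 1 ≤ A.card → 2 * e + 1 ∈ Ord G (A ∪ B) A {a}) ∧
     ∀ b ∈ B, e + 1 ≤ B.card → e + 1 ≤ A.card → 2 * e + 2 ∈ Ord G (A ∪ B) A {b}) := by
  induction e with
  | zero =>
    intro A B h
    refine ⟨fun a ha _ _ => Ord.single (by simp [ha]) ha (by simp), fun b hb _ hA => ?_⟩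
    obtain ⟨a, ha⟩ := Finset.card_pos.1 (show 0 < A.card by omega)
    have hbA : b ∉ A := fun h' => Finset.disjoint_left.1 h.disjoint h' hb
    exact Ord.snoc (W := A) Finset.subset_union_left (by simp [hb]) hbA (h a ha b hb)
      (Ord.single ha ha (by simp))
  | succ e ih =>
    have key : ∀ A B : Finset V, Compl G A B → ∀ a ∈ A, e + 1 ≤ B.card → e + 1 + 1 ≤ A.card →
        2 * (e + 1) + 1 ∈ Ord G (A ∪ B) A {a} := by
      intro A B h a ha hB hA
      obtain ⟨b, hb⟩ := Finset.card_pos.1 (show 0 < B.card by omega)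
      have hc := Finset.card_erase_of_mem ha
      have := (ih (A.erase a) B (h.mono (Finset.erase_subset _ _) subset_rfl)).2 b hb hB (by omega)
      have haB : a ∉ B := fun h' => Finset.disjoint_left.1 h.disjoint ha h'
      refine Ord.mono (Ord.snoc (U := A ∪ B) (W := A.erase a ∪ B) (Finset.union_subset_union_left
        (Finset.erase_subset _ _)) (by simp [ha]) (by simp [haB]) (h a ha b hb).symm this)
        subset_rfl (Finset.erase_subset _ _) subset_rfl
    intro A B h
    refine ⟨key A B h, fun b hb hB hA => ?_⟩
    obtain ⟨a, ha⟩ := Finset.card_pos.1 (show 0 < A.card by omega)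
    have hc := Finset.card_erase_of_mem hb
    have := key A (B.erase b) (h.mono subset_rfl (Finset.erase_subset _ _)) a ha (by omega) hA
    have hbA : b ∉ A := fun h' => Finset.disjoint_left.1 h.disjoint h' hb
    exact Ord.snoc (U := A ∪ B) (W := A ∪ B.erase b) (Finset.union_subset_union_right
        (Finset.erase_subset _ _)) (by simp [hb]) (by simp [hbA]) (h a ha b hb) this

/-- Odd orders of paths from `A` to `a ∈ A` in a complete bipartite graph. -/
theorem Compl.ord_odd {A B : Finset V} (h : Compl G A B) {a : V} (ha : a ∈ A) {e : ℕ}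
    (h1 : e ≤ B.card) (h2 : e + 1 ≤ A.card) : 1 + 2 * e ∈ Ord G (A ∪ B) A {a} := by
  rw [add_comm]; exact (Compl.ord_aux e A B h).1 a ha h1 h2

/-- Even orders of paths from `A` to `b ∈ B` in a complete bipartite graph. -/
theorem Compl.ord_even {A B : Finset V} (h : Compl G A B) {b : V} (hb : b ∈ B) {e : ℕ}
    (h1 : e + 1 ≤ B.card) (h2 : e + 1 ≤ A.card) : 2 + 2 * e ∈ Ord G (A ∪ B) A {b} := by
  rw [add_comm]; exact (Compl.ord_aux e A B h).2 b hb h1 h2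

/-- All orders from `X` to `a ∈ A`, when `X` contains `A` and a vertex of `B`. -/
theorem Compl.ord_all {A B X : Finset V} (h : Compl G A B) (hA : A ⊆ X) {b : V} (hb : b ∈ B)
    (hbX : b ∈ X) (hc : B.card ≤ A.card) {a : V} (ha : a ∈ A) {i : ℕ} (hi : i < 2 * B.card) :
    1 + i ∈ Ord G (A ∪ B) X {a} := by
  rcases Nat.even_or_odd' i with ⟨e, rfl | rfl⟩
  · exact Ord.mono (h.ord_odd ha (by omega) (by omega)) subset_rfl hA subset_rfl
  · have hc' := Finset.card_erase_of_mem hb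
    have h1 := (h.mono subset_rfl (Finset.erase_subset b B)).ord_odd ha (e := e) (by omega) (by omega)
    have hbA : b ∉ A := fun h' => Finset.disjoint_left.1 h.disjoint h' hb
    have := Ord.glue (U := A ∪ B) (H := {b}) (M := A ∪ B.erase b) (X := X) (n := 1) (by simp [hb])
      (Finset.union_subset_union_right (Finset.erase_subset _ _)) (by simp [hbA])
      (fun x hx => ⟨b, (h x hx b hb).symm, Ord.single (by simp) hbX (by simp)⟩) h1
    convert this using 1
    ring

theorem exists_max_finset {U : Finset V} (P : Finset V → Prop) {A : Finset V} (hA : A ⊆ U)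
    (hP : P A) : ∃ B, P B ∧ A ⊆ B ∧ B ⊆ U ∧ ∀ w ∈ U, w ∉ B → ¬ P (insert w B) := by
  classical
  obtain ⟨B, hB, hmax⟩ := Finset.exists_max_image
    (U.powerset.filter (fun B => P B ∧ A ⊆ B)) Finset.card ⟨A, by simp [hA, hP]⟩
  simp only [Finset.mem_filter, Finset.mem_powerset] at hB hmax
  refine ⟨B, hB.2.1, hB.2.2, hB.1, fun w hw hwB hPw => ?_⟩
  have := hmax (insert w B) ⟨Finset.insert_subset hw hB.1, hPw,
    hB.2.2.trans (Finset.subset_insert _ _)⟩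
  rw [Finset.card_insert_of_notMem hwB] at this
  omega

end Structures
section CliqueSteps
variable {V : Type*} [DecidableEq V] {G : SimpleGraph V} [DecidableRel G.Adj]

theorem Inst.good_of_piece {ε p : ℕ} {U X Y D : Finset V} {c : V} (h : Inst G U X Y)
    (ih : PathThm G ε U.card) (hp : 1 ≤ p) (hadm : Adm G ε X Y) (hdeg : DegOK G U X Y p)
    (hD : Sep G U {c} D) (hDY : Disjoint D Y) : Good ε p (Ord G U X Y) := by
  have hcD : c ∉ D := by simpa using hD.disj
  have hc : c ∈ U := by
    by_contra hc
    have : D = U := h.conn.2 _ ⟨hD.sub, hD.ne, by simp, fun a ha b hb hab => Or.inl <|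
        (hD.closed a ha b hb hab).resolve_right fun h => hc ((Finset.mem_singleton.1 h) ▸ hb)⟩
    obtain ⟨y, hy⟩ := h.neY
    exact Finset.disjoint_left.1 hDY (this ▸ h.subY hy) hy
  obtain ⟨z, hz⟩ := hD.ne
  obtain ⟨D', hD'D, -, hDc, hD'⟩ := hD.exists_conn hz
  replace hDY := Finset.disjoint_of_subset_left hD'D hDY
  clear hD
  have hcD : c ∉ D' := by simpa using hD'.disj
  have hlt : D' ⊂ U := ⟨hD'.sub, fun h => hcD (h hc)⟩
  have hX : (X ∩ D').Nonempty := by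
    by_contra hX
    refine h.piece c D' hD' ?_ hDY
    rwa [Finset.not_nonempty_iff_eq_empty, Finset.inter_comm, ← Finset.disjoint_iff_inter_eq_empty]
      at hX
  have hN : (nbr G D' {c}).Nonempty := by
    obtain ⟨a, ha, b, hb, hbD, hab⟩ := h.conn.exists_adj hD'.sub hD'.ne hlt.ne
    have := (hD'.closed a ha b hb hab).resolve_left hbD
    rw [Finset.mem_singleton] at this
    subst this
    exact ⟨a, mem_nbr_singleton.2 ⟨ha, hab.symm⟩⟩
  obtain ⟨y, hy⟩ := h.neY
  have hyD : y ∉ D' := fun h => Finset.disjoint_left.1 hDY h hy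
  obtain ⟨S, hS, hSp⟩ := (h.conn.sdiff hD' hc).path (a := c) (b := y) (by simp [hc, hcD])
    (by simp [h.subY hy, hyD])
  have hgood := ih D' (X ∩ D') (nbr G D' {c}) p (Finset.card_lt_card hlt) hp
    (hadm.imp_right fun h => ⟨h.1, h.2.1, Or.inr (h.2.1.indep_nbr _ _)⟩)
    ⟨hDc, Finset.inter_subset_right, nbr_subset _ _, hX, hN, fun c' D₁ hD₁ h1 h2 => by
      refine h.piece c' D₁ ((hD'.trans hD₁).shrink hD₁.disj ?_) ?_
        (Finset.disjoint_of_subset_left hD₁.sub hDY)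
      · intro a ha b hb hb' hab
        obtain rfl : b = c := by simp at hb hb'; tauto
        exact Finset.disjoint_left.1 h2 ha (mem_nbr_singleton.2 ⟨hD₁.sub ha, hab.symm⟩)
      · rw [Finset.disjoint_left] at h1 ⊢
        intro w hw hwX
        exact h1 hw (by simp [hwX, hD₁.sub hw])⟩
    (hdeg.imp_right fun hd w hw => by
      have h1 := hd w (hD'.sub hw)
      have h2 := dg_le_of_closed (hD'.closed w hw)
      rw [dg_singleton_of_mem hw] at h2
      have h3 : ind Y w = 0 := ind_of_notMem (Finset.disjoint_left.1 hDY hw)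
      have h4 : ind X w ≤ ind (X ∩ D') w := ind_mono (fun h => by simp [hw, h])
      omega)
  refine hgood.shift S.card fun n hn => ?_
  rw [Ord.comm] at hn ⊢
  rw [add_comm]
  have h1 : S.card ∈ Ord G (U \ D') Y {c} := ⟨S, y, c, hS, hy, by simp, hSp.symm, rfl⟩
  exact Ord.mono (Ord.glue (Finset.sdiff_subset) (hD'.sub) Finset.sdiff_disjoint
      (fun x hx => ⟨c, (mem_nbr_singleton.1 hx).2, h1⟩) hn) subset_rfl subset_rfl
      Finset.inter_subset_left

theorem Inst.good_or_strong {ε p : ℕ} {U X Y : Finset V} (h : Inst G U X Y)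
    (ih : PathThm G ε U.card) (hp : 1 ≤ p) (hadm : Adm G ε X Y) (hdeg : DegOK G U X Y p) :
    Good ε p (Ord G U X Y) ∨ SInst G U X Y := by
  by_cases hs : ∀ c D, Sep G U {c} D → ¬ Disjoint D X ∧ ¬ Disjoint D Y
  · exact Or.inr ⟨h, hs⟩
  left
  push Not at hs
  obtain ⟨c, D, hD, hs⟩ := hs
  by_cases hX : Disjoint D X
  · rw [Ord.comm]
    exact h.symm.good_of_piece ih hp hadm.symm hdeg.symm hD hX
  · exact h.good_of_piece ih hp hadm hdeg hD (hs hX)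

theorem dg_succ_le {K : Finset V} {w x : V} (hx : x ∈ K) (hw : ¬ G.Adj w x) :
    dg G K w + 1 ≤ K.card :=
  Finset.card_lt_card (Finset.filter_ssubset.2 ⟨x, hx, hw⟩)

theorem SInst.hU {U X Y H : Finset V} (h : SInst G U X Y) (hH : H ⊆ U) (hne : H.Nonempty) :
    ∀ D, Sep G U ∅ D → ¬ Disjoint D H := by
  intro D hD hd
  obtain ⟨x, hx⟩ := hne
  exact Finset.disjoint_right.1 hd hx (h.conn.2 D hD ▸ hH hx)

theorem clique_step {p : ℕ} {U X Y : Finset V} (h : SInst G U X Y) (ih : PathThm G 0 U.card)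
    (hdeg : ∀ w ∈ U, p + 1 ≤ dg G U w + ind X w + ind Y w) (hp : 2 ≤ p)
    {a b : V} (ha : a ∈ X) (hb : b ∈ X) (hab : G.Adj a b) :
    Good 0 p (Ord G U X Y) ∨ ∃ K ⊆ X, Clique G K ∧ Y ⊆ K := by
  obtain ⟨K, hK, habK, hKX, hmax⟩ := exists_max_finset (U := X) (Clique G) (A := {a, b})
    (by simp [Finset.insert_subset_iff, ha, hb]) (by
      intro x hx y hy hxy
      simp only [Finset.mem_insert, Finset.mem_singleton] at hx hy
      rcases hx with rfl | rfl <;> rcases hy with rfl | rfl <;> simp_all [hab.symm])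
  have h2 : 2 ≤ K.card := by
    rw [← Finset.card_pair hab.ne]; exact Finset.card_le_card habK
  have hKU := hKX.trans h.subX
  have hKne : K.Nonempty := ⟨a, habK (by simp)⟩
  rcases core_hang (ε := 0) (p := max 1 (p + 1 - K.card)) (a := 1) (δ := 1) (L := K.card) (p' := 1)
    (a' := 0) (δ' := 1) (L' := p) (X := X) (R' := ∅) (h.hU hKU hKne) (fun c D hD _ => (h.strong c D hD).2)
    hKU (subset_refl K) hKne (by simp) h.subY ih (by omega) le_rfl (Or.inl rfl) (by
      by_cases hc : p + 1 - K.card ≤ 1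
      · left; omega
      right
      intro w hw hwK
      have h3 := hdeg w hw
      have h4 := dg_sdiff_add (G := G) hKU w
      have h5 := dg_le_card (G := G) K w
      have h6 := ind_le X w
      have h8 : 0 < dg G K w → ind (nbr G U K) w = 1 := ind_nbr_pos hw
      have h7 : w ∈ X → dg G K w + 1 ≤ K.card := by
        intro hwX
        by_contra! hlt
        refine hmax w hwX hwK fun x hx y hy hxy => ?_
        have hadj : ∀ z ∈ K, G.Adj w z := by
          intro z hz
          by_contra hz'
          have := dg_succ_le hz hz'
          omega
        rcases Finset.mem_insert.1 hx with rfl | hx' <;> rcases Finset.mem_insert.1 hy with rfl | hy'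
        · exact absurd rfl hxy
        · exact hadj y hy'
        · exact (hadj x hx').symm
        · exact hK x hx' y hy' hxy
      by_cases hwX : w ∈ X
      · have := h7 hwX
        omega
      · rw [ind_of_notMem hwX] at h3
        omega)
    (fun r hr i hi => Ord.mono (hK.ord hr (e := 1 + 1 * i) (by omega) (by omega)) subset_rfl hKX
      subset_rfl)
    (Or.inl le_rfl) (by simp) with h3 | h3 | ⟨t, h3⟩
  · exact Or.inl (h3.one (by omega) (by omega) (by omega) (by omega) (Or.inl rfl))
  · exact Or.inr ⟨K, hKX, hK, h3⟩
  · exact Or.inl (h3.one (by omega) (by omega) (by omega) (by omega) (Or.inl rfl))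

theorem good_clique_of_edge {p : ℕ} {U X Y : Finset V} (h : SInst G U X Y) (ih : PathThm G 0 U.card)
    (hdeg : ∀ w ∈ U, p + 1 ≤ dg G U w + ind X w + ind Y w) (hp : 2 ≤ p) (hX : ¬ Indep G X) :
    Good 0 p (Ord G U X Y) := by
  unfold Indep at hX
  push Not at hX
  obtain ⟨a, ha, b, hb, hab⟩ := hX
  rcases clique_step h ih hdeg hp ha hb hab with h1 | ⟨K, hKX, hK, hYK⟩
  · exact h1
  obtain ⟨y, hy⟩ := h.neY
  obtain ⟨y', hy', hne⟩ := h.symm.exists_ne (h.subX ha) (h.subX hb) hab.ne y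
  rcases clique_step h.symm ih (fun w hw => by have := hdeg w hw; omega) hp hy' hy
    (hK _ (hYK hy') _ (hYK hy) hne) with h1 | ⟨K', hKY, hK', hXK⟩
  · rwa [Ord.comm]
  have hXY : X = Y := (hXK.trans hKY).antisymm (hYK.trans hKX)
  subst hXY
  replace hK := hK.mono hYK
  have hXU := h.subX
  have hcard := Finset.card_erase_of_mem ha
  have hbne : (X.erase a).Nonempty := ⟨b, by simp [hb, hab.ne']⟩
  have hpos := hbne.card_pos
  rcases fin_step (ε := 0) (p := max 1 (p + 1 - (X.erase a).card)) (a := 1) (δ := 1)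
    (L := (X.erase a).card) (p' := 1) (a' := 0) (δ' := 1) (L' := p) (R' := ∅) h ha (subset_refl _)
    (Finset.erase_subset_erase a hXU) (subset_refl _) hbne (by simp) ih (by omega) le_rfl
    (Or.inl rfl) (by
      by_cases hc : p + 1 - (X.erase a).card ≤ 1
      · left; omega
      right
      intro w hw hwa hwX
      have hwX' : w ∉ X := fun h => hwX (by simp [h, hwa])
      have h3 := hdeg w hw
      rw [ind_of_notMem hwX'] at h3
      have h5 := dg_le_card (G := G) (X.erase a) w
      have h8 : 0 < dg G (X.erase a) w → ind (nbr G U (X.erase a)) w = 1 := ind_nbr_pos hw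
      omega)
    (fun r hr i hi => (hK.mono (Finset.erase_subset a X)).ord hr (e := 1 + 1 * i) (by omega)
      (by omega))
    (Or.inl le_rfl) (by simp) with h3 | h3 | ⟨t, h3⟩
  · exact h3.one (by omega) (by omega) (by omega) (by omega) (Or.inl rfl)
  · right
    refine ⟨1, fun i hi => ?_⟩
    have h4 : dg G U a ≤ (X.erase a).card := by
      refine Finset.card_le_card fun x hx => h3 ?_
      rw [Finset.mem_filter] at hx
      exact mem_nbr_singleton.2 ⟨by simp [hx.1, hx.2.ne'], hx.2⟩
    have h5 := hdeg a (hXU ha)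
    rw [ind_of_mem ha] at h5
    exact Ord.mono (hK.ord ha (e := 1 + i) (by omega) (by omega)) hXU subset_rfl
      (by simpa using ha)
  · exact h3.one (by omega) (by omega) (by omega) (by omega) (Or.inl rfl)

end CliqueSteps
section DiamondStep
variable {V : Type*} [DecidableEq V] {G : SimpleGraph V} [DecidableRel G.Adj]

theorem Ord.cons {U X W Y : Finset V} {t : V} {n : ℕ} (hW : W ⊆ U) (htU : t ∈ U) (ht : t ∉ W)
    (htX : t ∈ X) {A : Finset V} (hA : ∀ x ∈ A, G.Adj t x) (h : n ∈ Ord G W A Y) :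
    1 + n ∈ Ord G U X Y :=
  Ord.glue (H := {t}) (by simpa using htU) hW (by simpa using ht)
    (fun x hx => ⟨t, hA x hx, Ord.single (by simp) htX (by simp)⟩) h

theorem diamond_ord {X Q : Finset V} {t₁ t₂ : V} (h1 : t₁ ∈ X) (hne : t₁ ≠ t₂)
    (hQ : Clique G Q) (hc : Compl G {t₁, t₂} Q) {r : V} (hr : r ∈ Q) (h2 : 2 ≤ Q.card)
    {i : ℕ} (hi : i < Q.card + 1) : 2 + i ∈ Ord G ({t₁, t₂} ∪ Q) X {r} := by
  have ht : t₁ ∉ Q ∧ t₂ ∉ Q := by simpa using hc.disjoint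
  have ha1 : ∀ x ∈ Q, G.Adj t₁ x := hc t₁ (by simp)
  have ha2 : ∀ x ∈ Q, G.Adj t₂ x := hc t₂ (by simp)
  by_cases hq : i < Q.card
  · have := Ord.cons (U := {t₁, t₂} ∪ Q) Finset.subset_union_right (by simp) ht.1 h1 ha1
      (hQ.ord hr (e := i + 1) (by omega) (by omega))
    convert this using 1
    ring
  · have hcard := Finset.card_erase_of_mem hr
    obtain ⟨q, hq'⟩ := Finset.card_pos.1 (show 0 < (Q.erase r).card by omega)
    have hqQ := (Finset.mem_erase.1 hq').2
    have hcq := Finset.card_erase_of_mem hqQ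
    have hrq : r ∈ Q.erase q := Finset.mem_erase.2 ⟨(Finset.mem_erase.1 hq').1.symm, hr⟩
    have e1 := (hQ.mono (Finset.erase_subset q Q)).ord hrq (e := Q.card - 1) (by omega) (by omega)
    have e2 := Ord.cons (U := insert t₂ (Q.erase q)) (X := {t₂}) (Finset.subset_insert _ _)
      (by simp) (by simp [ht.2]) (by simp) (fun x hx => ha2 x (Finset.mem_of_mem_erase hx)) e1
    have e3 := Ord.cons (U := insert t₂ Q) (X := {q}) (t := q)
      (Finset.insert_subset_insert _ (Finset.erase_subset q Q))
      (by simp [hqQ]) (by simp; rintro rfl; exact ht.2 hqQ) (by simp)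
      (fun x hx => by rw [Finset.mem_singleton.1 hx]; exact (ha2 q hqQ).symm) e2
    have e4 := Ord.cons (U := {t₁, t₂} ∪ Q) (X := X) (t := t₁)
      (by intro x; simp; tauto) (by simp) (by simp [hne, ht.1]) h1
      (fun x hx => by rw [Finset.mem_singleton.1 hx]; exact ha1 q hqQ) e3
    convert e4 using 1
    omega

theorem diamond_ord' {X Q : Finset V} {t₁ t₂ : V} (h1 : t₁ ∈ X) (hne : t₁ ≠ t₂)
    (hQ : Clique G Q) (hc : Compl G {t₁, t₂} Q) (h2 : 2 ≤ Q.card)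
    {i : ℕ} (hi : i < 2) : 3 + i ∈ Ord G ({t₁, t₂} ∪ Q) X {t₂} := by
  have ht : t₁ ∉ Q ∧ t₂ ∉ Q := by simpa using hc.disjoint
  obtain ⟨r, hr⟩ := Finset.card_pos.1 (show 0 < Q.card by omega)
  have := Ord.cons (U := insert t₁ Q) (Finset.subset_insert _ _) (by simp) ht.1 h1
    (hc t₁ (by simp)) (hQ.ord hr (e := i + 1) (by omega) (by omega))
  have := Ord.snoc (U := {t₁, t₂} ∪ Q) (r := t₂) (by intro x; simp; tauto) (by simp)
    (by simp [hne.symm, ht.2]) (hc t₂ (by simp) r hr).symm this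
  convert this using 1
  omega

theorem pair_le {w t₁ t₂ : V} (hne : t₁ ≠ t₂) : dg G {t₁, t₂} w ≤ 2 := by
  rw [← Finset.card_pair hne]; exact dg_le_card _ _

theorem diamond_step {p : ℕ} {U X Y Q₀ : Finset V} (h : SInst G U X Y) (ih : PathThm G 0 U.card)
    (hdeg : ∀ w ∈ U, p + 1 ≤ dg G U w + ind X w + ind Y w) (hp : 2 ≤ p)
    (hX : Indep G X) (hY : Indep G Y) {t₁ t₂ : V} (h1 : t₁ ∈ X) (h2 : t₂ ∈ X) (hne : t₁ ≠ t₂)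
    (hQ₀ : Q₀ ⊆ U) (hcl : Clique G Q₀) (hq₀ : 2 ≤ Q₀.card) (hco : Compl G {t₁, t₂} Q₀) :
    Good 0 p (Ord G U X Y) ∨ Y = {t₁, t₂} := by
  obtain ⟨Q, ⟨hQ, hc⟩, hQ₀Q, hQU, hmax⟩ := exists_max_finset (U := U)
    (fun Q => Clique G Q ∧ Compl G {t₁, t₂} Q) hQ₀ ⟨hcl, hco⟩
  have hq : 2 ≤ Q.card := hq₀.trans (Finset.card_le_card hQ₀Q)
  have hHU : {t₁, t₂} ∪ Q ⊆ U := Finset.union_subset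
    (by simp [Finset.insert_subset_iff, h.subX h1, h.subX h2]) hQU
  have hQne : Q.Nonempty := Finset.card_pos.1 (by omega)
  have hnb : ∀ w ∈ U, w ∈ X → dg G {t₁, t₂} w = 0 := by
    intro w hw hwX
    rw [dg_eq_zero]
    intro x hx
    refine hX w hwX x ?_
    simp only [Finset.mem_insert, Finset.mem_singleton] at hx
    rcases hx with rfl | rfl <;> assumption
  rcases core_hang (ε := 0) (p := max 1 (p - Q.card)) (a := 2) (δ := 1) (L := Q.card + 1)
    (p' := max 1 (p - 1)) (a' := 3) (δ' := 1) (L' := 2) (X := X) (R := Q) (R' := {t₁, t₂})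
    (h.hU hHU (hQne.mono Finset.subset_union_right))
    (fun c D hD _ => (h.strong c D hD).2) hHU Finset.subset_union_right hQne
    (by rw [Finset.union_comm]) h.subY ih
    (by omega) (by omega) (Or.inl rfl) (by
      by_cases hpc : p - Q.card ≤ 1
      · left; omega
      right
      intro w hw hwH
      have h3 := hdeg w hw
      have h4 := dg_sdiff_add (G := G) hHU w
      have h5 := dg_le_card (G := G) Q w
      have h6 := ind_le X w
      have h7 := dg_union_le (G := G) {t₁, t₂} Q w
      have h8 : 0 < dg G Q w → ind (nbr G U Q) w = 1 := ind_nbr_pos hw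
      have h9 := pair_le (G := G) (w := w) hne
      by_cases hwX : w ∈ X
      · have := hnb w hw hwX
        omega
      · rw [ind_of_notMem hwX] at h3
        have h10 : dg G Q w = Q.card → dg G {t₁, t₂} w ≤ 1 := by
          intro hfull
          by_contra! hlt
          simp only [Finset.mem_union, not_or] at hwH
          refine hmax w hw hwH.2 ⟨fun x hx y hy hxy => ?_, fun x hx y hy => ?_⟩
          · have hadj : ∀ z ∈ Q, G.Adj w z := by
              intro z hz
              by_contra hz'
              have := dg_succ_le hz hz'
              omega
            rcases Finset.mem_insert.1 hx with rfl | hx' <;>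
              rcases Finset.mem_insert.1 hy with rfl | hy'
            · exact absurd rfl hxy
            · exact hadj y hy'
            · exact (hadj x hx').symm
            · exact hQ x hx' y hy' hxy
          · rcases Finset.mem_insert.1 hy with rfl | hy'
            · by_contra hxw
              have := dg_succ_le hx (fun h => hxw h.symm)
              rw [Finset.card_pair hne] at this
              omega
            · exact hc x hx y hy'
        omega)
    (fun r hr i hi => by rw [one_mul]; exact diamond_ord h1 hne hQ hc hr hq hi)
    (by
      by_cases hpc : p - 1 ≤ 1
      · left; omega
      right
      intro w hw hwH hwQ
      have h3 := hdeg w hw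
      have h4 := dg_sdiff_add (G := G) hHU w
      have h5 := dg_eq_zero_of_notMem_nbr hw hwQ
      have h6 := ind_le X w
      have h7 := dg_union_le (G := G) {t₁, t₂} Q w
      have h8 : 0 < dg G {t₁, t₂} w → ind (nbr G U {t₁, t₂}) w = 1 := ind_nbr_pos hw
      have h9 := pair_le (G := G) (w := w) hne
      by_cases hwX : w ∈ X
      · have := hnb w hw hwX
        omega
      · rw [ind_of_notMem hwX] at h3
        omega)
    (fun r hr i hi => by
      simp only [Finset.mem_insert, Finset.mem_singleton] at hr
      rw [one_mul]
      rcases hr with rfl | rfl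
      · rw [Finset.pair_comm] at hc ⊢
        exact diamond_ord' h2 hne.symm hQ hc hq hi
      · exact diamond_ord' h1 hne hQ hc hq hi) with h3 | h3 | ⟨t, h3⟩
  · exact Or.inl (h3.one (by omega) (by omega) (by omega) (by omega) (Or.inl rfl))
  · right
    have hYt : Y ⊆ {t₁, t₂} := by
      intro y hy
      by_contra hyt
      have hyQ : y ∈ Q := (Finset.mem_union.1 (h3 hy)).resolve_left hyt
      obtain ⟨y', hy', hyy⟩ := h.symm.exists_ne (h.subX h1) (h.subX h2) hne y
      rcases Finset.mem_union.1 (h3 hy') with h4 | h4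
      · exact hY y' hy' y hy (hc y' h4 y hyQ)
      · exact hY y' hy' y hy (hQ y' h4 y hyQ hyy)
    refine Finset.eq_of_subset_of_card_le hYt ?_
    rw [Finset.card_pair hne]
    obtain ⟨y, hy⟩ := h.neY
    obtain ⟨y', hy', hyy⟩ := h.symm.exists_ne (h.subX h1) (h.subX h2) hne y
    rw [← Finset.card_pair hyy]
    exact Finset.card_le_card (by simp [Finset.insert_subset_iff, hy, hy'])
  · exact Or.inl (h3.one (by omega) (by omega) (by omega) (by omega) (Or.inl rfl))

theorem good_of_diamond {p : ℕ} {U X Y Q : Finset V} (h : SInst G U X Y) (ih : PathThm G 0 U.card)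
    (hdeg : ∀ w ∈ U, p + 1 ≤ dg G U w + ind X w + ind Y w) (hp : 2 ≤ p)
    (hX : Indep G X) (hY : Indep G Y) {t₁ t₂ : V} (h1 : t₁ ∈ X) (h2 : t₂ ∈ X) (hne : t₁ ≠ t₂)
    (hQU : Q ⊆ U) (hcl : Clique G Q) (hq : 2 ≤ Q.card) (hco : Compl G {t₁, t₂} Q) :
    Good 0 p (Ord G U X Y) := by
  rcases diamond_step h ih hdeg hp hX hY h1 h2 hne hQU hcl hq hco with h3 | rfl
  · exact h3
  rcases diamond_step h.symm ih (fun w hw => by have := hdeg w hw; omega) hp hY hX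
    (t₁ := t₁) (t₂ := t₂) (by simp) (by simp) hne hQU hcl hq hco with h3 | rfl
  · rwa [Ord.comm]
  have hU1 := h.subX h1
  rcases fin_step (ε := 0) (p := p) (a := 1) (δ := 1) (H := {t₁}) (R := {t₁})
    (L := 1) (p' := 1) (a' := 0) (δ' := 1) (L' := p) (R' := ∅) h h2 (by
      intro x hx
      simp only [Finset.mem_erase, Finset.mem_insert, Finset.mem_singleton] at hx ⊢
      tauto) (by simp [hne, hU1]) (subset_refl _) (by simp) (by simp) ih (by omega) le_rfl
    (Or.inl rfl) (by
      right
      intro w hw hw2 hw1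
      have hwX : w ∉ ({t₁, t₂} : Finset V) := by simpa [hw2] using hw1
      have h3 := hdeg w hw
      rw [ind_of_notMem hwX] at h3
      have h5 := dg_singleton_le (G := G) t₁ w
      have h8 : 0 < dg G {t₁} w → ind (nbr G U {t₁}) w = 1 := ind_nbr_pos hw
      omega)
    (fun r hr i hi => by
      obtain rfl : i = 0 := by omega
      obtain rfl := Finset.mem_singleton.1 hr
      exact Ord.single (a := r) (by simp) (by simp [hne]) (by simp))
    (Or.inl le_rfl) (by simp) with h3 | h3 | ⟨t, h3⟩
  · exact h3.one (by omega) (by omega) (by omega) (by omega) (Or.inl rfl)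
  · obtain ⟨r, hr⟩ := Finset.card_pos.1 (show 0 < Q.card by omega)
    have e1 := hco t₂ (by simp) r hr
    have := h3 (mem_nbr_singleton.2 ⟨Finset.mem_erase.2 ⟨e1.ne', hQU hr⟩, e1⟩)
    rw [Finset.mem_singleton] at this
    exact absurd rfl (this ▸ hco t₁ (by simp) r hr).ne
  · exact h3.one (by omega) (by omega) (by omega) (by omega) (Or.inl rfl)

end DiamondStep
section TwoLengths
variable {V : Type*} [DecidableEq V] {G : SimpleGraph V} [DecidableRel G.Adj]

theorem PathOn.join {S T : Finset V} {a b c : V} (h : PathOn G S a b) (h' : PathOn G T b c)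
    (hd : ∀ x ∈ S, x ∈ T → x = b) : PathOn G (S ∪ T) a c := by
  induction h with
  | single a => rwa [Finset.singleton_union, Finset.insert_eq_of_mem h'.left_mem]
  | @cons a b c' S hab haS hp ih =>
    rw [Finset.insert_union]
    refine PathOn.cons hab ?_ (ih h' fun x hx => hd x (Finset.mem_insert_of_mem hx))
    rw [Finset.mem_union, not_or]
    exact ⟨haS, fun haT => haS ((hd a (by simp) haT) ▸ hp.right_mem)⟩

/-- Concatenation of a fixed path with the paths counted by `Ord`. -/
theorem Ord.join {U E S X Y Y' : Finset V} {a b : V} {n : ℕ} (hS : PathOn G S a b) (hSU : S ⊆ U)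
    (ha : a ∈ X) (hE : E ⊆ U) (hd : ∀ x ∈ S, x ∈ E → x = b) (hY : Y' ⊆ Y)
    (h : n ∈ Ord G E {b} Y') : (S.card - 1) + n ∈ Ord G U X Y := by
  obtain ⟨T, b', y, h1, h2, h3, h4, rfl⟩ := h
  obtain rfl := Finset.mem_singleton.1 h2
  refine ⟨S ∪ T, a, y, Finset.union_subset hSU (h1.trans hE), ha, hY h3,
    hS.join h4 (fun x hx hxT => hd x hx (h1 hxT)), ?_⟩
  have h5 : S ∩ T = {b'} := by
    ext x
    simp only [Finset.mem_inter, Finset.mem_singleton]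
    exact ⟨fun h => hd x h.1 (h1 h.2), by rintro rfl; exact ⟨hS.right_mem, h4.left_mem⟩⟩
  have h6 := Finset.card_union_add_card_inter S T
  rw [h5, Finset.card_singleton] at h6
  have := hS.card_pos
  omega

variable (G) in
/-- Two path lengths differing by one or two. -/
def Two (E A Y : Finset V) : Prop :=
  ∃ m g, (g = 1 ∨ g = 2) ∧ m ∈ Ord G E A Y ∧ m + g ∈ Ord G E A Y

theorem Two.shift {E A Y E' A' Y' : Finset V} (h : Two G E A Y) (t : ℕ)
    (hO : ∀ n ∈ Ord G E A Y, t + n ∈ Ord G E' A' Y') : Two G E' A' Y' := by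
  obtain ⟨m, g, hg, h1, h2⟩ := h
  exact ⟨t + m, g, hg, hO m h1, by rw [add_assoc]; exact hO _ h2⟩

variable (G) in
/-- Hypotheses of the two-length lemma. -/
structure TwoInst (E Z₁ Z Y : Finset V) : Prop where
  conn : Conn G E
  subY : Y ⊆ E
  neY : Y.Nonempty
  subZ₁ : Z₁ ⊆ Z
  subZ : Z ⊆ E
  neZ : Z₁.Nonempty
  cardZ : Z.card ≤ 2
  deg : ∀ w ∈ E, w ∉ Z → 3 ≤ dg G E w + ind Y w
  piece : ∀ c D, Sep G E {c} D → Disjoint D Z₁ → ¬ Disjoint D Y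
  big : (E \ Z).Nonempty ∧ (Z₁.card = 1 ∨ 2 ≤ (E \ Z).card)

theorem two_of_edge {E Z₁ Z Y : Finset V} (h : TwoInst G E Z₁ Z Y) {y y' : V} (hy : y ∈ Y)
    (hy' : y' ∈ Y) (hyy : G.Adj y y') : ∃ z ∈ Z₁, Two G E {z} Y := by
  obtain ⟨z, hz⟩ := h.neZ
  refine ⟨z, hz, ?_⟩
  obtain ⟨S, hS, hp⟩ := h.conn.path (h.subZ (h.subZ₁ hz)) (h.subY hy)
  obtain ⟨T, hT, b, hb, hp, hh⟩ := hp.firstHit (B := {y, y'}) (by simp)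
  obtain ⟨b', hb', hbb, hne⟩ : ∃ b' ∈ Y, G.Adj b b' ∧ b' ∉ T := by
    simp only [Finset.mem_insert, Finset.mem_singleton] at hb
    rcases hb with rfl | rfl
    · exact ⟨y', hy', hyy, fun h => hyy.ne' (hh _ h (by simp))⟩
    · exact ⟨y, hy, hyy.symm, fun h => hyy.ne (hh _ h (by simp))⟩
  have hbY : b ∈ Y := by
    simp only [Finset.mem_insert, Finset.mem_singleton] at hb
    rcases hb with rfl | rfl <;> assumption
  have hm : T.card ∈ Ord G T {z} {b} := ⟨T, z, b, subset_rfl, by simp, by simp, hp, rfl⟩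
  refine ⟨T.card, 1, Or.inl rfl, Ord.mono hm (hT.trans hS) subset_rfl (by simpa using hbY), ?_⟩
  exact Ord.mono (Ord.snoc (hT.trans hS) (h.subY hb') hne hbb hm) subset_rfl subset_rfl
    (by simpa using hb')

theorem two_of_vertex {E Z₁ Z Y : Finset V} (h : TwoInst G E Z₁ Z Y)
    (ih : ∀ E' Z₁' Z' Y', E'.card < E.card → TwoInst G E' Z₁' Z' Y' →
      ∃ z ∈ Z₁', Two G E' {z} Y')
    {v t t' : V} (hv : v ∈ E) (hvY : v ∉ Y) (hvZ : v ∉ Z₁) (ht : t ∈ Y) (ht' : t' ∈ Y)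
    (hne : t ≠ t') (hvt : G.Adj v t) (hvt' : G.Adj v t') : ∃ z ∈ Z₁, Two G E {z} Y := by
  have hEv : ∀ t ∈ Y, t ∈ E ∧ t ∉ ({v} : Finset V) := fun t ht =>
    ⟨h.subY ht, by rw [Finset.mem_singleton]; rintro rfl; exact hvY ht⟩
  have key : ∀ t ∈ Y, ∀ t' ∈ Y, t ≠ t' → G.Adj v t → G.Adj v t' →
      ∀ M, t ∈ M → Conn G M → Sep G E {v} M → ¬ Disjoint M Z₁ → ∃ z ∈ Z₁, Two G E {z} Y := by
    intro t ht t' ht' hne hvt hvt' M htM hMc hM hd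
    obtain ⟨z, hzM, hz⟩ := Finset.not_disjoint_iff.1 hd
    refine ⟨z, hz, ?_⟩
    obtain ⟨S, hS, hp⟩ := hMc.path hzM htM
    obtain ⟨T, hT, b, hb, hp, hh⟩ := hp.firstHit (B := {t, t'}) (by simp)
    have hTE := (hT.trans hS).trans hM.sub
    have hvT : v ∉ T := fun hv => by simpa using Finset.disjoint_left.1 hM.disj (hS (hT hv))
    obtain ⟨b', hb', hbb, hne⟩ : ∃ b' ∈ Y, G.Adj v b' ∧ b' ∉ T := by
      simp only [Finset.mem_insert, Finset.mem_singleton] at hb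
      rcases hb with rfl | rfl
      · exact ⟨t', ht', hvt', fun h => hne (hh _ h (by simp)).symm⟩
      · exact ⟨t, ht, hvt, fun h => hne (hh _ h (by simp))⟩
    have hbY : b ∈ Y ∧ G.Adj v b := by
      simp only [Finset.mem_insert, Finset.mem_singleton] at hb
      rcases hb with rfl | rfl <;> constructor <;> assumption
    have hm : T.card ∈ Ord G T {z} {b} := ⟨T, z, b, subset_rfl, by simp, by simp, hp, rfl⟩
    refine ⟨T.card, 2, Or.inr rfl, Ord.mono hm hTE subset_rfl (by simpa using hbY.1), ?_⟩
    have hm2 := Ord.snoc (U := insert v T) (Finset.subset_insert _ _) (by simp) hvT hbY.2.symm hm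
    exact Ord.mono (Ord.snoc (U := E) (Finset.insert_subset hv hTE) (h.subY hb')
      (by simp only [Finset.mem_insert, not_or]; exact ⟨hbb.ne', hne⟩) hbb hm2)
      subset_rfl subset_rfl (by simpa using hb')
  obtain ⟨M, htM, hMc, hM⟩ := exists_component (G := G) (hEv t ht).1 (hEv t ht).2
  obtain ⟨M', htM', hMc', hM'⟩ := exists_component (G := G) (hEv t' ht').1 (hEv t' ht').2
  by_cases hd : Disjoint M Z₁
  swap
  · exact key t ht t' ht' hne hvt hvt' M htM hMc hM hd
  by_cases hd' : Disjoint M' Z₁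
  swap
  · exact key t' ht' t ht hne.symm hvt' hvt M' htM' hMc' hM' hd'
  obtain ⟨z, hz⟩ := h.neZ
  have hZE := h.subZ (h.subZ₁ hz)
  have main : ∀ t ∈ Y, t ∉ Z → G.Adj v t → ∀ M, t ∈ M → Conn G M → Sep G E {v} M →
      Disjoint M Z₁ → ∃ z ∈ Z₁, Two G E {z} Y := by
    clear! M M' t t'
    intro t ht htZ hvt M htM hMc hM hd
    have hzM : z ∉ M := fun h => Finset.disjoint_left.1 hd h hz
    have hvM : v ∉ M := by simpa using hM.disj
    have hME : insert v M ⊆ E := Finset.insert_subset hv hM.sub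
    have hcl : ∀ a ∈ M, ∀ b ∈ E, G.Adj a b → b ∈ insert v M := fun a ha b hb hab => by
      rcases hM.closed a ha b hb hab with h | h
      · simp [h]
      · simp [Finset.mem_singleton.1 h]
    obtain ⟨z', hz', htwo⟩ := ih (insert v M) {v} (insert v (Z ∩ M)) (Y ∩ M) (by
        refine Finset.card_lt_card ⟨hME, fun h' => ?_⟩
        rcases Finset.mem_insert.1 (h' hZE) with rfl | h
        · exact hvZ hz
        · exact hzM h)
      ⟨hMc.insert' htM hvt, Finset.inter_subset_right.trans (Finset.subset_insert _ _),
      ⟨t, by simp [ht, htM]⟩, by simp, Finset.insert_subset_insert _ Finset.inter_subset_right,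
      by simp, by
        have h1 : (Z ∩ M).card < Z.card := Finset.card_lt_card
          ⟨Finset.inter_subset_left, fun h' => hzM (Finset.mem_inter.1 (h' (h.subZ₁ hz))).2⟩
        have := h.cardZ
        have := Finset.card_insert_le v (Z ∩ M)
        omega, by
        intro w hw hwZ
        simp only [Finset.mem_insert, Finset.mem_inter, not_or, not_and] at hw hwZ
        have hwM := hw.resolve_left hwZ.1
        have h1 := h.deg w (hM.sub hwM) (fun h => hwZ.2 h hwM)
        have h2 := dg_le_of_closed (B := ∅) (fun b hb hab => Or.inl (hcl w hwM b hb hab))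
        have h3 : dg G ∅ w = 0 := by simp [dg]
        have h4 : ind Y w ≤ ind (Y ∩ M) w := ind_mono (fun h => by simp [hwM, h])
        omega, by
        intro c D hD h1 h2
        have hDM : D ⊆ M := fun x hx => (Finset.mem_insert.1 (hD.sub hx)).resolve_left
          (by rintro rfl; exact Finset.disjoint_left.1 h1 hx (by simp))
        refine h.piece c D ⟨hDM.trans hM.sub, hD.ne, hD.disj, fun a ha b hb hab =>
          hD.closed a ha b (hcl a (hDM ha) b hb hab) hab⟩
          (Finset.disjoint_of_subset_left hDM hd) ?_
        rw [Finset.disjoint_left] at h2 ⊢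
        exact fun x hx hxY => h2 hx (by simp [hxY, hDM hx]),
      ⟨t, by
        simp only [Finset.mem_sdiff, Finset.mem_insert, htM, Finset.mem_inter, htZ]
        simp [hvt.ne']⟩, by simp⟩
    obtain rfl := Finset.mem_singleton.1 hz'
    obtain ⟨S, hS, hp⟩ := (h.conn.sdiff hM hv).path (a := z) (b := z') (by simp [hZE, hzM])
      (by simp [hv, hvM])
    refine ⟨z, hz, htwo.shift _ fun n hn => Ord.join hp (hS.trans Finset.sdiff_subset) (by simp)
      hME ?_ Finset.inter_subset_left hn⟩
    intro x hx hxM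
    exact (Finset.mem_insert.1 hxM).resolve_right (Finset.mem_sdiff.1 (hS hx)).2
  by_cases htZ : t ∈ Z
  · refine main t' ht' (fun ht'Z => ?_) hvt' M' htM' hMc' hM' hd'
    have h3 : ({t, t', z} : Finset V) ⊆ Z := by
      simp [Finset.insert_subset_iff, htZ, ht'Z, h.subZ₁ hz]
    have h4 := Finset.card_le_card h3
    have := h.cardZ
    rw [Finset.card_eq_three.2 ⟨t, t', z, hne, ?_, ?_, rfl⟩] at h4
    · omega
    · rintro rfl; exact Finset.disjoint_left.1 hd htM hz
    · rintro rfl; exact Finset.disjoint_left.1 hd' htM' hz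
  · exact main t ht htZ hvt M htM hMc hM hd

/-- A component `M` of `E \ Y` that avoids `Z₁`. -/
theorem two_of_far {E Z₁ Z Y M : Finset V} (h : TwoInst G E Z₁ Z Y)
    (ih : ∀ E' Z₁' Z' Y', E'.card < E.card → TwoInst G E' Z₁' Z' Y' →
      ∃ z ∈ Z₁', Two G E' {z} Y')
    (hdY : ∀ w ∈ E, w ∉ Y → w ∉ Z₁ → dg G Y w ≤ 1)
    (hM : Sep G E Y M) (hMc : Conn G M) (hd : Disjoint M Z₁) (hMZ : (M \ Z).Nonempty) :
    ∃ z ∈ Z₁, Two G E {z} Y := by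
  obtain ⟨z, hz⟩ := h.neZ
  have hZE := h.subZ (h.subZ₁ hz)
  have hzM : z ∉ M := fun h => Finset.disjoint_left.1 hd h hz
  obtain ⟨E₁, hzE, hE₁c, hE₁⟩ := exists_component (G := G) hZE hzM
  have hdE := Finset.disjoint_left.1 hE₁.disj
  have hdM := Finset.disjoint_left.1 hM.disj
  obtain ⟨x, hx⟩ := hMc.1
  obtain ⟨y₀, hy₀, m₀, hm₀, hm₀', hadj⟩ := h.conn.exists_adj hE₁.sub hE₁.ne
    (fun h' => hdE (h' ▸ hM.sub hx) hx)
  have hm₀M := (hE₁.closed _ hy₀ _ hm₀ hadj).resolve_left hm₀'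
  have hy₀Y := (hM.closed _ hm₀M _ (hE₁.sub hy₀) hadj.symm).resolve_left (hdE hy₀)
  obtain ⟨S, hS, hp⟩ := hE₁c.path hzE hy₀
  obtain ⟨T, hT, y₁, hy₁, hp, hh⟩ := hp.firstHit (B := nbr G Y M)
    (mem_nbr.2 ⟨hy₀Y, m₀, hm₀M, hadj.symm⟩)
  obtain ⟨hy₁Y, m₁, hm₁, hm₁y⟩ := mem_nbr.1 hy₁
  have hTE : T ⊆ E₁ := hT.trans hS
  have hy₁M : y₁ ∉ M := fun h => hdM h hy₁Y
  have hME : insert y₁ M ⊆ E := Finset.insert_subset (h.subY hy₁Y) hM.sub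
  have hne2 : (nbr G M (Y.erase y₁)).Nonempty := by
    by_contra hne
    refine h.piece y₁ M ⟨hM.sub, hM.ne, by simpa using hy₁M, fun a ha b hb hab => ?_⟩ hd hM.disj
    refine (hM.closed a ha b hb hab).imp_right fun hbY => ?_
    by_contra hby
    exact hne ⟨a, mem_nbr.2 ⟨ha, b, by simpa [hbY] using hby, hab.symm⟩⟩
  obtain ⟨z', hz', m, g, hg, hm, hmg⟩ := ih (insert y₁ M) {y₁} (insert y₁ (Z ∩ M))
    (nbr G M (Y.erase y₁)) (by
      refine Finset.card_lt_card ⟨hME, fun h' => ?_⟩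
      obtain ⟨w, hw⟩ := hne2
      obtain ⟨-, y₂, hy₂, -⟩ := mem_nbr.1 hw
      rw [Finset.mem_erase] at hy₂
      rcases Finset.mem_insert.1 (h' (h.subY hy₂.2)) with h3 | h3
      · exact hy₂.1 h3
      · exact hdM h3 hy₂.2)
    ⟨hMc.insert' hm₁ hm₁y.symm, (nbr_subset _ _).trans (Finset.subset_insert _ _), hne2,
    by simp, Finset.insert_subset_insert _ Finset.inter_subset_right, by simp, by
      have h1 : (Z ∩ M).card < Z.card := Finset.card_lt_card
        ⟨Finset.inter_subset_left, fun h' => hzM (Finset.mem_inter.1 (h' (h.subZ₁ hz))).2⟩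
      have := h.cardZ
      have := Finset.card_insert_le y₁ (Z ∩ M)
      omega, by
      intro w hw hwZ
      simp only [Finset.mem_insert, Finset.mem_inter, not_or, not_and] at hw hwZ
      have hwM := hw.resolve_left hwZ.1
      have hwZ' : w ∉ Z := fun h => hwZ.2 h hwM
      have h1 := h.deg w (hM.sub hwM) hwZ'
      rw [ind_of_notMem (hdM hwM)] at h1
      have h2 : dg G E w ≤ dg G (insert y₁ M) w + dg G (Y.erase y₁) w :=
        dg_le_of_closed fun b hb hab => by
          rcases hM.closed w hwM b hb hab with h | h
          · simp [h]
          · by_cases hby : b = y₁ <;> simp [hby, h]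
      have h3 := hdY w (hM.sub hwM) (hdM hwM) (fun h' => hwZ' (h.subZ₁ h'))
      have h4 := dg_mono (G := G) (Finset.erase_subset y₁ Y) w
      have h5 : 0 < dg G (Y.erase y₁) w → ind (nbr G M (Y.erase y₁)) w = 1 := ind_nbr_pos hwM
      omega, by
      intro c D hD h1 h2
      have hDM : D ⊆ M := fun x hx => (Finset.mem_insert.1 (hD.sub hx)).resolve_left
        (by rintro rfl; exact Finset.disjoint_left.1 h1 hx (by simp))
      refine h.piece c D ⟨hDM.trans hM.sub, hD.ne, hD.disj, fun a ha b hb hab => ?_⟩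
        (Finset.disjoint_of_subset_left hDM hd) (Finset.disjoint_of_subset_left hDM hM.disj)
      refine hD.closed a ha b ?_ hab
      rcases hM.closed a (hDM ha) b hb hab with h3 | h3
      · simp [h3]
      · by_contra hby
        simp only [Finset.mem_insert, not_or] at hby
        exact Finset.disjoint_left.1 h2 ha (mem_nbr.2 ⟨hDM ha, b, by simp [hby, h3], hab.symm⟩),
      by
        obtain ⟨w, hw⟩ := hMZ
        rw [Finset.mem_sdiff] at hw
        refine ⟨w, ?_⟩
        simp only [Finset.mem_sdiff, Finset.mem_insert, hw, Finset.mem_inter]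
        simp only [or_true, false_and, or_false, true_and]
        rintro rfl
        exact hy₁M hw.1, by simp⟩
  obtain rfl := Finset.mem_singleton.1 hz'
  have hex : ∀ n ∈ Ord G (insert z' M) {z'} (nbr G M (Y.erase z')),
      (T.card - 1) + 1 + n ∈ Ord G E {z} Y := by
    intro n hn
    obtain ⟨Q, a, w, h1, h2, h3, h4, rfl⟩ := hn
    obtain ⟨hwM, y, hy, hyw⟩ := mem_nbr.1 h3
    rw [Finset.mem_erase] at hy
    have hyQ : y ∉ Q := fun h => by
      rcases Finset.mem_insert.1 (h1 h) with h | h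
      · exact hy.1 h
      · exact hdM h hy.2
    have hq := Ord.snoc (U := insert y (insert z' M)) (h1.trans (Finset.subset_insert _ _)) (by simp)
      hyQ hyw.symm (X := {z'}) ⟨Q, a, w, subset_rfl, h2, by simp, h4, rfl⟩
    have := Ord.join (U := E) (Y := Y) hp (hTE.trans hE₁.sub) (X := {z}) (by simp)
      (Finset.insert_subset (h.subY hy.2) hME) ?_ (by simpa using hy.2) hq
    · convert this using 1; ring
    · intro x hx hxE
      rcases Finset.mem_insert.1 hxE with rfl | hxE
      · exact hh _ hx (mem_nbr.2 ⟨hy.2, w, hwM, hyw.symm⟩)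
      · exact (Finset.mem_insert.1 hxE).resolve_right (hdE (hTE hx))
  exact ⟨z, hz, _, g, hg, hex _ hm, by rw [add_assoc]; exact hex _ hmg⟩

theorem dg_two {Y : Finset V} {w : V} (h : 2 ≤ dg G Y w) :
    ∃ a ∈ Y, ∃ b ∈ Y, a ≠ b ∧ G.Adj w a ∧ G.Adj w b := by
  obtain ⟨a, ha, b, hb, hab⟩ := Finset.one_lt_card.1 (show 1 < (Y.filter (fun x => G.Adj w x)).card from h)
  rw [Finset.mem_filter] at ha hb
  exact ⟨a, ha.1, b, hb.1, hab, ha.2, hb.2⟩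

theorem mem_of_dg {Z : Finset V} {w : V} (hZ : Z.card ≤ dg G Z w) : ∀ z ∈ Z, G.Adj w z := by
  intro z hz
  by_contra h
  have := dg_succ_le hz h
  omega

theorem Indep.dg_eq_zero {Y : Finset V} (h : Indep G Y) {y : V} (hy : y ∈ Y) : dg G Y y = 0 :=
  ConsecCycles.dg_eq_zero.2 fun x hx => h y hy x hx

/-- All vertices outside `Y` lie in `Z`. -/
theorem two_of_star {E Z₁ Z Y : Finset V} (h : TwoInst G E Z₁ Z Y) (hI : Indep G Y)
    (hE : E ⊆ Y ∪ Z) : ∃ z ∈ Z₁, Two G E {z} Y := by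
  have hst : ∀ t ∈ E, t ∉ Z → t ∈ Y := fun t ht htZ => (Finset.mem_union.1 (hE ht)).resolve_right htZ
  have hadj : ∀ t ∈ E, t ∉ Z → (∀ z ∈ Z, G.Adj t z) ∧ Z.card = 2 := by
    intro t ht htZ
    have h1 := h.deg t ht htZ
    have h2 := ind_le Y t
    have h3 : dg G E t ≤ dg G Z t + dg G Y t := dg_le_of_closed fun b hb _ =>
      (Finset.mem_union.1 (hE hb)).symm
    rw [hI.dg_eq_zero (hst t ht htZ)] at h3
    have h4 := dg_le_card (G := G) Z t
    have := h.cardZ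
    exact ⟨mem_of_dg (by omega), by omega⟩
  obtain ⟨t, ht⟩ := h.big.1
  rw [Finset.mem_sdiff] at ht
  obtain ⟨h1, h2⟩ := hadj t ht.1 ht.2
  obtain ⟨z, hz⟩ := h.neZ
  have hzZ := h.subZ₁ hz
  have htz := h1 z hzZ
  have hzY : z ∉ Y := fun h => hI t (hst t ht.1 ht.2) z h htz
  obtain ⟨c, hc, hcz⟩ : ∃ c ∈ Z, c ≠ z := by
    obtain ⟨c, hc⟩ := Finset.card_pos.1 (show 0 < (Z.erase z).card by
      rw [Finset.card_erase_of_mem hzZ]; omega)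
    exact ⟨c, Finset.mem_of_mem_erase hc, Finset.ne_of_mem_erase hc⟩
  have htc := h1 c hc
  have hcY : c ∉ Y := fun h => hI t (hst t ht.1 ht.2) c h htc
  have hzE := h.subZ hzZ
  have hcE := h.subZ hc
  have hYt : ∀ y ∈ Y, y ∈ E ∧ y ∉ Z := by
    intro y hy
    refine ⟨h.subY hy, fun hyZ => hI t (hst t ht.1 ht.2) y hy (h1 y hyZ)⟩
  have o1 : ∀ W : Finset V, 1 ∈ Ord G (insert z W) {z} {z} := fun W =>
    Ord.single (a := z) (by simp) (by simp) (by simp)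
  refine ⟨z, hz, ?_⟩
  by_cases hbig : ∃ t' ∈ Y, t' ≠ t
  · obtain ⟨t', ht', htt⟩ := hbig
    have h3 := (hadj t' (hYt t' ht').1 (hYt t' ht').2).1
    have p2 := Ord.snoc (U := insert t (insert z ∅)) (Finset.subset_insert _ _) (by simp)
      (by simpa using htz.ne) htz.symm (o1 ∅)
    have p3 := Ord.snoc (U := insert c (insert t (insert z ∅))) (Finset.subset_insert _ _) (by simp)
      (by simp [hcz, htc.ne']) htc p2
    have p4 := Ord.snoc (U := E) (r := t') (by simp [Finset.insert_subset_iff, hcE, ht.1, hzE])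
      (hYt t' ht').1 (by simp [htt, (h3 c hc).ne, (h3 z hzZ).ne]) (h3 c hc).symm p3
    refine ⟨2, 2, Or.inr rfl, Ord.mono p2 (by simp [Finset.insert_subset_iff, ht.1, hzE]) subset_rfl
      (by simpa using hst t ht.1 ht.2), Ord.mono p4 subset_rfl subset_rfl (by simpa using ht')⟩
  · push Not at hbig
    have hEt : ∀ w ∈ E, w = t ∨ w ∈ Z := fun w hw => by
      rcases Finset.mem_union.1 (hE hw) with h | h
      · exact Or.inl (hbig w h)
      · exact Or.inr h
    have hZ1 : Z₁.card = 1 := by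
      refine h.big.2.resolve_right fun h3 => ?_
      have : (E \ Z) ⊆ {t} := fun w hw => by
        rw [Finset.mem_sdiff] at hw
        simpa using (hEt w hw.1).resolve_right hw.2
      have := Finset.card_le_card this
      rw [Finset.card_singleton] at this
      omega
    have hZp : Z = {z, c} := by
      refine (Finset.eq_of_subset_of_card_le (by simp [Finset.insert_subset_iff, hc, hzZ]) ?_).symm
      rw [Finset.card_pair hcz.symm, h2]
    have hzc : G.Adj c z := by
      by_contra hzc
      refine h.piece t {c} ⟨by simpa using hcE, by simp, by simpa using htc.ne', ?_⟩ ?_ ?_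
      · intro a ha b hb hab
        obtain rfl := Finset.mem_singleton.1 ha
        rcases hEt b hb with rfl | hbZ
        · simp
        · rw [hZp] at hbZ
          simp only [Finset.mem_insert, Finset.mem_singleton] at hbZ
          rcases hbZ with rfl | rfl
          · exact absurd hab hzc
          · exact absurd hab (G.loopless.irrefl _)
      · rw [Finset.disjoint_singleton_left]
        intro hcZ
        exact hcz (Finset.card_le_one.1 hZ1.le _ hcZ _ hz)
      · simpa using hcY
    have p2 := Ord.snoc (U := insert t (insert z ∅)) (Finset.subset_insert _ _) (by simp)
      (by simpa using htz.ne) htz.symm (o1 ∅)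
    have q2 := Ord.snoc (U := insert c (insert z ∅)) (Finset.subset_insert _ _) (by simp)
      (by simpa using hcz) hzc.symm (o1 ∅)
    have q3 := Ord.snoc (U := E) (r := t) (by simp [Finset.insert_subset_iff, hcE, hzE])
      ht.1 (by simp [htc.ne, htz.ne]) htc.symm q2
    refine ⟨2, 1, Or.inl rfl, Ord.mono p2 (by simp [Finset.insert_subset_iff, ht.1, hzE]) subset_rfl
      (by simpa using hst t ht.1 ht.2), Ord.mono q3 subset_rfl subset_rfl
      (by simpa using hst t ht.1 ht.2)⟩

end TwoLengths
section TwoLengthsMain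
variable {V : Type*} [DecidableEq V] {G : SimpleGraph V} [DecidableRel G.Adj]

theorem Sep.subset_of_conn {E Y M M' : Finset V} (hM : Sep G E Y M) (hM' : Sep G E Y M')
    (hc : Conn G M') (hd : ¬ Disjoint M M') : M' ⊆ M := by
  obtain ⟨z, hz, hz'⟩ := Finset.not_disjoint_iff.1 hd
  have := hc.2 (M ∩ M') ⟨Finset.inter_subset_right, ⟨z, by simp [hz, hz']⟩, by simp,
    fun a ha b hb hab => by
      rw [Finset.mem_inter] at ha
      left
      rw [Finset.mem_inter]
      refine ⟨(hM.closed a ha.1 b (hM'.sub hb) hab).resolve_right ?_, hb⟩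
      exact Finset.disjoint_left.1 hM'.disj hb⟩
  rw [← this]
  exact Finset.inter_subset_left

/-- A component `M` of `E \ Y` that meets `Z₁`. -/
theorem two_of_near {E Z₁ Z Y M : Finset V} (h : TwoInst G E Z₁ Z Y)
    (ih : ∀ E' Z₁' Z' Y', E'.card < E.card → TwoInst G E' Z₁' Z' Y' →
      ∃ z ∈ Z₁', Two G E' {z} Y') (hI : Indep G Y)
    (hdY : ∀ w ∈ E, w ∉ Y → w ∉ Z₁ → dg G Y w ≤ 1)
    (hall : ∀ M, Sep G E Y M → Conn G M → (M \ Z).Nonempty → ¬ Disjoint M Z₁)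
    (hM : Sep G E Y M) (hMc : Conn G M) (hMZ : (M \ Z).Nonempty) :
    ∃ z ∈ Z₁, Two G E {z} Y := by
  have hdM := Finset.disjoint_left.1 hM.disj
  obtain ⟨z, hzM, hz⟩ := Finset.not_disjoint_iff.1 (hall M hM hMc hMZ)
  obtain ⟨y, hy⟩ := h.neY
  have hyM : y ∉ M := fun h => hdM h hy
  have hdE : ∀ w ∈ M, dg G E w ≤ dg G M w + dg G Y w := fun w hw =>
    dg_le_of_closed (hM.closed w hw)
  by_cases hbig : (Z₁ ∩ M).card = 1 ∨ 2 ≤ (M \ Z).card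
  · obtain ⟨z', hz', htwo⟩ := ih M (Z₁ ∩ M) (Z ∩ M) (nbr G M Y)
      (Finset.card_lt_card ⟨hM.sub, fun h' => hyM (h' (h.subY hy))⟩)
      ⟨hMc, nbr_subset _ _, by
        obtain ⟨a, ha, b, hb, hbM, hab⟩ := h.conn.exists_adj hM.sub hM.ne
          (fun h' => hyM (h' ▸ h.subY hy))
        exact ⟨a, mem_nbr.2 ⟨ha, b, (hM.closed a ha b hb hab).resolve_left hbM, hab.symm⟩⟩,
      Finset.inter_subset_inter_right h.subZ₁, Finset.inter_subset_right,
      ⟨z, by simp [hz, hzM]⟩, (Finset.card_le_card Finset.inter_subset_left).trans h.cardZ, by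
        intro w hw hwZ
        simp only [Finset.mem_inter, not_and] at hwZ
        have hwZ' : w ∉ Z := fun h => hwZ h hw
        have h1 := h.deg w (hM.sub hw) hwZ'
        rw [ind_of_notMem (hdM hw)] at h1
        have h2 := hdE w hw
        have h3 := hdY w (hM.sub hw) (hdM hw) (fun h' => hwZ' (h.subZ₁ h'))
        have h5 : 0 < dg G Y w → ind (nbr G M Y) w = 1 := ind_nbr_pos hw
        omega, by
        intro c D hD h1 h2
        have hDM := hD.sub
        refine h.piece c D ⟨hDM.trans hM.sub, hD.ne, hD.disj, fun a ha b hb hab => ?_⟩ ?_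
          (Finset.disjoint_of_subset_left hDM hM.disj)
        · refine hD.closed a ha b ((hM.closed a (hDM ha) b hb hab).resolve_right fun hbY => ?_) hab
          exact Finset.disjoint_left.1 h2 ha (mem_nbr.2 ⟨hDM ha, b, hbY, hab.symm⟩)
        · rw [Finset.disjoint_left] at h1 ⊢
          exact fun x hx hxZ => h1 hx (by simp [hxZ, hDM hx]),
      by
        have : M \ (Z ∩ M) = M \ Z := by ext x; simp
        rw [this]
        exact ⟨hMZ, hbig⟩⟩
    refine ⟨z', (Finset.mem_inter.1 hz').1, htwo.shift 1 fun n hn => ?_⟩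
    obtain ⟨Q, a, w, h1, h2, h3, h4, rfl⟩ := hn
    obtain ⟨hwM, y, hy, hyw⟩ := mem_nbr.1 h3
    have := Ord.snoc (U := E) (h1.trans hM.sub) (h.subY hy) (fun h => hdM (h1 h) hy) hyw.symm
      (X := {z'}) ⟨Q, a, w, subset_rfl, h2, by simp, h4, rfl⟩
    rw [add_comm]
    exact Ord.mono this subset_rfl subset_rfl (by simpa using hy)
  · push Not at hbig
    obtain ⟨t, ht⟩ := hMZ
    have hMt : ∀ w ∈ M, w = t ∨ w ∈ Z := fun w hw => by
      by_contra! hw'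
      exact hw'.1 (Finset.card_le_one.1 (show (M \ Z).card ≤ 1 by omega) w (by simp [hw, hw'.2]) t ht)
    rw [Finset.mem_sdiff] at ht
    have hc1 : 0 < (Z₁ ∩ M).card := Finset.card_pos.2 ⟨z, by simp [hz, hzM]⟩
    have hc2 := h.cardZ
    have hZ1 : Z₁ ∩ M = Z := Finset.eq_of_subset_of_card_le
      (Finset.inter_subset_left.trans h.subZ₁) (by omega)
    have hZM : Z ⊆ M := hZ1 ▸ Finset.inter_subset_right
    have hZZ : Z ⊆ Z₁ := hZ1 ▸ Finset.inter_subset_left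
    have htE := hM.sub ht.1
    have h1 := h.deg t htE ht.2
    rw [ind_of_notMem (hdM ht.1)] at h1
    have h2 := hdE t ht.1
    have h3 := hdY t htE (hdM ht.1) (fun h' => ht.2 (h.subZ₁ h'))
    have h4 : dg G M t ≤ dg G Z t + dg G ∅ t := dg_le_of_closed fun b hb hab => Or.inl
      ((hMt b hb).resolve_left hab.ne')
    have h5 : dg G ∅ t = 0 := by simp [dg]
    have h6 := dg_le_card (G := G) Z t
    have htZ := mem_of_dg (G := G) (Z := Z) (w := t) (by omega)
    obtain ⟨y₀, hy₀, hty⟩ := dg_pos.1 (show 0 < dg G Y t by omega)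
    have hy₀M : y₀ ∉ M := fun h => hdM h hy₀
    have h7 := h.deg y₀ (h.subY hy₀) (fun h' => hy₀M (hZM h'))
    have h8 := ind_le Y y₀
    have h9 : dg G E y₀ ≤ dg G Z y₀ + dg G {t} y₀ := dg_le_of_closed fun b hb hab => by
      have hbY : b ∉ Y := fun h => hI y₀ hy₀ b h hab
      obtain ⟨M', hbM', hMc', hM'⟩ := exists_component (G := G) hb hbY
      have hbM : b ∈ M := by
        by_contra hbM
        obtain ⟨x, hx, hx'⟩ := Finset.not_disjoint_iff.1 (hall M' hM' hMc'
          ⟨b, by rw [Finset.mem_sdiff]; exact ⟨hbM', fun h => hbM (hZM h)⟩⟩)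
        exact hbM (hM.subset_of_conn hM' hMc'
          (Finset.not_disjoint_iff.2 ⟨x, hZM (h.subZ₁ hx'), hx⟩) hbM')
      rw [Finset.mem_singleton]
      exact (hMt b hbM).symm
    have h10 := dg_singleton_le (G := G) t y₀
    obtain ⟨u, hu, huy⟩ := dg_pos.1 (show 0 < dg G Z y₀ by omega)
    have htu := htZ u hu
    have huE := h.subZ hu
    have o1 : ∀ W : Finset V, 1 ∈ Ord G (insert u W) {u} {u} := fun W =>
      Ord.single (a := u) (by simp) (by simp) (by simp)
    have p2 := Ord.snoc (U := E) (r := y₀) (by simpa using huE) (h.subY hy₀) (by simpa using huy.ne)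
      huy.symm (o1 ∅)
    have q2 := Ord.snoc (U := insert t (insert u ∅)) (Finset.subset_insert _ _) (by simp)
      (by simpa using htu.ne) htu.symm (o1 ∅)
    have q3 := Ord.snoc (U := E) (r := y₀) (by simp [Finset.insert_subset_iff, htE, huE])
      (h.subY hy₀) (by simp [hty.ne', huy.ne]) hty q2
    exact ⟨u, hZZ hu, 2, 1, Or.inl rfl, Ord.mono p2 subset_rfl subset_rfl (by simpa using hy₀),
      Ord.mono q3 subset_rfl subset_rfl (by simpa using hy₀)⟩

/-- The two-length lemma. -/
theorem TwoInst.two {E Z₁ Z Y : Finset V} (h : TwoInst G E Z₁ Z Y) :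
    ∃ z ∈ Z₁, Two G E {z} Y := by
  induction hn : E.card using Nat.strong_induction_on generalizing E Z₁ Z Y with
  | _ n ih =>
    subst hn
    replace ih : ∀ E' Z₁' Z' Y', E'.card < E.card → TwoInst G E' Z₁' Z' Y' →
      ∃ z ∈ Z₁', Two G E' {z} Y' := fun E' Z₁' Z' Y' hc h' => ih _ hc h' rfl
    by_cases hI : Indep G Y
    swap
    · unfold Indep at hI
      push Not at hI
      obtain ⟨a, ha, b, hb, hab⟩ := hI
      exact two_of_edge h ha hb hab
    by_cases hdY : ∀ w ∈ E, w ∉ Y → w ∉ Z₁ → dg G Y w ≤ 1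
    swap
    · push Not at hdY
      obtain ⟨w, hw, hwY, hwZ, hlt⟩ := hdY
      obtain ⟨a, ha, b, hb, hab, hwa, hwb⟩ := dg_two hlt
      exact two_of_vertex h ih hw hwY hwZ ha hb hab hwa hwb
    by_cases hfar : ∃ M, Sep G E Y M ∧ Conn G M ∧ (M \ Z).Nonempty ∧ Disjoint M Z₁
    · obtain ⟨M, h1, h2, h3, h4⟩ := hfar
      exact two_of_far h ih hdY h1 h2 h4 h3
    push Not at hfar
    by_cases hE : E ⊆ Y ∪ Z
    · exact two_of_star h hI hE
    obtain ⟨w, hw, hwn⟩ := Finset.not_subset.1 hE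
    simp only [Finset.mem_union, not_or] at hwn
    obtain ⟨M, hwM, hMc, hM⟩ := exists_component (G := G) hw hwn.1
    exact two_of_near h ih hI hdY hfar hM hMc ⟨w, by simp [hwM, hwn.2]⟩

end TwoLengthsMain
section HangTwo
variable {V : Type*} [DecidableEq V] {G : SimpleGraph V} [DecidableRel G.Adj]

theorem PathOn.conn {S : Finset V} {a b : V} (h : PathOn G S a b) : Conn G S := by
  induction h with
  | single a => exact conn_singleton a
  | cons hab _ hp ih => exact ih.insert' hp.left_mem hab

theorem Ord.bridge {U A D B X Y : Finset V} {q q' : V} {n₁ n₂ n : ℕ} (hA : A ⊆ U) (hD : D ⊆ U)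
    (hB : B ⊆ U) (hAD : Disjoint A D) (hAB : Disjoint A B) (hDB : Disjoint D B)
    (h₁ : n₁ ∈ Ord G A X {q}) (h : n ∈ Ord G D (nbr G D {q}) (nbr G D {q'}))
    (h₂ : n₂ ∈ Ord G B {q'} Y) : n + (n₁ + n₂) ∈ Ord G U X Y := by
  have h3 := Ord.glue (U := A ∪ D) Finset.subset_union_left Finset.subset_union_right hAD
    (fun x hx => ⟨q, (mem_nbr_singleton.1 hx).2, h₁⟩) h
  rw [Ord.comm] at h3 h₂ ⊢
  have h4 := Ord.glue (U := U) hB (Finset.union_subset hA hD)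
    (Finset.disjoint_union_right.2 ⟨hAB.symm, hDB.symm⟩)
    (fun x hx => ⟨q', (mem_nbr_singleton.1 hx).2, h₂⟩) h3
  convert h4 using 1
  ring

/-- Shrinking a two-vertex separator. -/
theorem Sep.drop {U D : Finset V} {q q' : V} (h : Sep G U {q, q'} D) (hq : nbr G D {q} = ∅) :
    Sep G U {q'} D :=
  h.shrink (Finset.disjoint_of_subset_right (by simp) h.disj) fun a ha b hb hb' hab => by
    have hbq : b = q := by
      simp only [Finset.mem_insert, Finset.mem_singleton] at hb hb'
      tauto
    subst hbq
    exact Finset.notMem_empty a (hq ▸ mem_nbr_singleton.2 ⟨ha, hab.symm⟩)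

theorem SInst.through {ε p : ℕ} {U X Y D : Finset V} {q q' : V} (h : SInst G U X Y)
    (ih : PathThm G ε U.card) (hadm : ε = 0 ∨ ε = 1 ∧ TriFree G)
    (hdeg : ∀ w ∈ U, p + 1 ≤ dg G U w + ind X w + ind Y w) (hp : 1 ≤ p)
    (hc : Conn G D) (hD : Sep G U {q, q'} D) (hq : q ∈ U)
    (hDX : Disjoint D X) (hDY : Disjoint D Y) :
    Good ε p (Ord G D (nbr G D {q}) (nbr G D {q'})) := by
  have hqD : q ∉ D := Finset.disjoint_right.1 hD.disj (by simp)
  refine ih _ _ _ _ (Finset.card_lt_card ⟨hD.sub, fun h' => hqD (h' hq)⟩) hp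
    (hadm.imp_right fun h => ⟨h.1, h.2, Or.inl (h.2.indep_nbr _ _)⟩)
    ⟨hc, nbr_subset _ _, nbr_subset _ _, ?_, ?_, ?_⟩ (Or.inr ?_)
  · by_contra hne
    exact (h.strong _ _ (hD.drop (Finset.not_nonempty_iff_eq_empty.1 hne))).1 hDX
  · by_contra hne
    rw [Finset.pair_comm] at hD
    exact (h.strong _ _ (hD.drop (Finset.not_nonempty_iff_eq_empty.1 hne))).1 hDX
  · intro c D' hD' h1 h2
    refine (h.strong c D' ((hD.trans hD').shrink hD'.disj fun a ha b hb hbc hab => ?_)).1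
      (Finset.disjoint_of_subset_left hD'.sub hDX)
    have hb' : b = q ∨ b = q' := by
      simp only [Finset.mem_insert, Finset.mem_singleton, Finset.mem_union] at hb hbc
      tauto
    rcases hb' with rfl | rfl
    · exact Finset.disjoint_left.1 h1 ha (mem_nbr_singleton.2 ⟨hD'.sub ha, hab.symm⟩)
    · exact Finset.disjoint_left.1 h2 ha (mem_nbr_singleton.2 ⟨hD'.sub ha, hab.symm⟩)
  · intro w hw
    have h1 := hdeg w (hD.sub hw)
    rw [ind_of_notMem (Finset.disjoint_left.1 hDX hw),
      ind_of_notMem (Finset.disjoint_left.1 hDY hw)] at h1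
    have h2 := dg_le_of_closed (hD.closed w hw)
    have h3 : dg G {q, q'} w ≤ dg G {q} w + dg G {q'} w := dg_union_le {q} {q'} w
    rw [dg_singleton_of_mem hw, dg_singleton_of_mem hw] at h3
    omega

theorem SInst.exit_good {ε p : ℕ} {U X Y D : Finset V} {q q' : V} (h : SInst G U X Y)
    (ih : PathThm G ε U.card) (hadm : ε = 0 ∨ ε = 1 ∧ TriFree G)
    (hdeg : ∀ w ∈ U, p + 1 ≤ dg G U w + ind X w + ind Y w) (hp : 2 ≤ p)
    (hc : Conn G D) (hD : Sep G U {q, q'} D) (hq : q ∈ U) (hq' : q' ∈ U)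
    (hDX : (X ∩ D).Nonempty) (hDY : Disjoint D Y) (hex : ∃ n, n ∈ Ord G (U \ D) {q'} Y) :
    Good ε p (Ord G U X Y) ∨ Good ε (p - 1) (Ord G D X (nbr G D {q})) := by
  have hqD : q ∉ D := Finset.disjoint_right.1 hD.disj (by simp)
  have hq'D : q' ∉ D := Finset.disjoint_right.1 hD.disj (by simp)
  by_cases hpiece : ∀ c' D₁, Sep G D {c'} D₁ → Disjoint D₁ X → ¬ Disjoint D₁ (nbr G D {q})
  · right
    refine (ih D (X ∩ D) (nbr G D {q}) (p - 1)
      (Finset.card_lt_card ⟨hD.sub, fun h' => hqD (h' hq)⟩) (by omega)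
      (hadm.imp_right fun h => ⟨h.1, h.2, Or.inr (h.2.indep_nbr _ _)⟩)
      ⟨hc, Finset.inter_subset_right, nbr_subset _ _, hDX, ?_, ?_⟩ (Or.inr ?_)).subset
      fun n hn => Ord.mono hn subset_rfl Finset.inter_subset_left subset_rfl
    · by_contra hne
      exact (h.strong _ _ (hD.drop (Finset.not_nonempty_iff_eq_empty.1 hne))).2 hDY
    · intro c D' hD' h1 h2
      refine hpiece c D' hD' ?_ h2
      rw [Finset.disjoint_left] at h1 ⊢
      exact fun x hx hxX => h1 hx (by simp [hxX, hD'.sub hx])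
    · intro w hw
      have h1 := hdeg w (hD.sub hw)
      rw [ind_of_notMem (Finset.disjoint_left.1 hDY hw)] at h1
      have h2 := dg_le_of_closed (hD.closed w hw)
      have h3 : dg G {q, q'} w ≤ dg G {q} w + dg G {q'} w := dg_union_le {q} {q'} w
      have h4 := dg_singleton_le (G := G) q' w
      have h5 : ind X w ≤ ind (X ∩ D) w := ind_mono fun h => by simp [h, hw]
      rw [dg_singleton_of_mem hw] at h3
      omega
  left
  push Not at hpiece
  obtain ⟨c', D₁, hD₁, h1, h2⟩ := hpiece
  obtain ⟨x, hx⟩ := hD₁.ne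
  obtain ⟨M, hMD, -, hMc, hM⟩ := hD₁.exists_conn hx
  replace h1 := Finset.disjoint_of_subset_left hMD h1
  replace h2 := Finset.disjoint_of_subset_left hMD h2
  clear! D₁
  obtain ⟨x, hx⟩ := hDX
  rw [Finset.mem_inter] at hx
  have hxM : x ∉ M := fun h => Finset.disjoint_left.1 h1 h hx.1
  have hc'D : c' ∈ D := by
    by_contra hc'
    have := hc.2 M ⟨hM.sub, hM.ne, by simp, fun a ha b hb hab => Or.inl
      ((hM.closed a ha b hb hab).resolve_right fun h => hc' (Finset.mem_singleton.1 h ▸ hb))⟩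
    exact hxM (this ▸ hx.2)
  have hc'M : c' ∉ M := by simpa using hM.disj
  have hMU : Sep G U {c', q'} M := by
    refine (hD.trans hM).shrink ?_ fun a ha b hb hbc hab => ?_
    · rw [Finset.disjoint_right]
      simp only [Finset.mem_insert, Finset.mem_singleton]
      rintro a (rfl | rfl)
      · exact hc'M
      · exact fun h => hq'D (hM.sub h)
    · have hb' : b = q := by
        simp only [Finset.mem_insert, Finset.mem_singleton, Finset.mem_union] at hb hbc
        tauto
      subst hb'
      exact Finset.disjoint_left.1 h2 ha (mem_nbr_singleton.2 ⟨hM.sub ha, hab.symm⟩)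
  obtain ⟨n₂, hn₂⟩ := hex
  obtain ⟨n₁, hn₁⟩ := (hc.sdiff hM hc'D).ord (X := X) (Y := {c'})
    ⟨x, by simp [hx, hxM]⟩ ⟨c', by simp [hc'D, hc'M]⟩
  exact (h.through ih hadm hdeg (by omega) hMc hMU (hD.sub hc'D) h1
    (Finset.disjoint_of_subset_left hM.sub hDY)).shift _ fun n hn =>
    Ord.bridge (Finset.sdiff_subset.trans hD.sub) hMU.sub Finset.sdiff_subset
      Finset.sdiff_disjoint (Finset.disjoint_of_subset_left Finset.sdiff_subset
        Finset.disjoint_sdiff) (Finset.disjoint_of_subset_left hM.sub Finset.disjoint_sdiff)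
      hn₁ hn hn₂

theorem SInst.exit {U X Y D C : Finset V} {u t : V} (h : SInst G U X Y)
    (hD : Sep G U (insert u C) D) (hu : u ∈ U) (ht : t ∈ U) (htD : t ∉ D)
    (hut : G.Adj u t)
    (hC : ∀ c ∈ C, ∃ n, n ∈ Ord G (U \ D) {c} Y) : ∃ n, n ∈ Ord G (U \ D) {u} Y := by
  have huD : u ∉ D := Finset.disjoint_right.1 hD.disj (by simp)
  obtain ⟨E, huE, hEc, hE⟩ := exists_component (G := G) hu huD
  have hED : E ⊆ U \ D := Finset.subset_sdiff.2 ⟨hE.sub, hE.disj⟩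
  by_cases hEY : Disjoint E Y
  swap
  · obtain ⟨y, hyE, hy⟩ := Finset.not_disjoint_iff.1 hEY
    obtain ⟨n, hn⟩ := hEc.ord (X := {u}) (Y := Y) ⟨u, by simp [huE]⟩ ⟨y, by simp [hyE, hy]⟩
    exact ⟨n, Ord.mono hn hED subset_rfl subset_rfl⟩
  exfalso
  have htE : t ∈ E := (hE.closed u huE t ht hut).resolve_right htD
  by_cases hCE : ∃ c ∈ C, c ∈ E
  · obtain ⟨c, hc, hcE⟩ := hCE
    obtain ⟨n, S, a, y, h1, h2, h3, h4, h5⟩ := hC c hc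
    obtain rfl := Finset.mem_singleton.1 h2
    have h6 : S ⊆ E := by
      have h7 := h4.conn.2 (S ∩ E) ⟨Finset.inter_subset_left, ⟨a, by simp [hcE, h4.left_mem]⟩,
        by simp, fun x hx z hz hxz => by
          rw [Finset.mem_inter] at hx
          left
          have hz' := Finset.mem_sdiff.1 (h1 hz)
          exact Finset.mem_inter.2 ⟨hz, (hE.closed x hx.2 z hz'.1 hxz).resolve_right hz'.2⟩⟩
      rw [← h7]
      exact Finset.inter_subset_right
    exact Finset.disjoint_left.1 hEY (h6 h4.right_mem) h3
  · push Not at hCE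
    have htu : t ≠ u := hut.ne'
    refine (h.strong u (E.erase u) ⟨(Finset.erase_subset _ _).trans hE.sub, ⟨t, by simp [htu, htE]⟩,
      by simp, fun a ha b hb hab => ?_⟩).2 (Finset.disjoint_of_subset_left
        (Finset.erase_subset _ _) hEY)
    rw [Finset.mem_erase] at ha
    by_cases hbu : b = u
    · simp [hbu]
    left
    refine Finset.mem_erase.2 ⟨hbu, (hE.closed a ha.2 b hb hab).resolve_right fun hbD => ?_⟩
    rcases hD.closed b hbD a (hE.sub ha.2) hab.symm with h' | h'
    · exact Finset.disjoint_left.1 hE.disj ha.2 h'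
    · exact hCE a ((Finset.mem_insert.1 h').resolve_left ha.1) ha.2

theorem SInst.pair_combine {ε p : ℕ} {U X Y D C T : Finset V} {u : V} (h : SInst G U X Y)
    (hε : ε ≤ 1) (hdeg : ∀ w ∈ U, p + 1 ≤ dg G U w + ind X w + ind Y w) (hp : 3 ≤ p)
    (hD : Sep G U (insert u C) D) (hC : C.card ≤ 1) (hu : u ∈ U) (hT : T ⊆ U)
    (hTD : Disjoint T D) (hTC : Disjoint T (insert u C)) (hT2 : 2 ≤ T.card)
    (huT : ∀ t ∈ T, G.Adj u t) (hex : ∃ n, n ∈ Ord G (U \ D) {u} Y)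
    (hG : ∀ q ∈ insert u C, q ∈ U → Good ε (p - 1) (Ord G D X (nbr G D {q}))) :
    Good ε p (Ord G U X Y) := by
  have huD : u ∉ D := Finset.disjoint_right.1 hD.disj (by simp)
  obtain ⟨E, huE, hEc, hE⟩ := exists_component (G := G) hu huD
  have hED : E ⊆ U \ D := Finset.subset_sdiff.2 ⟨hE.sub, hE.disj⟩
  have hEcl : ∀ a ∈ E, a ∉ insert u C → ∀ b ∈ U, G.Adj a b → b ∈ E := by
    intro a ha haC b hb hab
    refine (hE.closed a ha b hb hab).resolve_right fun hbD => ?_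
    rcases hD.closed b hbD a (hE.sub ha) hab.symm with h' | h'
    · exact Finset.disjoint_left.1 hE.disj ha h'
    · exact haC h'
  have hTE : T ⊆ E := fun t ht => (hE.closed u huE t (hT ht) (huT t ht)).resolve_right
    (Finset.disjoint_left.1 hTD ht)
  have hTW : T ⊆ E \ (insert u C ∩ E) := fun t ht => by
    rw [Finset.mem_sdiff]
    exact ⟨hTE ht, fun h' => Finset.disjoint_left.1 hTC ht (Finset.mem_inter.1 h').1⟩
  have hTW2 := Finset.card_le_card hTW
  obtain ⟨z, hz, m, g, hg, hm, hmg⟩ := TwoInst.two (G := G) (E := E) (Z₁ := insert u C ∩ E)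
    (Z := insert u C ∩ E) (Y := Y ∩ E)
    ⟨hEc, Finset.inter_subset_right, by
      obtain ⟨n, S, a, y, h1, h2, h3, h4, h5⟩ := hex
      obtain rfl := Finset.mem_singleton.1 h2
      have h7 := h4.conn.2 (S ∩ E) ⟨Finset.inter_subset_left, ⟨a, by simp [huE, h4.left_mem]⟩,
        by simp, fun x hx z hz hxz => by
          rw [Finset.mem_inter] at hx
          left
          have hz' := Finset.mem_sdiff.1 (h1 hz)
          exact Finset.mem_inter.2 ⟨hz, (hE.closed x hx.2 z hz'.1 hxz).resolve_right hz'.2⟩⟩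
      have h8 : y ∈ S ∩ E := h7.symm ▸ h4.right_mem
      exact ⟨y, Finset.mem_inter.2 ⟨h3, (Finset.mem_inter.1 h8).2⟩⟩,
    subset_rfl, Finset.inter_subset_right, ⟨u, by simp [huE]⟩, by
      have h1 := Finset.card_le_card (Finset.inter_subset_left (s₁ := insert u C) (s₂ := E))
      have h2 := Finset.card_insert_le u C
      omega, by
      intro w hw hwC
      have hwC' : w ∉ insert u C := fun h => hwC (by rw [Finset.mem_inter]; exact ⟨h, hw⟩)
      have h1 := hdeg w (hE.sub hw)
      have h2 := dg_le_of_closed (B := ∅) (fun b hb hab => Or.inl (hEcl w hw hwC' b hb hab))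
      have h3 : dg G ∅ w = 0 := by simp [dg]
      have h4 : ind Y w ≤ ind (Y ∩ E) w := ind_mono (fun h => by simp [hw, h])
      have h5 := ind_le X w
      omega, by
      intro c D' hD' h1 h2
      refine (h.strong c D' ⟨hD'.sub.trans hE.sub, hD'.ne, hD'.disj, fun a ha b hb hab =>
        hD'.closed a ha b (hEcl a (hD'.sub ha) (fun haC => ?_) b hb hab) hab⟩).2 ?_
      · exact Finset.disjoint_left.1 h1 ha (Finset.mem_inter.2 ⟨haC, hD'.sub ha⟩)
      · rw [Finset.disjoint_left] at h2 ⊢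
        exact fun x hx hxY => h2 hx (by simp [hxY, hD'.sub hx]),
    ⟨by
      obtain ⟨t, ht⟩ := Finset.card_pos.1 (show 0 < T.card by omega)
      exact ⟨t, hTW ht⟩, Or.inr (by omega)⟩⟩
  rw [Finset.mem_inter] at hz
  have hfin : ∀ n ∈ Ord G D X (nbr G D {z}), ∀ m ∈ Ord G E {z} (Y ∩ E), n + m ∈ Ord G U X Y := by
    intro n hn m hm
    rw [Ord.comm] at hn hm ⊢
    rw [add_comm]
    have := Ord.glue (U := U) hE.sub hD.sub hE.disj
      (fun x hx => ⟨z, (mem_nbr_singleton.1 hx).2, hm⟩) hn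
    exact Ord.mono this subset_rfl Finset.inter_subset_left subset_rfl
  exact (hG z hz.1 (hE.sub hz.2)).add_pair hε (fun n hn => ⟨hfin n hn m hm, hfin n hn _ hmg⟩) hg hp

end HangTwo
section T3
variable {V : Type*} [DecidableEq V] {G : SimpleGraph V} [DecidableRel G.Adj]

theorem good_two_of_compl {ε : ℕ} {U X Y T : Finset V} {u : V} (h : SInst G U X Y)
    (hu : u ∈ U) (hTX : T ⊆ X) (hco : Compl G T {u}) (hT : 2 ≤ T.card) :
    Good ε 2 (Ord G U X Y) := by
  have huT : u ∉ T := fun h => Finset.disjoint_left.1 hco.disjoint h (by simp)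
  obtain ⟨t, ht⟩ : T.Nonempty := Finset.card_pos.1 (by omega)
  obtain ⟨W, htW, hWc, hW⟩ := exists_component (G := G) (B := {u}) (h.subX (hTX ht))
    (by simpa using fun h : t = u => huT (h ▸ ht))
  obtain ⟨y, hyW, hyY⟩ := Finset.not_disjoint_iff.1 (h.strong u W hW).2
  obtain ⟨S, hSW, hS⟩ := hWc.path hyW htW
  obtain ⟨S', hS'S, t', ht', hp, hh⟩ := hS.firstHit ht
  have huW : u ∉ W := by simpa using hW.disj
  have key : ∀ e ≤ 1, (S'.card - 1) + (1 + 2 * e) ∈ Ord G U X Y := by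
    intro e he
    rw [Ord.comm]
    refine Ord.join hp ((hS'S.trans hSW).trans hW.sub) hyY (E := T ∪ {u}) (Y' := T)
      (Finset.union_subset (hTX.trans h.subX) (by simpa using hu)) ?_ hTX ?_
    · intro x hx hxE
      rcases Finset.mem_union.1 hxE with h1 | h1
      · exact hh x hx h1
      · rw [Finset.mem_singleton] at h1
        exact absurd (hSW (hS'S hx)) (h1 ▸ huW)
    · rw [Ord.comm]
      exact hco.ord_odd ht' (by simpa using he) (by omega)
  refine Or.inl ⟨S'.card - 1 + 1, fun i hi => ?_⟩
  convert key i (by omega) using 1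
  ring

theorem good_of_star {ε p : ℕ} {U X Y T : Finset V} {u : V} (h : SInst G U X Y)
    (ih₀ : PathThm G 0 U.card) (ih : PathThm G ε U.card) (hε : ε ≤ 1)
    (hadm : ε = 0 ∨ ε = 1 ∧ TriFree G) (hp : 2 ≤ p)
    (hdeg : ∀ w ∈ U, p + 1 ≤ dg G U w + ind X w + ind Y w)
    (hu : u ∈ U) (hTX : T ⊆ X) (hco : Compl G T {u}) (hT : 2 ≤ T.card)
    (h1 : ∀ w ∈ U, w ∉ T → w ∉ ({u} : Finset V) →
      dg G T w + dg G {u} w + ind X w ≤ 1 + ind (nbr G U T) w) :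
    Good ε p (Ord G U X Y) ∨ Y ⊆ T ∪ {u} := by
  have huT : u ∉ T := fun h => Finset.disjoint_left.1 hco.disjoint h (by simp)
  obtain ⟨t, ht⟩ : T.Nonempty := Finset.card_pos.1 (by omega)
  rcases hp.eq_or_lt with rfl | hp3
  · exact Or.inl (good_two_of_compl h hu hTX hco hT)
  have hTU := hTX.trans h.subX
  have hHU : T ∪ {u} ⊆ U := Finset.union_subset hTU (by simpa using hu)
  have huadj : ∀ t ∈ T, G.Adj u t := fun t ht => (hco t ht u (by simp)).symm
  rcases core_main (ε := 0) (p := p - 1) (a := 1) (δ := 2) (L := 2) (X := X) (Y := Y) (R := T)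
    hHU Finset.subset_union_left ⟨t, ht⟩ h.subY ih₀ (by omega) (Or.inl rfl)
    (Or.inr fun w hw hwH => by
      simp only [Finset.mem_union, not_or] at hwH
      have h2 := h1 w hw hwH.1 hwH.2
      have h3 := hdeg w hw
      have h4 := dg_sdiff_add (G := G) hHU w
      have h5 := dg_union_le (G := G) T {u} w
      omega)
    (fun r hr i hi => Ord.mono (hco.ord_odd hr (by simpa using (by omega : i ≤ 1)) (by omega))
      subset_rfl hTX subset_rfl) with h2 | h2 | ⟨M, h2⟩ | ⟨M, c, D, h2⟩
  · exact Or.inl (h2.two (by omega) (by omega) (by omega) (Or.inr ⟨hε, le_rfl⟩))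
  · exact Or.inr h2
  · left
    obtain ⟨hM, hMc, hMY, hMT⟩ := h2
    have hTM : Disjoint T M := Finset.disjoint_of_subset_left Finset.subset_union_left hM.disj.symm
    have huM : u ∉ M := Finset.disjoint_right.1 hM.disj (by simp)
    have hMu : Sep G U {u} M := hM.shrink (by simpa using huM) fun a ha b hb hbu hab =>
      hMT a ha (mem_nbr.2 ⟨hM.sub ha, b, (Finset.mem_union.1 hb).resolve_right hbu, hab.symm⟩)
    obtain ⟨x, hxM, hxX⟩ := Finset.not_disjoint_iff.1 (h.strong u M hMu).1
    refine h.pair_combine (C := ∅) (T := T) hε hdeg hp3 (by simpa using hMu) (by simp) hu hTU hTM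
      (by simpa using huT) hT huadj
      (h.exit (C := ∅) (t := t) (by simpa using hMu) hu (hTU ht) (Finset.disjoint_left.1 hTM ht)
        (huadj t ht) (by simp)) ?_
    intro q hq _
    obtain rfl : q = u := by simpa using hq
    refine (ih M (X ∩ M) (nbr G M {q}) (p - 1)
      (Finset.card_lt_card ⟨hM.sub, fun h' => huM (h' hu)⟩) (by omega)
      (hadm.imp_right fun h => ⟨h.1, h.2, Or.inr (h.2.indep_nbr _ _)⟩)
      ⟨hMc, Finset.inter_subset_right, nbr_subset _ _, ⟨x, by simp [hxM, hxX]⟩, ?_, ?_⟩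
      (Or.inr ?_)).subset fun n hn => Ord.mono hn subset_rfl Finset.inter_subset_left subset_rfl
    · by_contra hne
      have h3 : Sep G U ∅ M := hMu.shrink (by simp) fun a ha b hb _ hab => hne
        ⟨a, mem_nbr_singleton.2 ⟨ha, by rw [Finset.mem_singleton.1 hb] at hab; exact hab.symm⟩⟩
      exact huM (h.conn.2 M h3 ▸ hu)
    · intro c D hD hDX hDq
      refine (h.strong c D ((hMu.trans hD).shrink (by simpa using hD.disj) ?_)).1 ?_
      · intro a ha b hb hbc hab
        have hbq : b = q := by
          simp only [Finset.mem_union, Finset.mem_singleton] at hb hbc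
          tauto
        subst hbq
        exact Finset.disjoint_left.1 hDq ha (mem_nbr_singleton.2 ⟨hD.sub ha, hab.symm⟩)
      · rw [Finset.disjoint_left] at hDX ⊢
        exact fun x hx hxX => hDX hx (by simp [hxX, hD.sub hx])
    · intro w hw
      have h3 := hdeg w (hM.sub hw)
      have h4 := dg_le_of_closed (hMu.closed w hw)
      have h5 : ind X w ≤ ind (X ∩ M) w := ind_mono fun h => by simp [h, hw]
      have h6 := ind_le Y w
      rw [dg_singleton_of_mem hw] at h4
      omega
  · left
    obtain ⟨hM, hMc, ⟨y, hy⟩, hcM, hD, hDc, hDY, hDT⟩ := h2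
    rw [Finset.mem_inter] at hy
    have hcD : c ∉ D := by simpa using hD.disj
    have hTM : Disjoint T M := Finset.disjoint_of_subset_left Finset.subset_union_left hM.disj.symm
    have hTD : Disjoint T D := Finset.disjoint_of_subset_right hD.sub hTM
    have huM : u ∉ M := Finset.disjoint_right.1 hM.disj (by simp)
    have huD : u ∉ D := fun h => huM (hD.sub h)
    have hDU : Sep G U {u, c} D := (hM.trans hD).shrink
      (by
        rw [Finset.disjoint_right]
        simp only [Finset.mem_insert, Finset.mem_singleton]
        rintro a (rfl | rfl)
        exacts [huD, hcD]) fun a ha b hb hbu hab => by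
        have hbT : b ∈ T := by
          simp only [Finset.mem_union, Finset.mem_singleton, Finset.mem_insert] at hb hbu
          tauto
        exact hDT a ha (mem_nbr.2 ⟨hM.sub (hD.sub ha), b, hbT, hab.symm⟩)
    have hcU := hM.sub hcM
    have htu : t ≠ u := fun h => huT (h ▸ ht)
    have hyD : y ∉ D := fun h => Finset.disjoint_left.1 hDY h hy.2
    obtain ⟨n₂, hn₂⟩ := (hMc.sdiff hD hcM).ord (X := {c}) (Y := Y)
      ⟨c, by simp [hcM, hcD]⟩ ⟨y, by simp [hy, hyD]⟩
    have hexc : ∃ n, n ∈ Ord G (U \ D) {c} Y :=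
      ⟨n₂, Ord.mono hn₂ (Finset.sdiff_subset_sdiff hM.sub subset_rfl) subset_rfl subset_rfl⟩
    have hexu : ∃ n, n ∈ Ord G (U \ D) {u} Y :=
      h.exit (C := {c}) hDU hu (hTU ht) (Finset.disjoint_left.1 hTD ht)
        (huadj t ht) (by simpa using hexc)
    by_cases hDX : Disjoint D X
    · refine (h.through ih hadm hdeg (by omega) hDc hDU hu hDX hDY).shift (2 + n₂) fun n hn => ?_
      refine Ord.bridge (A := {t, u}) (B := M \ D) ?_ hDU.sub
        (Finset.sdiff_subset.trans hM.sub) ?_ ?_ Finset.disjoint_sdiff ?_ hn hn₂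
      · simp [Finset.insert_subset_iff, hu, hTU ht]
      · simp [Finset.disjoint_left.1 hTD ht, huD]
      · simp [Finset.disjoint_left.1 hTM ht, huM]
      · exact ⟨{t, u}, t, u, subset_rfl, hTX ht, by simp, .cons (huadj t ht).symm
          (by simpa using htu) (.single u), Finset.card_pair htu⟩
    · obtain ⟨x, hxD, hxX⟩ := Finset.not_disjoint_iff.1 hDX
      have hne : (X ∩ D).Nonempty := ⟨x, by simp [hxD, hxX]⟩
      rcases h.exit_good ih hadm hdeg (by omega) hDc hDU hu hcU hne hDY hexc with h3 | h3
      · exact h3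
      rcases h.exit_good ih hadm hdeg (by omega) hDc (by rwa [Finset.pair_comm]) hcU hu hne hDY
        hexu with h4 | h4
      · exact h4
      refine h.pair_combine (C := {c}) (T := T) hε hdeg hp3 hDU (by simp) hu hTU hTD ?_
        hT huadj hexu ?_
      · rw [Finset.disjoint_left]
        intro t' ht' h5
        simp only [Finset.mem_insert, Finset.mem_singleton] at h5
        rcases h5 with rfl | rfl
        · exact huT ht'
        · exact Finset.disjoint_left.1 hTM ht' hcM
      · intro q hq _
        simp only [Finset.mem_insert, Finset.mem_singleton] at hq
        rcases hq with rfl | rfl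
        exacts [h3, h4]

theorem compl_step {ε p : ℕ} {U X Y S T : Finset V} (h : SInst G U X Y)
    (ih₀ : PathThm G 0 U.card) (ih : PathThm G ε U.card) (hε : ε ≤ 1)
    (hadm : ε = 0 ∨ ε = 1 ∧ TriFree G) (hp : 2 ≤ p)
    (hdeg : ∀ w ∈ U, p + 1 ≤ dg G U w + ind X w + ind Y w)
    (hS : S ⊆ U) (hTX : T ⊆ X) (hco : Compl G T S) (hT : S.card + 1 ≤ T.card)
    (hε' : ε = 0 ∨ 1 ≤ S.card)
    (h1 : ∀ w ∈ U, w ∉ T → w ∉ S →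
      dg G T w + dg G S w + ind X w ≤ S.card + ind (nbr G U T) w)
    (h2 : 2 ≤ S.card → ∀ w ∈ U, w ∉ T → w ∉ S → w ∉ nbr G U T →
      dg G S w + ind X w + 1 ≤ S.card + ind (nbr G U S) w) :
    Good ε p (Ord G U X Y) ∨ Y ⊆ T ∪ S := by
  by_cases hs1 : S.card = 1
  · obtain ⟨u, rfl⟩ := Finset.card_eq_one.1 hs1
    exact good_of_star h ih₀ ih hε hadm hp hdeg (hS (by simp)) hTX hco (by simpa using hT)
      (by simpa using h1)
  have hTU := hTX.trans h.subX
  have hHU : T ∪ S ⊆ U := Finset.union_subset hTU hS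
  have hTne : T.Nonempty := Finset.card_pos.1 (by omega)
  have hd1 : max 1 (p - S.card) ≤ 1 ∨ ∀ w ∈ U, w ∉ T ∪ S →
      max 1 (p - S.card) + 1 ≤ dg G (U \ (T ∪ S)) w + ind (nbr G U T) w + ind Y w := by
    by_cases hpc : p - S.card ≤ 1
    · left; omega
    right
    intro w hw hwH
    simp only [Finset.mem_union, not_or] at hwH
    have h3 := hdeg w hw
    have h4 := dg_sdiff_add (G := G) hHU w
    have h5 := dg_union_le (G := G) T S w
    have h6 := h1 w hw hwH.1 hwH.2
    omega
  have ho1 : ∀ r ∈ T, ∀ i < S.card + 1, 1 + 2 * i ∈ Ord G (T ∪ S) X {r} := fun r hr i hi =>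
    Ord.mono (hco.ord_odd hr (by omega) (by omega)) subset_rfl hTX subset_rfl
  by_cases hs0 : S = ∅
  · subst hs0
    rcases core_hang (ε := 0) (p := p) (a := 1) (δ := 2) (L := 1)
      (p' := 1) (a' := 0) (δ' := 2) (L' := p) (X := X) (Y := Y) (R := T) (R' := ∅)
      (h.hU hHU (hTne.mono Finset.subset_union_left)) (fun c D hD _ => (h.strong c D hD).2)
      hHU Finset.subset_union_left hTne subset_rfl h.subY ih₀
      (by omega) (by omega) (Or.inl rfl) (by simpa [max_eq_right (by omega : 1 ≤ p)] using hd1)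
      (by simpa using ho1) (Or.inl le_rfl) (by simp) with h3 | h3 | ⟨t, h3⟩
    · exact Or.inl (h3.two (by omega) (by omega) (by omega) (by simp at hε'; omega))
    · exact Or.inr h3
    · exact Or.inl (h3.two (by omega) (by omega) (by omega) (by omega))
  have hs2 : 2 ≤ S.card := by
    have := Finset.card_pos.2 (Finset.nonempty_iff_ne_empty.2 hs0)
    omega
  rcases core_hang (ε := 0) (p := max 1 (p - S.card)) (a := 1) (δ := 2) (L := S.card + 1)
    (p' := max 1 (p + 1 - S.card)) (a' := 2) (δ' := 2) (L' := S.card) (X := X) (Y := Y)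
    (R := T) (R' := S)
    (h.hU hHU (hTne.mono Finset.subset_union_left)) (fun c D hD _ => (h.strong c D hD).2)
    hHU Finset.subset_union_left hTne subset_rfl h.subY ih₀
    (by omega) (by omega) (Or.inl rfl) hd1 ho1 (by
      by_cases hpc : p + 1 - S.card ≤ 1
      · left; omega
      right
      intro w hw hwH hwT
      have h6 := dg_eq_zero_of_notMem_nbr hw hwT
      simp only [Finset.mem_union, not_or] at hwH
      have h3 := hdeg w hw
      have h4 := dg_sdiff_add (G := G) hHU w
      have h5 := dg_union_le (G := G) T S w
      have h7 := h2 hs2 w hw hwH.1 hwH.2 hwT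
      omega)
    (fun r hr i hi => Ord.mono (hco.ord_even hr (by omega) (by omega)) subset_rfl hTX subset_rfl)
    with h3 | h3 | ⟨t, h3⟩
  · exact Or.inl (h3.two (by omega) (by omega) (by omega) (Or.inr ⟨hε, by omega⟩))
  · exact Or.inr h3
  · exact Or.inl (h3.two (by omega) (by omega) (by omega) (Or.inr ⟨hε, by omega⟩))

end T3
section TA
variable {V : Type*} [DecidableEq V] {G : SimpleGraph V} [DecidableRel G.Adj]

variable (G) in
/-- A largest set `S` in `U` with at least `|S| + 1` common neighbours `T` in `X`. -/
structure MaxStar (U X S T : Finset V) : Prop where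
  subS : S ⊆ U
  subT : T ⊆ X
  co : Compl G T S
  card : S.card + 1 ≤ T.card
  all : ∀ w ∈ X, (∀ u ∈ S, G.Adj w u) → w ∈ T
  le : ∀ w ∈ U, w ∉ S → dg G T w ≤ S.card + 1

theorem exists_maxStar {U X S₀ T₀ : Finset V} (hS₀ : S₀ ⊆ U) (hT₀ : T₀ ⊆ X) (hco : Compl G T₀ S₀)
    (hc : S₀.card + 1 ≤ T₀.card) : ∃ S T, S₀.card ≤ S.card ∧ MaxStar G U X S T := by
  obtain ⟨S, ⟨T, hT, hTS, hTc⟩, hS₀S, hSU, hmax⟩ := exists_max_finset (U := U)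
    (fun S => ∃ T ⊆ X, Compl G T S ∧ S.card + 1 ≤ T.card) hS₀ ⟨T₀, hT₀, hco, hc⟩
  have hsub : T ⊆ X.filter fun w => ∀ u ∈ S, G.Adj w u := fun t ht =>
    Finset.mem_filter.2 ⟨hT ht, fun u hu => hTS t ht u hu⟩
  refine ⟨S, X.filter fun w => ∀ u ∈ S, G.Adj w u, Finset.card_le_card hS₀S, hSU,
    Finset.filter_subset _ _, fun a ha b hb => (Finset.mem_filter.1 ha).2 b hb,
    hTc.trans (Finset.card_le_card hsub), fun w hw h => Finset.mem_filter.2 ⟨hw, h⟩, ?_⟩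
  intro w hw hwS
  by_contra! hlt
  refine hmax w hw hwS ⟨(X.filter fun w => ∀ u ∈ S, G.Adj w u).filter (G.Adj w),
    (Finset.filter_subset _ _).trans (Finset.filter_subset _ _), ?_, ?_⟩
  · intro a ha b hb
    rw [Finset.mem_filter] at ha
    rcases Finset.mem_insert.1 hb with rfl | hb'
    · exact ha.2.symm
    · exact (Finset.mem_filter.1 ha.1).2 b hb'
  · rw [Finset.card_insert_of_notMem hwS]
    exact hlt

variable (G) in
/-- No edge has both ends adjacent to two vertices of `X`. -/
def NoDiamond (U X : Finset V) : Prop :=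
  ∀ w ∈ U, ∀ u ∈ U, G.Adj w u → ∀ T ⊆ X, Compl G T {u} → dg G T w ≤ 1

theorem good_or_noDiamond {p : ℕ} {U X Y : Finset V} (h : SInst G U X Y) (ih : PathThm G 0 U.card)
    (hdeg : ∀ w ∈ U, p + 1 ≤ dg G U w + ind X w + ind Y w) (hp : 2 ≤ p)
    (hX : Indep G X) (hY : Indep G Y) : Good 0 p (Ord G U X Y) ∨ NoDiamond G U X := by
  by_cases hd : NoDiamond G U X
  · exact Or.inr hd
  left
  unfold NoDiamond at hd
  push Not at hd
  obtain ⟨w, hw, u, hu, hwu, T, hT, hco, hlt⟩ := hd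
  obtain ⟨a, ha, b, hb, hab, haw, hbw⟩ := dg_two hlt
  refine good_of_diamond h ih hdeg hp hX hY (t₁ := a) (t₂ := b) (Q := {w, u}) (hT ha) (hT hb) hab
    ?_ ?_ ?_ ?_
  · simp [Finset.insert_subset_iff, hw, hu]
  · intro x hx y hy hxy
    simp only [Finset.mem_insert, Finset.mem_singleton] at hx hy
    rcases hx with rfl | rfl <;> rcases hy with rfl | rfl
    exacts [absurd rfl hxy, hwu, hwu.symm, absurd rfl hxy]
  · rw [Finset.card_pair hwu.ne]
  · intro x hx y hy
    simp only [Finset.mem_insert, Finset.mem_singleton] at hx hy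
    rcases hx with rfl | rfl <;> rcases hy with rfl | rfl
    exacts [haw.symm, hco _ ha _ (by simp), hbw.symm, hco _ hb _ (by simp)]

theorem MaxStar.step {p : ℕ} {U X Y S T : Finset V} (m : MaxStar G U X S T) (h : SInst G U X Y)
    (ih : PathThm G 0 U.card) (hdeg : ∀ w ∈ U, p + 1 ≤ dg G U w + ind X w + ind Y w)
    (hp : 2 ≤ p) (hX : Indep G X) (hd : NoDiamond G U X) :
    Good 0 p (Ord G U X Y) ∨ Y ⊆ T ∪ S := by
  have hwX : ∀ w, w ∈ X → w ∉ T → dg G T w = 0 ∧ dg G S w + 1 ≤ S.card := by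
    intro w hw hwT
    refine ⟨dg_eq_zero.2 fun x hx => hX w hw x (m.subT hx), ?_⟩
    by_contra! hlt
    refine hwT (m.all w hw fun u hu => ?_)
    by_contra hwu
    have := dg_succ_le hu hwu
    omega
  refine compl_step h ih ih (by omega) (Or.inl rfl) hp hdeg m.subS m.subT m.co m.card (Or.inl rfl)
    ?_ ?_
  · intro w hw hwT hwS
    have h1 : 0 < dg G T w → ind (nbr G U T) w = 1 := ind_nbr_pos hw
    have h2 := dg_le_card (G := G) S w
    by_cases hx : w ∈ X
    · have h3 := hwX w hx hwT
      rw [ind_of_mem hx]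
      omega
    · rw [ind_of_notMem hx]
      have h4 := m.le w hw hwS
      have h5 : 0 < dg G S w → dg G T w ≤ 1 := fun h6 => by
        obtain ⟨u, hu, hwu⟩ := dg_pos.1 h6
        exact hd w hw u (m.subS hu) hwu T m.subT (m.co.mono subset_rfl (by simpa using hu))
      omega
  · intro hs w hw hwT hwS hwn
    have h1 : 0 < dg G S w → ind (nbr G U S) w = 1 := ind_nbr_pos hw
    have h2 := dg_le_card (G := G) S w
    by_cases hx : w ∈ X
    · have h3 := hwX w hx hwT
      rw [ind_of_mem hx]
      omega
    · rw [ind_of_notMem hx]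
      omega

theorem MaxStar.fin {ε p : ℕ} {U X S : Finset V} (m : MaxStar G U X S X) (h : SInst G U X X)
    (ih : PathThm G ε U.card) (hdeg : ∀ w ∈ U, p + 1 ≤ dg G U w + ind X w + ind X w)
    (hp : 2 ≤ p) (hX : Indep G X) (hd : NoDiamond G U X)
    (hadm : ε = 0 ∨ ε = 1 ∧ TriFree G) : Good ε p (Ord G U X X) := by
  obtain ⟨b, hb⟩ := h.neX
  have hX2 : 2 ≤ X.card := by
    obtain ⟨u, hu, v, hv, huv⟩ := exists_adj_of_deg h.conn.1 hp (Or.inr hdeg)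
    obtain ⟨x, hx, hxb⟩ := h.exists_ne hu hv huv b
    rw [← Finset.card_pair hxb]
    exact Finset.card_le_card (by simp [Finset.insert_subset_iff, hb, hx])
  obtain ⟨S', hS', hSc⟩ := Finset.exists_subset_card_eq
    (show min S.card (X.card - 2) ≤ S.card from min_le_left _ _)
  set T := X.erase b with hT
  have hTc : T.card = X.card - 1 := Finset.card_erase_of_mem hb
  have hco : Compl G T S' := m.co.mono (Finset.erase_subset _ _) hS'
  have hbS : b ∉ S' := fun hbS => Finset.disjoint_left.1 m.co.disjoint hb (hS' hbS)
  have hHU : T ∪ S' ⊆ U.erase b := by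
    intro x hx
    rcases Finset.mem_union.1 hx with h1 | h1
    · exact Finset.erase_subset_erase _ h.subX h1
    · exact Finset.mem_erase.2 ⟨fun h2 => hbS (h2 ▸ h1), m.subS (hS' h1)⟩
  have hTne : T.Nonempty := Finset.card_pos.1 (by omega)
  have ho : ∀ r ∈ T, ∀ i < S'.card + 1, 1 + 2 * i ∈ Ord G (T ∪ S') (X.erase b) {r} :=
    fun r hr i hi => hco.ord_odd hr (by omega) (by omega)
  have hwX : ∀ w ∈ U, w ≠ b → w ∉ T ∪ S' → p + 1 ≤ dg G U w := by
    intro w hw hwb hwH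
    have h1 := hdeg w hw
    rw [ind_of_notMem] at h1
    · exact h1
    · simp only [hT, Finset.mem_union, Finset.mem_erase] at hwH
      tauto
  obtain ⟨p', L', hp', hL', hpL, hdeg', hord'⟩ : ∃ p' L', 1 ≤ p' ∧ 1 ≤ L' ∧ p + 1 ≤ p' + L' ∧
      (p' ≤ 1 ∨ ∀ w ∈ U, w ≠ b → w ∉ T ∪ S' → w ∉ nbr G U T →
        p' + 1 + dg G (T ∪ S') w ≤ dg G U w + ind (nbr G U S') w) ∧
      ∀ r ∈ S', ∀ i < L', 2 + 2 * i ∈ Ord G (T ∪ S') (X.erase b) {r} := by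
    by_cases hs0 : S' = ∅
    · exact ⟨1, p, le_rfl, by omega, by omega, Or.inl le_rfl, by simp [hs0]⟩
    have hs1 : 1 ≤ S'.card := Finset.card_pos.2 (Finset.nonempty_iff_ne_empty.2 hs0)
    refine ⟨max 1 (p + 1 - S'.card), S'.card, by omega, hs1, by omega, ?_,
      fun r hr i hi => hco.ord_even hr (by omega) (by omega)⟩
    by_cases hpc : p + 1 - S'.card ≤ 1
    · left; omega
    right
    intro w hw hwb hwH hwn
    have h1 := hwX w hw hwb hwH
    have h2 := dg_eq_zero_of_notMem_nbr hw hwn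
    have h3 := dg_union_le (G := G) T S' w
    have h4 : 0 < dg G S' w → ind (nbr G U S') w = 1 := ind_nbr_pos hw
    have h5 := dg_le_card (G := G) S' w
    omega
  rcases fin_step (ε := ε) (p := max 1 (p - S'.card)) (a := 1) (δ := 2) (L := S'.card + 1)
    (a' := 2) (δ' := 2) (H := T ∪ S') (R := T) (R' := S') h hb Finset.subset_union_left hHU
    Finset.subset_union_left hTne subset_rfl ih (by omega) hp' hadm (by
      by_cases hpc : p - S'.card ≤ 1
      · left; omega
      right
      intro w hw hwb hwH
      have h1 := hwX w hw hwb hwH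
      have h2 := dg_le_card (G := G) S' w
      have h3 := dg_union_le (G := G) T S' w
      have h4 : 0 < dg G T w → ind (nbr G U T) w = 1 := ind_nbr_pos hw
      have h5 := dg_le_card (G := G) T w
      have h6 : 0 < dg G S' w → dg G T w ≤ 1 := fun h6 => by
        obtain ⟨u, hu, hwu⟩ := dg_pos.1 h6
        exact hd w hw u (m.subS (hS' hu)) hwu T (Finset.erase_subset _ _)
          (hco.mono subset_rfl (by simpa using hu))
      have h7 : dg G T w ≤ S'.card + 1 := by
        by_cases hc : S.card ≤ X.card - 2
        · obtain rfl : S' = S := Finset.eq_of_subset_of_card_le hS' (by omega)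
          refine le_trans (dg_mono (Finset.erase_subset _ _) _) (m.le w hw fun h8 => hwH ?_)
          exact Finset.mem_union_right _ h8
        · omega
      omega) ho hdeg' hord' with h1 | h1 | ⟨t, h1⟩
  · exact h1.two (by omega) (by omega) (by omega) (by omega)
  · left
    refine ⟨1, fun i hi => ?_⟩
    obtain ⟨r, hr⟩ := hTne
    have hbU := h.subX hb
    have h2 : dg G U b ≤ dg G ∅ b + dg G S' b := dg_le_of_closed fun x hx hbx => Or.inr <| by
      have hxT : x ∉ T := fun hxT => hX b hb x (Finset.erase_subset _ _ hxT) hbx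
      exact (Finset.mem_union.1 (h1 (mem_nbr_singleton.2
        ⟨Finset.mem_erase.2 ⟨hbx.ne', hx⟩, hbx⟩))).resolve_left hxT
    have h3 := dg_le_card (G := G) S' b
    have h4 := dg_le_card (G := G) ∅ b
    have h5 := hdeg b hbU
    have h6 := ind_le X b
    simp only [Finset.card_empty] at h4
    exact Ord.mono (ho r hr i (by omega)) (hHU.trans (Finset.erase_subset _ _))
      (Finset.erase_subset _ _) (by simpa using Finset.erase_subset _ _ hr)
  · exact h1.two hp' hL' hpL (by omega)

/-- The path theorem with `p` orders. -/
theorem pathThm_zero (N : ℕ) : PathThm G 0 N := by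
  induction N with
  | zero => intro M X Y p h; omega
  | succ N IH =>
  intro U X Y p hU hp hadm h hdeg
  have ih : PathThm G 0 U.card := IH.mono (by omega)
  rcases hp.eq_or_lt with rfl | hp2
  · obtain ⟨x, hx⟩ := h.neX
    obtain ⟨y, hy⟩ := h.neY
    obtain ⟨n, hn⟩ := h.conn.ord (X := X) (Y := Y) ⟨x, by simp [hx, h.subX hx]⟩
      ⟨y, by simp [hy, h.subY hy]⟩
    exact Good.of_one hn le_rfl
  rcases h.good_or_strong ih hp hadm hdeg with h1 | h
  · exact h1
  have hdeg := hdeg.resolve_left (by omega)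
  have hdeg' : ∀ w ∈ U, p + 1 ≤ dg G U w + ind Y w + ind X w := fun w hw => by
    have := hdeg w hw; omega
  by_cases hX : Indep G X
  swap
  · exact good_clique_of_edge h ih hdeg hp2 hX
  by_cases hY : Indep G Y
  swap
  · rw [Ord.comm]; exact good_clique_of_edge h.symm ih hdeg' hp2 hY
  rcases good_or_noDiamond h ih hdeg hp2 hX hY with h1 | hdX
  · exact h1
  rcases good_or_noDiamond h.symm ih hdeg' hp2 hY hX with h1 | hdY
  · rw [Ord.comm]; exact h1
  obtain ⟨S, T, -, m⟩ := exists_maxStar (G := G) (U := U) (X := X) (S₀ := ∅) (T₀ := X)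
    (by simp) subset_rfl (fun _ _ _ h => by simp at h) (by simpa using h.neX.card_pos)
  obtain ⟨S', T', -, m'⟩ := exists_maxStar (G := G) (U := U) (X := Y) (S₀ := ∅) (T₀ := Y)
    (by simp) subset_rfl (fun _ _ _ h => by simp at h) (by simpa using h.neY.card_pos)
  rcases m.step h ih hdeg hp2 hX hdX with h1 | h1
  · exact h1
  rcases m'.step h.symm ih hdeg' hp2 hY hdY with h2 | h2
  · rw [Ord.comm]; exact h2
  have key : ∀ {A B C : Finset V}, Indep G C → Compl G A B → C ⊆ A ∪ B → C ⊆ A ∨ C ⊆ B := by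
    intro A B C hC hAB hCAB
    by_contra! hcon
    obtain ⟨⟨a, ha, ha'⟩, ⟨b, hb, hb'⟩⟩ :=
      And.intro (Finset.not_subset.1 hcon.1) (Finset.not_subset.1 hcon.2)
    exact hC b hb a ha (hAB b ((Finset.mem_union.1 (hCAB hb)).resolve_right hb') a
      ((Finset.mem_union.1 (hCAB ha)).resolve_left ha'))
  have hc1 := m.card
  have hc2 := m'.card
  have hc3 := Finset.card_le_card m.subT
  have hc4 := Finset.card_le_card m'.subT
  have hXY : X.card ≤ Y.card := by
    rcases key hX m'.co h2 with h3 | h3 <;> have := Finset.card_le_card h3 <;> omega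
  have hYT : Y ⊆ T := (key hY m.co h1).resolve_right fun h3 => by
    have := Finset.card_le_card h3; omega
  have hYX : Y = X := Finset.eq_of_subset_of_card_le (hYT.trans m.subT) hXY
  have hTX : T = X := Finset.Subset.antisymm m.subT (hYX ▸ hYT)
  subst hYX
  rw [hTX] at m
  exact m.fin h ih hdeg hp2 hX hdX (Or.inl rfl)

end TA
section TB
variable {V : Type*} [DecidableEq V] {G : SimpleGraph V} [DecidableRel G.Adj]

theorem PathOn.reach {U B M S : Finset V} {y m : V} (h : PathOn G S y m) (hS : S ⊆ U)
    (hM : Sep G U B M) (hm : m ∈ M) (hy : y ∉ M) :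
    ∃ a ∈ B, ∃ T ⊆ S, Disjoint T M ∧ PathOn G T y a ∧ ∀ x ∈ T, x ∈ B → x = a := by
  induction h with
  | single a => exact absurd hm hy
  | @cons a b c S' hab ha hp ih =>
    by_cases haB : a ∈ B
    · exact ⟨a, haB, {a}, by simp, by simpa using hy, .single a, by simp⟩
    · have hbM : b ∉ M := fun hbM => (hM.closed b hbM a (hS (by simp)) hab.symm).elim hy haB
      obtain ⟨a', ha', T, hT, hTM, hTp, hTB⟩ := ih ((Finset.subset_insert _ _).trans hS) hm hbM
      refine ⟨a', ha', insert a T, Finset.insert_subset_insert _ hT, ?_,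
        .cons hab (fun h => ha (hT h)) hTp, ?_⟩
      · simp [hTM, hy]
      · intro x hx hxB
        rcases Finset.mem_insert.1 hx with rfl | hx'
        · exact absurd hxB haB
        · exact hTB x hx' hxB

theorem TriFree.not_adj {A B : Finset V} (ht : TriFree G) (hc : Compl G A B) {w : V}
    (h : 0 < dg G A w) : dg G B w = 0 := by
  obtain ⟨a, ha, hwa⟩ := dg_pos.1 h
  exact dg_eq_zero.2 fun b hb hwb => ht w a b hwa (hc a ha b hb) hwb

theorem TriFree.indep_left {A B : Finset V} (ht : TriFree G) (hc : Compl G A B)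
    (hB : B.Nonempty) : Indep G A := by
  obtain ⟨b, hb⟩ := hB
  exact fun x hx y hy hxy => ht x y b hxy (hc y hy b hb) (hc x hx b hb)

theorem Indep.subset_or {A B C : Finset V} (hC : Indep G C) (hAB : Compl G A B)
    (hCAB : C ⊆ A ∪ B) : C ⊆ A ∨ C ⊆ B := by
  by_contra! hcon
  obtain ⟨a, ha, ha'⟩ := Finset.not_subset.1 hcon.1
  obtain ⟨b, hb, hb'⟩ := Finset.not_subset.1 hcon.2
  exact hC b hb a ha (hAB b ((Finset.mem_union.1 (hCAB hb)).resolve_right hb') a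
    ((Finset.mem_union.1 (hCAB ha)).resolve_left ha'))

theorem good_of_sparse {p : ℕ} {U X Y : Finset V} (ht : TriFree G) (hY : Indep G Y)
    (h : SInst G U X Y) (ih : PathThm G 1 U.card) (hp : 2 ≤ p)
    (hdeg : ∀ w ∈ U, p + 1 ≤ dg G U w + ind X w + ind Y w)
    (hX : ∀ w ∈ U, dg G X w ≤ 1) : Good 1 p (Ord G U X Y) := by
  rcases core_hang (ε := 1) (p := p) (a := 1) (δ := 2) (L := 1) (p' := 1) (a' := 0) (δ' := 2)
    (L' := p) (X := X) (Y := Y) (H := X) (R := X) (R' := ∅)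
    (h.hU h.subX h.neX) (fun c D hD _ => (h.strong c D hD).2) h.subX subset_rfl h.neX
    (by simp) h.subY ih (by omega) (by omega) (Or.inr ⟨rfl, ht, hY⟩)
    (Or.inr fun w hw hwX => by
      have h1 := hdeg w hw
      have h2 := dg_sdiff_add (G := G) h.subX w
      have h3 := hX w hw
      have h4 : 0 < dg G X w → ind (nbr G U X) w = 1 := ind_nbr_pos hw
      rw [ind_of_notMem hwX] at h1
      omega)
    (fun r hr i hi => by
      obtain rfl : i = 0 := by omega
      exact Ord.single hr hr (by simp))
    (Or.inl le_rfl) (by simp) with h1 | h1 | ⟨t, h1⟩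
  · exact h1.two (by omega) (by omega) (by omega) (by omega)
  swap
  · exact h1.two (by omega) (by omega) (by omega) (by omega)
  obtain ⟨y, hy⟩ := h.neY
  obtain ⟨v, hv, hvX⟩ : ∃ v ∈ U, v ∉ X := by
    by_contra! hUX
    have hUX' : U = X := Finset.Subset.antisymm hUX h.subX
    have h2 := hdeg y (h.subY hy)
    have h3 := hX y (h.subY hy)
    rw [hUX', ind_of_mem (h1 hy), ind_of_mem hy] at h2
    obtain ⟨x, hx, hyx⟩ := dg_pos.1 (show 0 < dg G X y by omega)
    have h4 := hdeg x (h.subX hx)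
    have h5 := hX x (h.subX hx)
    have h6 := ind_le X x
    rw [hUX', ind_of_notMem fun hxY => hY y hy x hxY hyx] at h4
    omega
  obtain ⟨M, hvM, hMc, hM⟩ := exists_component (G := G) hv hvX
  have hMX : Disjoint M X := hM.disj
  have hMB : Sep G U (nbr G X M) M := hM.shrink
    (Finset.disjoint_of_subset_right (nbr_subset _ _) hMX) fun a ha b hb hbn hab =>
    hbn (mem_nbr.2 ⟨hb, a, ha, hab⟩)
  have hyM : y ∉ M := fun hyM => Finset.disjoint_left.1 hMX hyM (h1 hy)
  obtain ⟨S, hSU, hS⟩ := h.conn.path (h.subY hy) hv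
  obtain ⟨a, ha, T, hTS, hTM, hT, hTB⟩ := hS.reach hSU hMB hvM hyM
  obtain ⟨haX, m, hm, hma⟩ := mem_nbr.1 ha
  have hMY : Disjoint M Y := Finset.disjoint_of_subset_right h1 hMX
  have hadj : ∀ w ∈ M, w ∉ nbr G M (X.erase a) → w ∉ nbr G M {a} → ∀ x ∈ X, ¬ G.Adj w x := by
    intro w hw h2 h3 x hx hwx
    by_cases hxa : x = a
    · exact h3 (mem_nbr_singleton.2 ⟨hw, hxa ▸ hwx.symm⟩)
    · exact h2 (mem_nbr.2 ⟨hw, x, Finset.mem_erase.2 ⟨hxa, hx⟩, hwx.symm⟩)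
  refine (ih M (nbr G M (X.erase a)) (nbr G M {a}) p
    (Finset.card_lt_card ⟨hM.sub, fun h' => hyM (h' (h.subY hy))⟩) (by omega)
    (Or.inr ⟨rfl, ht, Or.inr (ht.indep_nbr _ _)⟩)
    ⟨hMc, nbr_subset _ _, nbr_subset _ _, ?_, ⟨m, mem_nbr_singleton.2 ⟨hm, hma.symm⟩⟩, ?_⟩
    (Or.inr ?_)).shift (T.card + 1) fun n hn => ?_
  · by_contra hne
    have hMa : Sep G U {a} M := hM.shrink (by simpa using Finset.disjoint_right.1 hMX haX)
      fun w hw b hb hba hwb => hne ⟨w, mem_nbr.2 ⟨hw, b, Finset.mem_erase.2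
        ⟨by simpa using hba, hb⟩, hwb.symm⟩⟩
    exact (h.strong _ _ hMa).2 hMY
  · intro c D hD hDX hDa
    have hDc : Sep G U {c} D := (hM.trans hD).shrink hD.disj fun w hw b hb hbc hwb => by
      refine hadj w (hD.sub hw) (Finset.disjoint_left.1 hDX hw) (Finset.disjoint_left.1 hDa hw) b
        ?_ hwb
      exact (Finset.mem_union.1 hb).resolve_right hbc
    exact (h.strong c D hDc).1 (Finset.disjoint_of_subset_left hD.sub hMX)
  · intro w hw
    have h2 := hdeg w (hM.sub hw)
    have h3 := hX w (hM.sub hw)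
    have h4 := dg_le_of_closed (hM.closed w hw)
    rw [ind_of_notMem (Finset.disjoint_left.1 hMX hw),
      ind_of_notMem (Finset.disjoint_left.1 hMY hw)] at h2
    by_cases h5 : w ∈ nbr G M (X.erase a)
    · rw [ind_of_mem h5]; omega
    by_cases h6 : w ∈ nbr G M {a}
    · rw [ind_of_mem h6]; omega
    have := dg_eq_zero.2 (hadj w hw h5 h6)
    omega
  · have h2 : T.card + n ∈ Ord G (T ∪ M) Y (nbr G M (X.erase a)) := by
      rw [Ord.comm] at hn
      refine Ord.glue Finset.subset_union_left Finset.subset_union_right hTM (fun x hx =>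
        ⟨a, (mem_nbr_singleton.1 hx).2, T, y, a, subset_rfl, hy, by simp, hT, rfl⟩) hn
    rw [Ord.comm] at h2
    have hTU := hTS.trans hSU
    have h3 := Ord.glue (U := U) (X := X) (H := (nbr G X M).erase a) (n := 1)
      (((Finset.erase_subset _ _).trans (nbr_subset _ _)).trans h.subX)
      (Finset.union_subset hTU hM.sub) (by
        rw [Finset.disjoint_left]
        intro x hx hxT
        obtain ⟨hxa, hx⟩ := Finset.mem_erase.1 hx
        rcases Finset.mem_union.1 hxT with h3 | h3
        · exact hxa (hTB x h3 hx)
        · exact Finset.disjoint_left.1 hMX h3 (nbr_subset _ _ hx))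
      (fun x hx => by
        obtain ⟨hxM, r, hr, hrx⟩ := mem_nbr.1 hx
        have hr' := Finset.mem_erase.1 hr
        exact ⟨r, hrx, Ord.single (a := r)
          (Finset.mem_erase.2 ⟨hr'.1, mem_nbr.2 ⟨hr'.2, x, hxM, hrx.symm⟩⟩) hr'.2 (by simp)⟩) h2
    convert h3 using 1
    ring

theorem MaxStar.step_one {p : ℕ} {U X Y S T : Finset V} (ht : TriFree G)
    (m : MaxStar G U X S T) (h : SInst G U X Y)
    (ih : PathThm G 1 U.card) (hdeg : ∀ w ∈ U, p + 1 ≤ dg G U w + ind X w + ind Y w)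
    (hp : 2 ≤ p) (hS : 1 ≤ S.card)
    (hB : ∀ w ∈ X, w ∉ T → w ∉ S → dg G T w ≤ S.card) :
    Good 1 p (Ord G U X Y) ∨ Y ⊆ T ∪ S := by
  have hwX : ∀ w, w ∈ X → w ∉ T → dg G S w + 1 ≤ S.card := by
    intro w hw hwT
    by_contra! hlt
    refine hwT (m.all w hw fun u hu => ?_)
    by_contra hwu
    have := dg_succ_le hu hwu
    omega
  refine compl_step h (pathThm_zero _) ih le_rfl (Or.inr ⟨rfl, ht⟩) hp hdeg m.subS m.subT m.co
    m.card (Or.inr hS) ?_ ?_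
  · intro w hw hwT hwS
    have h1 : 0 < dg G T w → ind (nbr G U T) w = 1 := ind_nbr_pos hw
    have h2 := dg_le_card (G := G) S w
    have h3 : 0 < dg G T w → dg G S w = 0 := ht.not_adj m.co
    by_cases hx : w ∈ X
    · have h4 := hwX w hx hwT
      have h5 := hB w hx hwT hwS
      rw [ind_of_mem hx]
      omega
    · rw [ind_of_notMem hx]
      have h4 := m.le w hw hwS
      omega
  · intro hs w hw hwT hwS hwn
    have h1 : 0 < dg G S w → ind (nbr G U S) w = 1 := ind_nbr_pos hw
    have h2 := dg_le_card (G := G) S w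
    by_cases hx : w ∈ X
    · have h4 := hwX w hx hwT
      rw [ind_of_mem hx]
      omega
    · rw [ind_of_notMem hx]
      omega

theorem MaxStar.step_two {p : ℕ} {U X Y S T : Finset V} (ht : TriFree G)
    (m : MaxStar G U X S T) (h : SInst G U X Y)
    (hdeg : ∀ w ∈ U, p + 1 ≤ dg G U w + ind X w + ind Y w)
    (hp : 2 ≤ p) (hS : 1 ≤ S.card) {w₀ : V} (hw₀ : w₀ ∈ X) (hw₀T : w₀ ∉ T) (hw₀S : w₀ ∉ S)
    (hd : S.card < dg G T w₀) :
    Good 1 p (Ord G U X Y) ∨ ∃ T' S', T' ⊆ X ∧ S' ⊆ U ∧ Compl G T' S' ∧ S'.Nonempty ∧ T'.Nonempty ∧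
      S'.card ≤ T'.card ∧ Y ⊆ T' ∪ S' := by
  have hw₀U := h.subX hw₀
  have hTc : (T.filter (G.Adj w₀)).card = S.card + 1 :=
    le_antisymm (m.le w₀ hw₀U hw₀S) hd
  set T' := T.filter (G.Adj w₀) with hT'
  set S' := insert w₀ S with hS'
  have hSc : S'.card = S.card + 1 := Finset.card_insert_of_notMem hw₀S
  have hT'T : T' ⊆ T := Finset.filter_subset _ _
  have hco : Compl G T' S' := by
    intro a ha b hb
    rcases Finset.mem_insert.1 hb with rfl | hb'
    · exact (Finset.mem_filter.1 ha).2.symm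
    · exact m.co a (hT'T ha) b hb'
  have hT'X := hT'T.trans m.subT
  have hHU : T' ∪ S' ⊆ U := Finset.union_subset (hT'X.trans h.subX)
    (Finset.insert_subset hw₀U m.subS)
  have hTne : T'.Nonempty := Finset.card_pos.1 (by omega)
  have hSne : S'.Nonempty := Finset.card_pos.1 (by omega)
  have hX : ∀ w ∈ X, w ∉ T' ∪ S' → dg G S' w ≤ S.card := by
    intro w hw hwH
    by_contra! hlt
    have hadj : ∀ u ∈ S', G.Adj w u := by
      intro u hu
      by_contra hwu
      have := dg_succ_le hu hwu
      omega
    refine hwH (Finset.mem_union_left _ (Finset.mem_filter.2 ⟨m.all w hw fun u hu =>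
      hadj u (Finset.mem_insert_of_mem hu), (hadj w₀ (Finset.mem_insert_self _ _)).symm⟩))
  rcases core_hang (ε := 0) (p := max 1 (p - (S.card + 1))) (a := 1) (δ := 1)
    (L := 2 * (S.card + 1)) (p' := max 1 (p - S.card)) (a' := 2) (δ' := 2) (L' := S.card + 1)
    (X := X) (Y := Y) (H := T' ∪ S') (R := T') (R' := S')
    (h.hU hHU (hTne.mono Finset.subset_union_left)) (fun c D hD _ => (h.strong c D hD).2) hHU
    Finset.subset_union_left hTne subset_rfl h.subY (pathThm_zero _) (by omega) (by omega)
    (Or.inl rfl) (by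
      by_cases hpc : p - (S.card + 1) ≤ 1
      · left; omega
      right
      intro w hw hwH
      have h1 := hdeg w hw
      have h2 := dg_sdiff_add (G := G) hHU w
      have h3 := dg_union_le (G := G) T' S' w
      have h4 := dg_le_card (G := G) T' w
      have h5 := dg_le_card (G := G) S' w
      have h6 : 0 < dg G T' w → ind (nbr G U T') w = 1 := ind_nbr_pos hw
      have h7 : 0 < dg G T' w → dg G S' w = 0 := ht.not_adj hco
      by_cases hx : w ∈ X
      · have h8 := hX w hx hwH
        rw [ind_of_mem hx] at h1
        omega
      · rw [ind_of_notMem hx] at h1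
        omega)
    (fun r hr i hi => by
      rw [one_mul]
      exact hco.ord_all hT'X (Finset.mem_insert_self _ _) hw₀ (by omega) hr (by omega))
    (by
      by_cases hpc : p - S.card ≤ 1
      · left; omega
      right
      intro w hw hwH hwn
      have h1 := hdeg w hw
      have h2 := dg_sdiff_add (G := G) hHU w
      have h3 := dg_union_le (G := G) T' S' w
      have h4 := dg_eq_zero_of_notMem_nbr hw hwn
      have h5 := dg_le_card (G := G) S' w
      have h6 : 0 < dg G S' w → ind (nbr G U S') w = 1 := ind_nbr_pos hw
      by_cases hx : w ∈ X
      · have h8 := hX w hx hwH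
        rw [ind_of_mem hx] at h1
        omega
      · rw [ind_of_notMem hx] at h1
        omega)
    (fun r hr i hi => Ord.mono (hco.ord_even hr (by omega) (by omega)) subset_rfl hT'X subset_rfl)
    with h1 | h1 | ⟨t, h1⟩
  · exact Or.inl (h1.one (by omega) (by omega) (by omega) (by omega) (by omega))
  · exact Or.inr ⟨T', S', hT'X, Finset.insert_subset hw₀U m.subS, hco, hSne, hTne, by omega, h1⟩
  · exact Or.inl (h1.two (by omega) (by omega) (by omega) (by omega))

theorem MaxStar.fin_one {p : ℕ} {U X Y S : Finset V} (ht : TriFree G) (m : MaxStar G U Y S Y)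
    (h : SInst G U X Y) (ih : PathThm G 1 U.card)
    (hdeg : ∀ w ∈ U, p + 1 ≤ dg G U w + ind X w + ind Y w)
    (hp : 3 ≤ p) (hY : Indep G Y) (hYX : Y ⊆ X) (hXS : X ⊆ Y ∪ S) {z : V} (hz : z ∈ X)
    (hzS : z ∈ S) : Good 1 p (Ord G U X Y) := by
  obtain ⟨b, hb⟩ := h.neY
  have hS1 : 1 ≤ S.card := Finset.card_pos.2 ⟨z, hzS⟩
  have hYS := m.co.disjoint
  have hc := m.card
  set T := Y.erase b with hT
  have hTY : T ⊆ Y := Finset.erase_subset _ _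
  have hTc : T.card = Y.card - 1 := Finset.card_erase_of_mem hb
  have hco : Compl G T S := m.co.mono hTY subset_rfl
  have hbS : b ∉ S := Finset.disjoint_left.1 hYS hb
  have hHU : T ∪ S ⊆ U.erase b := by
    intro x hx
    rcases Finset.mem_union.1 hx with h1 | h1
    · exact Finset.erase_subset_erase _ h.subY h1
    · exact Finset.mem_erase.2 ⟨fun h2 => hbS (h2 ▸ h1), m.subS h1⟩
  have hTne : T.Nonempty := Finset.card_pos.1 (by omega)
  have hXH : X.erase b ⊆ T ∪ S := by
    intro x hx
    obtain ⟨hxb, hx⟩ := Finset.mem_erase.1 hx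
    rcases Finset.mem_union.1 (hXS hx) with h1 | h1
    · exact Finset.mem_union_left _ (Finset.mem_erase.2 ⟨hxb, h1⟩)
    · exact Finset.mem_union_right _ h1
  have hzb : z ∈ X.erase b := Finset.mem_erase.2 ⟨fun h1 => hbS (h1 ▸ hzS), hz⟩
  have hwX : ∀ w ∈ U, w ≠ b → w ∉ T ∪ S → p + 1 ≤ dg G U w := by
    intro w hw hwb hwH
    have h1 := hdeg w hw
    have hwX : w ∉ X := fun hx => hwH (hXH (Finset.mem_erase.2 ⟨hwb, hx⟩))
    rwa [ind_of_notMem hwX, ind_of_notMem fun hy => hwX (hYX hy)] at h1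
  rcases fin_step (ε := 1) (p := max 1 (p - S.card)) (a := 1) (δ := 1) (L := 2 * S.card)
    (p' := max 1 (p + 1 - S.card)) (a' := 2) (δ' := 2) (L' := S.card) (H := T ∪ S) (R := T)
    (R' := S) h hb hXH hHU Finset.subset_union_left hTne subset_rfl ih (by omega) (by omega)
    (Or.inr ⟨rfl, ht⟩) (by
      by_cases hpc : p - S.card ≤ 1
      · left; omega
      right
      intro w hw hwb hwH
      have h1 := hwX w hw hwb hwH
      have h2 := dg_le_card (G := G) S w
      have h3 := dg_union_le (G := G) T S w
      have h4 : 0 < dg G T w → ind (nbr G U T) w = 1 := ind_nbr_pos hw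
      have h5 : 0 < dg G T w → dg G S w = 0 := ht.not_adj hco
      have h6 := m.le w hw fun h8 => hwH (Finset.mem_union_right _ h8)
      have h7 : dg G T w ≤ dg G Y w := dg_mono hTY w
      omega)
    (fun r hr i hi => by
      rw [one_mul]
      exact hco.ord_all (Finset.erase_subset_erase _ hYX) hzS hzb (by omega) hr hi)
    (by
      by_cases hpc : p + 1 - S.card ≤ 1
      · left; omega
      right
      intro w hw hwb hwH hwn
      have h1 := hwX w hw hwb hwH
      have h2 := dg_eq_zero_of_notMem_nbr hw hwn
      have h3 := dg_union_le (G := G) T S w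
      have h4 : 0 < dg G S w → ind (nbr G U S) w = 1 := ind_nbr_pos hw
      have h5 := dg_le_card (G := G) S w
      omega)
    (fun r hr i hi => Ord.mono (hco.ord_even hr (by omega) (by omega)) subset_rfl
      (Finset.erase_subset_erase _ hYX) subset_rfl) with h1 | h1 | ⟨t, h1⟩
  · exact h1.one (by omega) (by omega) (by omega) (by omega) (by omega)
  · right
    refine ⟨1, fun i hi => ?_⟩
    have hbU := h.subY hb
    have h2 : dg G U b ≤ dg G ∅ b + dg G S b := dg_le_of_closed fun x hx hbx => Or.inr <| by
      have hxT : x ∉ T := fun hxT => hY b hb x (hTY hxT) hbx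
      exact (Finset.mem_union.1 (h1 (mem_nbr_singleton.2
        ⟨Finset.mem_erase.2 ⟨hbx.ne', hx⟩, hbx⟩))).resolve_left hxT
    have h3 := dg_le_card (G := G) S b
    have h4 := dg_le_card (G := G) ∅ b
    have h5 := hdeg b hbU
    have h6 := ind_le X b
    have h7 := ind_le Y b
    simp only [Finset.card_empty] at h4
    exact Ord.mono (m.co.ord_all hYX hzS hz (by omega) hb (by omega))
      (Finset.union_subset h.subY m.subS) subset_rfl (by simpa using hb)
  · exact h1.two (by omega) (by omega) (by omega) (by omega)

theorem good_one_of_indep {p : ℕ} {U X Y : Finset V} (ht : TriFree G) (hY : Indep G Y)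
    (h : SInst G U X Y) (ih : PathThm G 1 U.card) (hp : 2 ≤ p)
    (hdeg : ∀ w ∈ U, p + 1 ≤ dg G U w + ind X w + ind Y w) : Good 1 p (Ord G U X Y) := by
  by_cases hsp : ∀ w ∈ U, dg G X w ≤ 1
  · exact good_of_sparse ht hY h ih hp hdeg hsp
  push Not at hsp
  obtain ⟨v, hv, hvX⟩ := hsp
  have hstar : ∀ v (Z : Finset V), Compl G (Z.filter (G.Adj v)) {v} := by
    intro v Z a ha b hb
    rw [Finset.mem_singleton.1 hb]
    exact (Finset.mem_filter.1 ha).2.symm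
  rcases hp.eq_or_lt with rfl | hp3
  · exact good_two_of_compl h hv (Finset.filter_subset _ _) (hstar v X) hvX
  have hdeg' : ∀ w ∈ U, p + 1 ≤ dg G U w + ind Y w + ind X w := fun w hw => by
    have := hdeg w hw; omega
  obtain ⟨S, T, hS1, m⟩ := exists_maxStar (G := G) (U := U) (X := X) (S₀ := {v})
    (T₀ := X.filter (G.Adj v)) (by simpa using hv) (Finset.filter_subset _ _) (hstar v X)
    (by rw [Finset.card_singleton]; exact hvX)
  rw [Finset.card_singleton] at hS1
  have hc := m.card
  have hstep : Good 1 p (Ord G U X Y) ∨ ∃ T' S', T' ⊆ X ∧ S' ⊆ U ∧ Compl G T' S' ∧ S'.Nonempty ∧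
      T'.Nonempty ∧ S'.card ≤ T'.card ∧ Y ⊆ T' ∪ S' := by
    by_cases hB : ∀ w ∈ X, w ∉ T → w ∉ S → dg G T w ≤ S.card
    · exact (m.step_one ht h ih hdeg hp hS1 hB).imp_right fun h1 => ⟨T, S, m.subT, m.subS, m.co,
        Finset.card_pos.1 hS1, Finset.card_pos.1 (by omega), by omega, h1⟩
    · push Not at hB
      obtain ⟨w₀, h1, h2, h3, h4⟩ := hB
      exact m.step_two ht h hdeg hp hS1 h1 h2 h3 h4
  rcases hstep with h1 | ⟨T₁, S₁, hT₁X, hS₁U, hco₁, hS₁, hT₁, hc₁, hY₁⟩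
  · exact h1
  clear! S T
  have hY2 : 2 ≤ Y.card := by
    obtain ⟨u, hu, v, hv, huv⟩ := exists_adj_of_deg h.conn.1 hp (Or.inr hdeg)
    obtain ⟨y, hy⟩ := h.neY
    obtain ⟨x, hx, hxb⟩ := h.symm.exists_ne hu hv huv y
    rw [← Finset.card_pair hxb]
    exact Finset.card_le_card (by simp [Finset.insert_subset_iff, hy, hx])
  have hYor := hY.subset_or hco₁ hY₁
  obtain ⟨v', hv', hv'Y⟩ : ∃ v' ∈ U, ∀ y ∈ Y, G.Adj v' y := by
    rcases hYor with h2 | h2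
    · obtain ⟨u, hu⟩ := hS₁
      exact ⟨u, hS₁U hu, fun y hy => (hco₁ y (h2 hy) u hu).symm⟩
    · obtain ⟨t, ht'⟩ := hT₁
      exact ⟨t, h.subX (hT₁X ht'), fun y hy => hco₁ t ht' y (h2 hy)⟩
  have hfil : Y.filter (G.Adj v') = Y := Finset.filter_true_of_mem hv'Y
  obtain ⟨S, T, hS1, m⟩ := exists_maxStar (G := G) (U := U) (X := Y) (S₀ := {v'}) (T₀ := Y)
    (by simpa using hv') subset_rfl (hfil ▸ hstar v' Y) (by simpa using hY2)
  rw [Finset.card_singleton] at hS1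
  have hc := m.card
  rcases m.step_one ht h.symm ih hdeg' hp hS1 fun w hw hwT hwS => by
      rw [dg_eq_zero.2 fun x hx => hY w hw x (m.subT hx)]
      omega with h1 | hX₁
  · rw [Ord.comm]; exact h1
  have hT₁or := (ht.indep_left hco₁ hS₁).subset_or m.co (hT₁X.trans hX₁)
  have hcT := Finset.card_le_card m.subT
  have hYT₁ : Y ⊆ T₁ := by
    refine hYor.resolve_right fun h2 => ?_
    rcases hT₁or with h3 | h3
    · obtain ⟨t, ht'⟩ := hT₁
      exact Finset.disjoint_left.1 hco₁.disjoint ht' (h2 (m.subT (h3 ht')))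
    · have h4 := Finset.card_le_card h2
      have h5 := Finset.card_le_card h3
      omega
  have hYX := hYT₁.trans hT₁X
  obtain ⟨t, ht'⟩ : T.Nonempty := Finset.card_pos.1 (by omega)
  have hYT : Y ⊆ T := (hY.subset_or m.co (hYX.trans hX₁)).resolve_right fun h2 =>
    Finset.disjoint_left.1 m.co.disjoint ht' (h2 (m.subT ht'))
  obtain rfl : T = Y := Finset.Subset.antisymm m.subT hYT
  by_cases hXT : X ⊆ T
  · obtain rfl : X = T := Finset.Subset.antisymm hXT hYX
    refine m.fin h ih hdeg hp hY ?_ (Or.inr ⟨rfl, ht⟩)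
    intro w hw u hu hwu T' hT' hco
    by_contra! hlt
    have := ht.not_adj hco (show 0 < dg G T' w by omega)
    rw [dg_eq_zero] at this
    exact this u (by simp) hwu
  · obtain ⟨z, hz, hzT⟩ := Finset.not_subset.1 hXT
    exact m.fin_one ht h ih hdeg hp3 hY hYX hX₁ hz
      ((Finset.mem_union.1 (hX₁ hz)).resolve_left hzT)

/-- The path theorem with one additional order in triangle-free graphs. -/
theorem pathThm_one (N : ℕ) : PathThm G 1 N := by
  induction N with
  | zero => intro M X Y p h; omega
  | succ N IH =>
  intro U X Y p hU hp hadm h hdeg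
  have ih : PathThm G 1 U.card := IH.mono (by omega)
  rcases hp.eq_or_lt with rfl | hp2
  · obtain ⟨x, hx⟩ := h.neX
    obtain ⟨y, hy⟩ := h.neY
    obtain ⟨n, hn⟩ := h.conn.ord (X := X) (Y := Y) ⟨x, by simp [hx, h.subX hx]⟩
      ⟨y, by simp [hy, h.subY hy]⟩
    exact Good.of_one hn le_rfl
  rcases h.good_or_strong ih hp hadm hdeg with h1 | h
  · exact h1
  have hdeg := hdeg.resolve_left (by omega)
  rcases hadm with h1 | ⟨-, ht, hX | hY⟩
  · omega
  · rw [Ord.comm]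
    exact good_one_of_indep ht hX h.symm ih hp2 fun w hw => by have := hdeg w hw; omega
  · exact good_one_of_indep ht hY h ih hp2 hdeg

end TB
section Threads
variable {V : Type*} [DecidableEq V] {G : SimpleGraph V} [DecidableRel G.Adj]

variable (G) in
/-- A path from `X` to `Y` through `q` together with a path with `n` vertices joining `v` to `q`,
the three branches at `q` being otherwise disjoint. -/
def Thread (U X Y : Finset V) (v : V) (n : ℕ) : Prop :=
  ∃ x ∈ X, ∃ y ∈ Y, ∃ q, ∃ P ⊆ U, ∃ P' ⊆ U, ∃ Q ⊆ U, PathOn G P x q ∧ PathOn G P' y q ∧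
    PathOn G Q v q ∧ (∀ z ∈ P, z ∈ P' → z = q) ∧ (∀ z ∈ Q, z ∈ P → z = q) ∧
    (∀ z ∈ Q, z ∈ P' → z = q) ∧ Q.card = n

theorem Thread.symm {U X Y : Finset V} {v : V} {n : ℕ} (h : Thread G U X Y v n) :
    Thread G U Y X v n := by
  obtain ⟨x, hx, y, hy, q, P, hP, P', hP', Q, hQ, h1, h2, h3, h4, h5, h6, h7⟩ := h
  exact ⟨y, hy, x, hx, q, P', hP', P, hP, Q, hQ, h2, h1, h3, fun z hz hz' => h4 z hz' hz, h6, h5,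
    h7⟩

theorem Thread.core {U X Y P' Q N : Finset V} {v q x y w : V} (hx : x ∈ X) (hy : y ∈ Y)
    (hP' : P' ⊆ U) (hQ : Q ⊆ U) (hN : N ⊆ U) (h2 : PathOn G P' y q) (h3 : PathOn G Q v q)
    (h4 : PathOn G N x w) (hw : w ∈ Q) (hwq : w ≠ q) (h5 : ∀ z ∈ Q, z ∈ P' → z = q)
    (h6 : ∀ z ∈ N, z ∉ P') (h7 : ∀ z ∈ N, z ∈ Q → z = w) :
    ∃ m < Q.card, Thread G U X Y v m := by
  obtain ⟨Q₁, Q₂, hQQ, hQi, g1, g2⟩ := h3.split hw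
  have hi : ∀ z ∈ Q₁, z ∈ Q₂ → z = w := fun z h h' => by
    have : z ∈ Q₁ ∩ Q₂ := Finset.mem_inter.2 ⟨h, h'⟩
    simpa [hQi] using this
  have hQ₁ : Q₁ ⊆ Q := hQQ ▸ Finset.subset_union_left
  have hQ₂ : Q₂ ⊆ Q := hQQ ▸ Finset.subset_union_right
  have hq : q ∉ Q₁ := fun h => hwq (hi q h g2.right_mem).symm
  refine ⟨Q₁.card, Finset.card_lt_card ⟨hQ₁, fun h => hq (h h3.right_mem)⟩, x, hx, y, hy, w, N, hN,
    P' ∪ Q₂, Finset.union_subset hP' (hQ₂.trans hQ), Q₁, hQ₁.trans hQ, h4,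
    h2.join g2.symm fun z hz hz' => h5 z (hQ₂ hz') hz, g1, ?_, ?_, ?_, rfl⟩
  · intro z hz hz'
    rcases Finset.mem_union.1 hz' with h | h
    · exact absurd h (h6 z hz)
    · exact h7 z hz (hQ₂ h)
  · exact fun z hz hz' => h7 z hz' (hQ₁ hz)
  · intro z hz hz'
    rcases Finset.mem_union.1 hz' with h | h
    · obtain rfl := h5 z (hQ₁ hz) h
      exact absurd hz hq
    · exact hi z hz h

theorem Thread.reroute {U X Y P P' Q R : Finset V} {v q x y r w : V} (hx : x ∈ X) (hy : y ∈ Y)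
    (hP : P ⊆ U) (hP' : P' ⊆ U) (hQ : Q ⊆ U) (hR : R ⊆ U) (h1 : PathOn G P x q)
    (h2 : PathOn G P' y q) (h3 : PathOn G Q v q) (h4 : ∀ z ∈ P, z ∈ P' → z = q)
    (h5 : ∀ z ∈ Q, z ∈ P → z = q) (h6 : ∀ z ∈ Q, z ∈ P' → z = q) (h7 : PathOn G R r w)
    (hw : w ∈ Q) (hqR : q ∉ R) (h8 : ∀ z ∈ R, z ∈ Q → z = w) (h9 : ∀ z ∈ R, z ∈ P → z = r)
    (h10 : ∀ z ∈ R, z ∈ P' → z = r) (hr : r ∈ P ∨ r ∉ P' ∧ r ∈ X) :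
    ∃ m < Q.card, Thread G U X Y v m := by
  have hwq : w ≠ q := fun h => hqR (h ▸ h7.right_mem)
  have hrq : r ≠ q := fun h => hqR (h ▸ h7.left_mem)
  rcases hr with hr | ⟨hr, hrX⟩
  · obtain ⟨A₁, A₂, hAA, hAi, g1, g2⟩ := h1.split hr
    have hA₁ : A₁ ⊆ P := hAA ▸ Finset.subset_union_left
    have hqA : q ∉ A₁ := fun h => hrq (by
      have : q ∈ A₁ ∩ A₂ := Finset.mem_inter.2 ⟨h, g2.right_mem⟩
      rw [hAi, Finset.mem_singleton] at this
      exact this.symm)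
    refine Thread.core hx hy hP' hQ (Finset.union_subset (hA₁.trans hP) hR) h2 h3
      (g1.join h7 fun z hz hz' => h9 z hz' (hA₁ hz)) hw hwq h6 ?_ ?_
    · intro z hz hz'
      rcases Finset.mem_union.1 hz with h | h
      · obtain rfl := h4 z (hA₁ h) hz'
        exact hqA h
      · obtain rfl := h10 z h hz'
        exact hrq (h4 z hr hz')
    · intro z hz hz'
      rcases Finset.mem_union.1 hz with h | h
      · obtain rfl := h5 z hz' (hA₁ h)
        exact absurd h hqA
      · exact h8 z h hz'
  · exact Thread.core hrX hy hP' hQ hR h2 h3 h7 hw hwq h6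
      (fun z hz hz' => hr (h10 z hz hz' ▸ hz')) h8

theorem Inst.thread_lt {U X Y : Finset V} {v : V} {n : ℕ} (h : Inst G U X Y) (hv : v ∈ U)
    (ht : Thread G U X Y v n) (hn : 2 ≤ n) : ∃ m < n, Thread G U X Y v m := by
  obtain ⟨x, hx, y, hy, q, P, hP, P', hP', Q, hQ, h1, h2, h3, h4, h5, h6, rfl⟩ := ht
  have hvq : v ≠ q := by
    rintro rfl
    cases h3 with
    | single => simp at hn
    | cons _ h7 h8 => exact h7 h8.right_mem
  obtain ⟨D, hvD, hDc, hD⟩ := exists_component (G := G) (B := {q}) hv (by simpa using hvq)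
  have hqD : q ∉ D := Finset.disjoint_right.1 hD.disj (by simp)
  obtain ⟨b, hbD, hb⟩ : ∃ b ∈ D, b ∈ X ∪ Y := by
    by_contra! hno
    refine h.piece q D hD ?_ ?_ <;> rw [Finset.disjoint_left] <;> intro a ha ha' <;>
      exact hno a ha (by simp [ha'])
  obtain ⟨S, hS, hSp⟩ := hDc.path hvD hbD
  obtain ⟨R, hR, r, hr, hRp, hRh⟩ := hSp.firstHit (B := (P ∪ P') ∪ (X ∪ Y))
    (Finset.mem_union_right _ hb)
  obtain ⟨R', hR', w, hw, hRp', hRh'⟩ := hRp.symm.firstHit (B := Q) h3.left_mem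
  have hR'D : R' ⊆ D := hR'.trans (hR.trans hS)
  have hqR : q ∉ R' := fun h => hqD (hR'D h)
  have h9 : ∀ z ∈ R', z ∈ P → z = r := fun z hz hz' => hRh z (hR' hz) (by simp [hz'])
  have h10 : ∀ z ∈ R', z ∈ P' → z = r := fun z hz hz' => hRh z (hR' hz) (by simp [hz'])
  have hX := Thread.reroute hx hy hP hP' hQ (hR'D.trans hD.sub) h1 h2 h3 h4 h5 h6 hRp' hw hqR hRh'
    h9 h10
  have hY := Thread.reroute hy hx hP' hP hQ (hR'D.trans hD.sub) h2 h1 h3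
    (fun z hz hz' => h4 z hz' hz) h6 h5 hRp' hw hqR hRh' h10 h9
  have hY' : (r ∈ P' ∨ r ∉ P ∧ r ∈ Y) → ∃ m < Q.card, Thread G U X Y v m := fun h => by
    obtain ⟨m, hm, h⟩ := hY h
    exact ⟨m, hm, h.symm⟩
  clear hY
  simp only [Finset.mem_union] at hr
  tauto

/-- In an arena every vertex lies on a path from `X` to `Y`. -/
theorem Inst.thread {U X Y : Finset V} {v : V} (h : Inst G U X Y) (hv : v ∈ U) :
    ∃ x ∈ X, ∃ y ∈ Y, ∃ P ⊆ U, ∃ P' ⊆ U, PathOn G P x v ∧ PathOn G P' y v ∧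
      ∀ z ∈ P, z ∈ P' → z = v := by
  have hex : ∃ n, Thread G U X Y v n := by
    obtain ⟨x, hx⟩ := h.neX
    obtain ⟨y, hy⟩ := h.neY
    obtain ⟨S, hS, hSp⟩ := h.conn.path (h.subX hx) (h.subY hy)
    obtain ⟨R, hR, hRp⟩ := h.conn.path hv (h.subX hx)
    obtain ⟨Q, hQ, q, hq, hQp, hQh⟩ := hRp.firstHit hSp.left_mem
    obtain ⟨S₁, S₂, hSS, hSi, g1, g2⟩ := hSp.split hq
    have hS₁ : S₁ ⊆ S := hSS ▸ Finset.subset_union_left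
    have hS₂ : S₂ ⊆ S := hSS ▸ Finset.subset_union_right
    refine ⟨_, x, hx, y, hy, q, S₁, hS₁.trans hS, S₂, hS₂.trans hS, Q, hQ.trans hR, g1, g2.symm,
      hQp, fun z hz hz' => ?_, fun z hz hz' => hQh z hz (hS₁ hz'),
      fun z hz hz' => hQh z hz (hS₂ hz'), rfl⟩
    have : z ∈ S₁ ∩ S₂ := Finset.mem_inter.2 ⟨hz, hz'⟩
    simpa [hSi] using this
  classical
  have hspec := Nat.find_spec hex
  have hlt : Nat.find hex < 2 := by
    by_contra hge
    obtain ⟨m, hm, hm'⟩ := h.thread_lt hv hspec (by omega)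
    exact Nat.find_min hex hm hm'
  obtain ⟨x, hx, y, hy, q, P, hP, P', hP', Q, hQ, h1, h2, h3, h4, h5, h6, h7⟩ := hspec
  obtain rfl : v = q := h3.single' (by have := h3.card_pos; omega)
  exact ⟨x, hx, y, hy, P, hP, P', hP', h1, h2, h4⟩

end Threads
section Exceptional
variable {V : Type*} [DecidableEq V] {G : SimpleGraph V} [DecidableRel G.Adj]

/-- A two-sided piece avoiding both terminal sets. -/
theorem Inst.good_of_through {p : ℕ} {U X Y D : Finset V} {z c : V} (ht : TriFree G)
    (h : Inst G U X Y) (hz : z ∈ U) (hdeg : ∀ w ∈ U, w ≠ z → p + 1 ≤ dg G U w) (hp : 1 ≤ p)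
    (hc : Conn G D) (hD : Sep G U {z, c} D) (hDX : Disjoint D X) (hDY : Disjoint D Y) :
    Good 1 p (Ord G U X Y) := by
  have hzD : z ∉ D := Finset.disjoint_right.1 hD.disj (by simp)
  have hgood : Good 1 p (Ord G D (nbr G D {z}) (nbr G D {c})) := by
    refine pathThm_one (D.card + 1) _ _ _ _ (Nat.lt_succ_self _) hp
      (Or.inr ⟨rfl, ht, Or.inl (ht.indep_nbr _ _)⟩)
      ⟨hc, nbr_subset _ _, nbr_subset _ _, ?_, ?_, ?_⟩ (Or.inr ?_)
    · by_contra hne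
      exact h.piece _ _ (hD.drop (Finset.not_nonempty_iff_eq_empty.1 hne)) hDX hDY
    · by_contra hne
      rw [Finset.pair_comm] at hD
      exact h.piece _ _ (hD.drop (Finset.not_nonempty_iff_eq_empty.1 hne)) hDX hDY
    · intro c' D' hD' h1 h2
      refine h.piece c' D' ((hD.trans hD').shrink hD'.disj fun a ha b hb hbc hab => ?_)
        (Finset.disjoint_of_subset_left hD'.sub hDX) (Finset.disjoint_of_subset_left hD'.sub hDY)
      have hb' : b = z ∨ b = c := by
        simp only [Finset.mem_insert, Finset.mem_singleton, Finset.mem_union] at hb hbc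
        tauto
      rcases hb' with rfl | rfl
      · exact Finset.disjoint_left.1 h1 ha (mem_nbr_singleton.2 ⟨hD'.sub ha, hab.symm⟩)
      · exact Finset.disjoint_left.1 h2 ha (mem_nbr_singleton.2 ⟨hD'.sub ha, hab.symm⟩)
    · intro w hw
      have h1 := hdeg w (hD.sub hw) (fun h => hzD (h ▸ hw))
      have h2 := dg_le_of_closed (hD.closed w hw)
      have h3 : dg G {z, c} w ≤ dg G {z} w + dg G {c} w := dg_union_le {z} {c} w
      rw [dg_singleton_of_mem hw, dg_singleton_of_mem hw] at h3
      omega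
  obtain ⟨v, hv⟩ := hD.ne
  obtain ⟨x, hx, y, hy, P, hP, P', hP', h1, h2, h3⟩ := h.thread (hD.sub hv)
  obtain ⟨a, ha, T, hT, hTD, hTp, -⟩ := h1.reach hP hD hv (Finset.disjoint_right.1 hDX hx)
  obtain ⟨a', ha', T', hT', hTD', hTp', -⟩ := h2.reach hP' hD hv (Finset.disjoint_right.1 hDY hy)
  have hTT : Disjoint T T' := by
    rw [Finset.disjoint_left]
    intro t h4 h5
    obtain rfl := h3 t (hT h4) (hT' h5)
    exact Finset.disjoint_left.1 hTD h4 hv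
  have haa : a ≠ a' := by
    rintro rfl
    exact Finset.disjoint_left.1 hTT hTp.right_mem hTp'.right_mem
  have hgood' : Good 1 p (Ord G D (nbr G D {a}) (nbr G D {a'})) := by
    simp only [Finset.mem_insert, Finset.mem_singleton] at ha ha'
    rcases ha with rfl | rfl <;> rcases ha' with rfl | rfl
    · exact absurd rfl haa
    · exact hgood
    · rwa [Ord.comm]
    · exact absurd rfl haa
  exact hgood'.shift (T.card + T'.card) fun n hn =>
    Ord.bridge (hT.trans hP) hD.sub (hT'.trans hP') hTD hTT hTD'.symm
      ⟨T, x, a, subset_rfl, hx, Finset.mem_singleton_self _, hTp, rfl⟩ hn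
      ⟨T', a', y, subset_rfl, Finset.mem_singleton_self _, hy, hTp'.symm, rfl⟩

theorem Inst.good_of_side {p : ℕ} {U X Y M : Finset V} {z : V} (ht : TriFree G)
    (h : Inst G U X Y) (hz : z ∈ U) (hdeg : ∀ w ∈ U, w ≠ z → p + 1 ≤ dg G U w) (hp : 1 ≤ p)
    (hc : Conn G M) (hM : Sep G U {z} M) (hMY : Disjoint M Y) :
    Good 1 p (Ord G U X Y) := by
  have hzM : z ∉ M := Finset.disjoint_right.1 hM.disj (by simp)
  have hgood : Good 1 p (Ord G M (X ∩ M) (nbr G M {z})) := by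
    refine pathThm_one (M.card + 1) _ _ _ _ (Nat.lt_succ_self _) hp
      (Or.inr ⟨rfl, ht, Or.inr (ht.indep_nbr _ _)⟩)
      ⟨hc, Finset.inter_subset_right, nbr_subset _ _, ?_, ?_, ?_⟩ (Or.inr ?_)
    · by_contra hne
      refine h.piece z M hM ?_ hMY
      rw [Finset.disjoint_left]
      exact fun a ha ha' => hne ⟨a, Finset.mem_inter.2 ⟨ha', ha⟩⟩
    · obtain ⟨a, ha, b, hb, hbM, hab⟩ := h.conn.exists_adj hM.sub hM.ne (fun h => hzM (h ▸ hz))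
      have hbz : b = z := by
        rcases hM.closed a ha b hb hab with h | h
        · exact absurd h hbM
        · simpa using h
      subst hbz
      exact ⟨a, mem_nbr_singleton.2 ⟨ha, hab.symm⟩⟩
    · intro c D hD h1 h2
      refine h.piece c D ((hM.trans hD).shrink hD.disj fun a ha b hb hbc hab => ?_) ?_
        (Finset.disjoint_of_subset_left hD.sub hMY)
      · have hb' : b = z := by
          simp only [Finset.mem_singleton, Finset.mem_union] at hb hbc
          tauto
        subst hb'
        exact Finset.disjoint_left.1 h2 ha (mem_nbr_singleton.2 ⟨hD.sub ha, hab.symm⟩)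
      · rw [Finset.disjoint_left] at h1 ⊢
        exact fun a ha ha' => h1 ha (Finset.mem_inter.2 ⟨ha', hD.sub ha⟩)
    · intro w hw
      have h1 := hdeg w (hM.sub hw) (fun h => hzM (h ▸ hw))
      have h2 := dg_le_of_closed (hM.closed w hw)
      rw [dg_singleton_of_mem hw] at h2
      omega
  obtain ⟨y, hy⟩ := h.neY
  obtain ⟨n, hn⟩ := (h.conn.sdiff hM hz).ord (X := Y) (Y := {z})
    ⟨y, by simp [hy, h.subY hy, Finset.disjoint_right.1 hMY hy]⟩ ⟨z, by simp [hz, hzM]⟩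
  refine hgood.shift n fun n' hn' => ?_
  rw [Ord.comm] at hn'
  rw [Ord.comm, add_comm]
  exact Ord.glue (A := nbr G M {z}) Finset.sdiff_subset hM.sub Finset.sdiff_disjoint
    (fun x hx => ⟨z, (mem_nbr_singleton.1 hx).2, hn⟩) (Ord.mono hn' subset_rfl subset_rfl
      Finset.inter_subset_left)

/-- The path theorem when the degree condition fails at one vertex. -/
theorem Inst.good_of_exception {p : ℕ} {U X Y : Finset V} {z w : V} (ht : TriFree G)
    (h : Inst G U X Y) (hX : Indep G X) (hz : z ∈ U) (hw : w ∈ U) (hwz : w ≠ z)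
    (hdeg : ∀ w ∈ U, w ≠ z → p + 1 ≤ dg G U w) (hp : 2 ≤ p) :
    Good 1 (p - 1) (Ord G U X Y) := by
  obtain ⟨M, hwM, hMc, hM⟩ := exists_component (G := G) (B := {z}) hw (by simpa using hwz)
  have hzM : z ∉ M := Finset.disjoint_right.1 hM.disj (by simp)
  by_cases hMY : Disjoint M Y
  · exact (h.good_of_side ht hz hdeg (by omega) hMc hM hMY).mono (by omega) (by omega)
  by_cases hMX : Disjoint M X
  · rw [Ord.comm]
    exact (h.symm.good_of_side ht hz hdeg (by omega) hMc hM hMX).mono (by omega) (by omega)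
  rw [Finset.not_disjoint_iff] at hMX hMY
  obtain ⟨x, hxM, hx⟩ := hMX
  obtain ⟨y, hyM, hy⟩ := hMY
  by_cases hpiece : ∀ c D, Sep G M {c} D → Disjoint D X → ¬ Disjoint D Y
  · refine (pathThm_one (M.card + 1) M (X ∩ M) (Y ∩ M) (p - 1) (Nat.lt_succ_self _) (by omega)
      (Or.inr ⟨rfl, ht, Or.inl (hX.mono Finset.inter_subset_left)⟩)
      ⟨hMc, Finset.inter_subset_right, Finset.inter_subset_right, ⟨x, by simp [hx, hxM]⟩,
        ⟨y, by simp [hy, hyM]⟩, ?_⟩ (Or.inr ?_)).subset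
      fun n hn => Ord.mono hn hM.sub Finset.inter_subset_left Finset.inter_subset_left
    · intro c D hD h1 h2
      refine hpiece c D hD ?_ ?_
      · rw [Finset.disjoint_left] at h1 ⊢
        exact fun a ha ha' => h1 ha (Finset.mem_inter.2 ⟨ha', hD.sub ha⟩)
      · rw [Finset.disjoint_left] at h2 ⊢
        exact fun a ha ha' => h2 ha (Finset.mem_inter.2 ⟨ha', hD.sub ha⟩)
    · intro u hu
      have h1 := hdeg u (hM.sub hu) (fun h => hzM (h ▸ hu))
      have h2 := dg_le_of_closed (hM.closed u hu)
      have h3 := dg_singleton_le (G := G) z u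
      omega
  · push Not at hpiece
    obtain ⟨c, D, hD, h1, h2⟩ := hpiece
    obtain ⟨d, hd⟩ := hD.ne
    obtain ⟨D', hDD, -, hDc, hD'⟩ := hD.exists_conn hd
    exact (h.good_of_through ht hz hdeg (by omega) hDc (hM.trans hD')
      (Finset.disjoint_of_subset_left hDD h1) (Finset.disjoint_of_subset_left hDD h2)).mono
      (by omega) (by omega)

end Exceptional
section Triangle
variable {V : Type*} [DecidableEq V] {G : SimpleGraph V} [DecidableRel G.Adj]

theorem cycle_of_paths {S T : Finset V} {a b c d : V} (hS : PathOn G S a b) (hT : PathOn G T c d)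
    (hd : Disjoint S T) (hbc : G.Adj b c) (hda : G.Adj d a) (h3 : 3 ≤ S.card + T.card) :
    HasCycleLength G (S.card + T.card) := by
  obtain ⟨w, hw, hl, -⟩ := (hS.append hT hbc hd).toWalk
  rw [Finset.card_union_of_disjoint hd] at hl
  refine ⟨d, Walk.cons hda w, (Walk.cons_isCycle_iff _ _).2 ⟨hw, fun he => ?_⟩, by simpa using hl⟩
  rw [Sym2.eq_swap] at he
  have := hw.length_eq_one_of_mem_edges he
  omega

theorem consec_of_good {ε p L k s : ℕ} {O : Set ℕ} (hg : Good ε p O) (hp : 1 ≤ p) (hL : 2 ≤ L)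
    (h1 : k + 1 ≤ p + ε + L) (h2 : k + 2 ≤ 2 * p + L)
    (hO : ∀ n ∈ O, ∀ i < L, HasCycleLength G (n + (s + i))) : HasConsecCycles G k := by
  rcases hg with ⟨m, hm⟩ | ⟨m, hm⟩ <;> refine ⟨m + s, fun t ht => ?_⟩
  · rcases le_or_gt (t / 2) (p - 1) with h | h
    · have := hO _ (hm (t / 2) (by omega)) (t % 2) (by omega)
      convert this using 1
      omega
    · have := hO _ (hm (p - 1) (by omega)) (t - 2 * (p - 1)) (by omega)
      convert this using 1
      omega
  · rcases le_or_gt t (p + ε - 1) with h | h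
    · have := hO _ (hm t (by omega)) 0 (by omega)
      convert this using 1
      omega
    · have := hO _ (hm (p + ε - 1) (by omega)) (t - (p + ε - 1)) (by omega)
      convert this using 1
      omega

theorem consec_of_closings {ε p L k s : ℕ} {F A B : Finset V}
    (hg : Good ε p (Ord G F (nbr G F A) (nbr G F B))) (hp : 1 ≤ p) (hL : 2 ≤ L)
    (h1 : k + 1 ≤ p + ε + L) (h2 : k + 2 ≤ 2 * p + L) (hs : 2 ≤ s)
    (hcl : ∀ a ∈ A, ∀ b ∈ B, ∀ i < L, ∃ S, Disjoint S F ∧ PathOn G S b a ∧ S.card = s + i) :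
    HasConsecCycles G k := by
  refine consec_of_good (s := s) hg hp hL h1 h2 ?_
  rintro n ⟨T, x, y, hT, hx, hy, hTp, rfl⟩ i hi
  obtain ⟨-, a, ha, hax⟩ := mem_nbr.1 hx
  obtain ⟨-, b, hb, hby⟩ := mem_nbr.1 hy
  obtain ⟨S, hS, hSp, hc⟩ := hcl a ha b hb i hi
  rw [← hc]
  exact cycle_of_paths hTp hSp (Finset.disjoint_of_subset_left hT hS.symm) hby.symm hax (by
    have := hTp.card_pos
    omega)

variable [Fintype V]

variable (G) in
/-- At most two vertices never separate `G`. -/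
def NoSep : Prop := ∀ B D : Finset V, Sep G Finset.univ B D → B.card ≤ 2 → D ∪ B = Finset.univ

theorem NoSep.mem_or (h : NoSep G) {B D : Finset V} (hs : Sep G Finset.univ B D) (hB : B.card ≤ 2)
    (x : V) : x ∈ D ∨ x ∈ B := by
  have : x ∈ D ∪ B := h B D hs hB ▸ Finset.mem_univ x
  simpa using this

theorem NoSep.triangle_cycles {p L k : ℕ} {F A B : Finset V} (h : NoSep G) (hc : Conn G F)
    (hF : Sep G Finset.univ (A ∪ B) F) (hAB : Disjoint A B)
    (hA : (nbr G F A).Nonempty) (hB : (nbr G F B).Nonempty) (hp : 1 ≤ p) (hL : 2 ≤ L)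
    (h1 : k + 1 ≤ p + L) (h2 : k + 2 ≤ 2 * p + L)
    (hdeg : ∀ w ∈ F, p + 1 ≤ dg G F w + ind (nbr G F A) w + ind (nbr G F B) w)
    (hcl : ∀ a ∈ A, ∀ b ∈ B, ∀ i < L, ∃ S ⊆ A ∪ B, PathOn G S b a ∧ S.card = 2 + i) :
    HasConsecCycles G k := by
  refine consec_of_closings (ε := 0) (s := 2) (pathThm_zero (F.card + 1) F (nbr G F A) (nbr G F B) p
    (Nat.lt_succ_self _) hp (Or.inl rfl)
    ⟨hc, nbr_subset _ _, nbr_subset _ _, hA, hB, ?_⟩ (Or.inr hdeg)) hp hL (by omega) h2 le_rfl ?_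
  · intro c D hD h3 h4
    have hD' : Sep G Finset.univ {c} D := (hF.trans hD).shrink hD.disj fun u hu b hb hbc hub => by
      have hb' : b ∈ A ∨ b ∈ B := by
        simp only [Finset.mem_singleton, Finset.mem_union] at hb hbc
        tauto
      rcases hb' with hb' | hb'
      · exact Finset.disjoint_left.1 h3 hu (mem_nbr.2 ⟨hD.sub hu, b, hb', hub.symm⟩)
      · exact Finset.disjoint_left.1 h4 hu (mem_nbr.2 ⟨hD.sub hu, b, hb', hub.symm⟩)
    have key : ∀ x ∈ A ∪ B, x = c := fun x hx => by
      rcases h.mem_or hD' (by simp) x with h' | h'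
      · exact absurd hx (Finset.disjoint_left.1 hF.disj (hD.sub h'))
      · simpa using h'
    obtain ⟨w, hw⟩ := hA
    obtain ⟨w', hw'⟩ := hB
    obtain ⟨-, a, ha, -⟩ := mem_nbr.1 hw
    obtain ⟨-, b, hb, -⟩ := mem_nbr.1 hw'
    have e1 := key a (by simp [ha])
    have e2 := key b (by simp [hb])
    subst e1
    subst e2
    exact Finset.disjoint_left.1 hAB ha hb
  · intro a ha b hb i hi
    obtain ⟨S, hS, h3⟩ := hcl a ha b hb i hi
    exact ⟨S, Finset.disjoint_of_subset_left hS hF.disj.symm, h3⟩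

theorem Clique.exists_path {K : Finset V} (h : Clique G K) {a b : V} (ha : a ∈ K) (hb : b ∈ K)
    (hab : a ≠ b) {e : ℕ} (h1 : 2 ≤ e) (h2 : e ≤ K.card) :
    ∃ S ⊆ K, PathOn G S b a ∧ S.card = e := by
  have hc := Finset.card_erase_of_mem hb
  obtain ⟨T, x, a', hT, hx, ha', hTp, hTc⟩ := (h.mono (Finset.erase_subset b K)).ord (e := e - 1)
    (r := a) (Finset.mem_erase.2 ⟨hab, ha⟩) (by omega) (by omega)
  obtain rfl : a' = a := by simpa using ha'
  have hx' := Finset.mem_erase.1 hx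
  have hbT : b ∉ T := fun h => (Finset.mem_erase.1 (hT h)).1 rfl
  refine ⟨insert b T, Finset.insert_subset hb (hT.trans (Finset.erase_subset _ _)),
    .cons (h b hb x hx'.2 hx'.1.symm) hbT hTp, ?_⟩
  rw [Finset.card_insert_of_notMem hbT]
  omega

theorem Clique.consec {K : Finset V} (h : Clique G K) {k : ℕ} (hK : k + 2 ≤ K.card) :
    HasConsecCycles G k := by
  refine ⟨3, fun i hi => ?_⟩
  obtain ⟨b, hb⟩ : K.Nonempty := Finset.card_pos.1 (by omega)
  have hc := Finset.card_erase_of_mem hb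
  obtain ⟨a, ha⟩ : (K.erase b).Nonempty := Finset.card_pos.1 (by omega)
  obtain ⟨T, x, a', hT, hx, ha', hTp, hTc⟩ := (h.mono (Finset.erase_subset b K)).ord (e := 2 + i)
    (r := a) ha (by omega) (by omega)
  obtain rfl : a' = a := by simpa using ha'
  have hx' := Finset.mem_erase.1 hx
  have ha'' := Finset.mem_erase.1 ha
  have hbT : b ∉ T := fun h => (Finset.mem_erase.1 (hT h)).1 rfl
  have := cycle_of_paths (PathOn.single b) hTp (by simpa using hbT) (h b hb x hx'.2 hx'.1.symm)
    (h _ ha''.2 b hb ha''.1) (by simp; omega)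
  convert this using 1
  simp
  omega

theorem NoSep.exists_mem (h : NoSep G) {A B F : Finset V} (hF : Sep G Finset.univ (A ∪ B) F)
    (hA : A.Nonempty) (hAB : Disjoint A B) (hB : B.card ≤ 2) : (nbr G F A).Nonempty := by
  by_contra hne
  have hne := Finset.not_nonempty_iff_eq_empty.1 hne
  obtain ⟨a, ha⟩ := hA
  have hF' : Sep G Finset.univ B F := hF.shrink
    (Finset.disjoint_of_subset_right Finset.subset_union_right hF.disj) fun u hu b hb hbB hub => by
      have : u ∈ nbr G F A := mem_nbr.2 ⟨hu, b, (Finset.mem_union.1 hb).resolve_right hbB, hub.symm⟩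
      simp [hne] at this
  rcases h.mem_or hF' hB a with h' | h'
  · exact Finset.disjoint_left.1 hF.disj h' (by simp [ha])
  · exact Finset.disjoint_left.1 hAB ha h'

theorem NoSep.consec_of_clique {k : ℕ} {K : Finset V} (h : NoSep G)
    (hdeg : ∀ w, k ≤ dg G Finset.univ w) (hcard : k + 2 ≤ Fintype.card V) (hK : Clique G K)
    (hmax : ∀ w ∉ K, ¬ Clique G (insert w K)) (hK4 : 4 ≤ K.card) : HasConsecCycles G k := by
  by_cases hKk : k + 2 ≤ K.card
  · exact hK.consec hKk
  push Not at hKk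
  obtain ⟨x, hx⟩ : ∃ x, x ∉ K := by
    by_contra! hall
    have := Finset.card_le_card (show Finset.univ ⊆ K from fun x _ => hall x)
    rw [Finset.card_univ] at this
    omega
  obtain ⟨F, -, hFc, hF⟩ := exists_component (G := G) (Finset.mem_univ x) hx
  set T := K.filter (fun a => (nbr G F {a}).Nonempty) with hT
  have hT3 : 3 ≤ T.card := by
    by_contra! hlt
    have hF' : Sep G Finset.univ T F := hF.shrink
      (Finset.disjoint_of_subset_right (Finset.filter_subset _ _) hF.disj)
      fun u hu b hb hbT hub => hbT (Finset.mem_filter.2 ⟨hb, u, mem_nbr_singleton.2 ⟨hu, hub.symm⟩⟩)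
    have : K ⊆ T := fun a ha => by
      rcases h.mem_or hF' (by omega) a with h' | h'
      · exact absurd ha (Finset.disjoint_left.1 hF.disj h')
      · exact h'
    have := Finset.card_le_card this
    omega
  obtain ⟨t₁, h₁, t₂, h₂, h12⟩ := Finset.one_lt_card.1 (show 1 < T.card by omega)
  rw [hT, Finset.mem_filter] at h₁ h₂
  obtain ⟨u, hu⟩ : (K \ {t₁, t₂}).Nonempty := by
    rw [← Finset.card_pos]
    have := Finset.le_card_sdiff {t₁, t₂} K
    have := Finset.card_le_two (a := t₁) (b := t₂)
    omega
  simp only [Finset.mem_sdiff, Finset.mem_insert, Finset.mem_singleton, not_or] at hu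
  have hA : ({t₁, u} : Finset V) ⊆ K := by
    intro a ha
    simp only [Finset.mem_insert, Finset.mem_singleton] at ha
    rcases ha with rfl | rfl
    exacts [h₁.1, hu.1]
  have hAc : ({t₁, u} : Finset V).card = 2 := Finset.card_pair (Ne.symm hu.2.1)
  have hBc : (K \ {t₁, u}).card = K.card - 2 := by rw [Finset.card_sdiff_of_subset hA, hAc]
  have ht₂ : t₂ ∈ K \ {t₁, u} := by simp [h₂.1, h12.symm, Ne.symm hu.2.2]
  have hU : ({t₁, u} : Finset V) ∪ K \ {t₁, u} = K := Finset.union_sdiff_of_subset hA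
  generalize hAe : ({t₁, u} : Finset V) = A at *
  generalize hBe : K \ A = B at *
  have hAB : Disjoint A B := by rw [← hBe]; exact Finset.disjoint_sdiff
  have ht₁ : t₁ ∈ A := by simp [← hAe]
  refine h.triangle_cycles (p := k + 2 - K.card) (L := K.card - 1) hFc (by rwa [hU]) hAB
    ?_ ?_ (by omega) (by omega) (by omega) (by omega) ?_ ?_
  · obtain ⟨y, hy⟩ := h₁.2
    rw [mem_nbr_singleton] at hy
    exact ⟨y, mem_nbr.2 ⟨hy.1, t₁, ht₁, hy.2⟩⟩
  · obtain ⟨y, hy⟩ := h₂.2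
    rw [mem_nbr_singleton] at hy
    exact ⟨y, mem_nbr.2 ⟨hy.1, t₂, ht₂, hy.2⟩⟩
  · intro w hw
    have h1 := hdeg w
    have h2 := dg_le_of_closed (hF.closed w hw)
    have h3 : dg G K w ≤ dg G A w + dg G B w := by rw [← hU]; exact dg_union_le A B w
    have h4 : dg G K w < K.card := by
      refine lt_of_le_of_ne (dg_le_card K w) fun he => ?_
      have hwK : w ∉ K := Finset.disjoint_left.1 hF.disj hw
      have hall := Finset.filter_card_eq he
      refine hmax w hwK fun a ha b hb hab => ?_
      rcases Finset.mem_insert.1 ha with ha' | ha' <;> rcases Finset.mem_insert.1 hb with hb' | hb'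
      · exact absurd (ha'.trans hb'.symm) hab
      · subst ha'; exact hall b hb'
      · subst hb'; exact (hall a ha').symm
      · exact hK a ha' b hb' hab
    have h5 := dg_le_card (G := G) A w
    have h6 := dg_le_card (G := G) B w
    have h7 : 0 < dg G A w → ind (nbr G F A) w = 1 := ind_nbr_pos hw
    have h8 : 0 < dg G B w → ind (nbr G F B) w = 1 := ind_nbr_pos hw
    omega
  · intro a ha b hb i hi
    rw [hU]
    exact hK.exists_path (hU ▸ Finset.mem_union_left _ ha) (hU ▸ Finset.mem_union_right _ hb)
      (by rintro rfl; exact Finset.disjoint_left.1 hAB ha hb) (by omega) (by omega)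

theorem dg_pair {b c : V} (hbc : b ≠ c) (w : V) : dg G {b, c} w = dg G {b} w + dg G {c} w := by
  unfold dg
  rw [Finset.insert_eq, Finset.filter_union, Finset.card_union_of_disjoint]
  exact Finset.disjoint_filter_filter (by simpa using hbc)

theorem NoSep.consec_of_triangle {k : ℕ} (h : NoSep G) (hk : 4 ≤ k)
    (hdeg : ∀ w, k ≤ dg G Finset.univ w) (hcard : k + 2 ≤ Fintype.card V) {a b c : V}
    (hab : G.Adj a b) (hac : G.Adj a c) (hbc : G.Adj b c)
    (hmax : ∀ K, Clique G K → K.card ≤ 3) : HasConsecCycles G k := by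
  have hB : ({b, c} : Finset V).card ≤ 2 := Finset.card_le_two
  have hp1 : ∀ x y : V, G.Adj x y → ∃ S ⊆ ({x, y} : Finset V), PathOn G S y x ∧ S.card = 2 :=
    fun x y hxy => ⟨{y, x}, by rw [Finset.pair_comm], .cons hxy.symm (by simpa using hxy.ne')
      (.single x), Finset.card_pair hxy.ne'⟩
  have hp2 : ∀ x y z : V, G.Adj x y → G.Adj y z → x ≠ z →
      PathOn G {z, y, x} z x ∧ ({z, y, x} : Finset V).card = 3 := fun x y z hxy hyz hxz => by
    have hz : z ∉ ({y, x} : Finset V) := by simp [hyz.ne', hxz.symm]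
    refine ⟨.cons hyz.symm hz (.cons hxy.symm (by simpa using hxy.ne') (.single x)), ?_⟩
    rw [Finset.card_insert_of_notMem hz, Finset.card_pair hxy.ne']
  have hex : ∀ K : Finset V, K.card < 6 → ∃ F, Conn G F ∧ Sep G Finset.univ K F := by
    intro K hK
    obtain ⟨x, hx⟩ : ∃ x, x ∉ K := by
      by_contra! hall
      have := Finset.card_le_card (show Finset.univ ⊆ K from fun x _ => hall x)
      rw [Finset.card_univ] at this
      omega
    obtain ⟨F, -, hFc, hF⟩ := exists_component (G := G) (Finset.mem_univ x) hx
    exact ⟨F, hFc, hF⟩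
  have hdg : ∀ F A B : Finset V, Sep G Finset.univ (A ∪ B) F → ∀ w ∈ F,
      k ≤ dg G F w + dg G A w + dg G B w := fun F A B hF w hw => by
    have h1 := hdeg w
    have h2 := dg_le_of_closed (hF.closed w hw)
    have h3 := dg_union_le (G := G) A B w
    omega
  have hsing : ∀ u w : V, dg G {u} w = 1 → G.Adj w u := fun u w h => by
    rw [dg_singleton] at h
    by_contra hn
    simp [hn] at h
  by_cases hother : ∃ w, w ≠ a ∧ G.Adj w b ∧ G.Adj w c
  · obtain ⟨w, hwa, hwb, hwc⟩ := hother
    have hA : ({a, w} : Finset V).card ≤ 2 := Finset.card_le_two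
    have hAB : Disjoint ({a, w} : Finset V) {b, c} := by
      rw [Finset.disjoint_left]
      intro x hx
      simp only [Finset.mem_insert, Finset.mem_singleton] at hx ⊢
      rcases hx with rfl | rfl
      · simp [hab.ne, hac.ne]
      · simp [hwb.ne, hwc.ne]
    obtain ⟨F, hFc, hF⟩ := hex ({a, w} ∪ {b, c}) (by
      have := Finset.card_union_le ({a, w} : Finset V) {b, c}
      omega)
    refine h.triangle_cycles (p := k - 2) (L := 3) hFc hF hAB
      (h.exists_mem hF ⟨a, by simp⟩ hAB hB)
      (h.exists_mem (by rwa [Finset.union_comm]) ⟨b, by simp⟩ hAB.symm hA)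
      (by omega) (by omega) (by omega) (by omega) ?_ ?_
    · intro u hu
      have h1 := hdg F _ _ hF u hu
      have h2 := dg_le_card (G := G) {a, w} u
      have h3 := dg_le_card (G := G) {b, c} u
      have h4 : 0 < dg G {a, w} u → ind (nbr G F {a, w}) u = 1 := ind_nbr_pos hu
      have h5 : 0 < dg G {b, c} u → ind (nbr G F {b, c}) u = 1 := ind_nbr_pos hu
      have h6 : ¬ (dg G {b, c} u = 2 ∧ 0 < dg G {a, w} u) := by
        rintro ⟨h7, h8⟩
        rw [dg_pair hbc.ne] at h7
        have h9 := dg_singleton_le (G := G) b u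
        have h10 := dg_singleton_le (G := G) c u
        have hub := hsing b u (by omega)
        have huc := hsing c u (by omega)
        obtain ⟨v, hv, huv⟩ := dg_pos.1 h8
        have hv' : G.Adj v b ∧ G.Adj v c := by
          simp only [Finset.mem_insert, Finset.mem_singleton] at hv
          rcases hv with rfl | rfl
          exacts [⟨hab, hac⟩, ⟨hwb, hwc⟩]
        have := hmax {u, v, b, c} (by
          intro x hx y hy hxy
          simp only [Finset.mem_insert, Finset.mem_singleton] at hx hy
          have := huv.symm
          have := hub.symm
          have := huc.symm
          have := hv'.1.symm
          have := hv'.2.symm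
          have := hbc.symm
          rcases hx with rfl | rfl | rfl | rfl <;> rcases hy with rfl | rfl | rfl | rfl <;>
            simp_all)
        rw [Finset.card_insert_of_notMem (by simp [huv.ne, hub.ne, huc.ne]),
          Finset.card_insert_of_notMem (by simp [hv'.1.ne, hv'.2.ne]),
          Finset.card_pair hbc.ne] at this
        omega
      omega
    · have key : ∀ x x' y y', G.Adj x y → G.Adj x y' → G.Adj x' y → G.Adj x' y' → G.Adj y y' →
          x ≠ x' → ∀ i < 3, ∃ S ⊆ ({x, x', y, y'} : Finset V), PathOn G S y x ∧ S.card = 2 + i := by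
        intro x x' y y' h1 h2 h3 h4 h5 h6 i hi
        interval_cases i
        · obtain ⟨S, hS, h7⟩ := hp1 x y h1
          exact ⟨S, hS.trans (by intro z; simp; tauto), h7⟩
        · exact ⟨_, by intro z; simp; tauto, hp2 x y' y h2 h5.symm h1.ne⟩
        · have h7 : y ∉ ({x', y', x} : Finset V) := by simp [h3.ne', h5.ne, h1.ne']
          have h8 := hp2 x y' x' h2 h4.symm h6
          exact ⟨_, by intro z; simp; tauto, .cons h3.symm h7 h8.1, by
            rw [Finset.card_insert_of_notMem h7, h8.2]⟩
      intro x hx y hy i hi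
      simp only [Finset.mem_insert, Finset.mem_singleton] at hx hy
      have hsub : ∀ {T : Finset V}, T ⊆ ({a, w} : Finset V) ∪ {b, c} →
          (∃ S ⊆ T, PathOn G S y x ∧ S.card = 2 + i) →
          ∃ S ⊆ ({a, w} : Finset V) ∪ {b, c}, PathOn G S y x ∧ S.card = 2 + i :=
        fun hT ⟨S, hS, h⟩ => ⟨S, hS.trans hT, h⟩
      rcases hx with rfl | rfl <;> rcases hy with rfl | rfl
      · exact hsub (by intro z; simp; tauto) (key _ w _ c hab hac hwb hwc hbc hwa.symm i hi)
      · exact hsub (by intro z; simp; tauto) (key _ w _ b hac hab hwc hwb hbc.symm hwa.symm i hi)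
      · exact hsub (by intro z; simp; tauto) (key _ a _ c hwb hwc hab hac hbc hwa i hi)
      · exact hsub (by intro z; simp; tauto) (key _ a _ b hwc hwb hac hab hbc.symm hwa i hi)
  · push Not at hother
    have hAB : Disjoint ({a} : Finset V) {b, c} := by simp [hab.ne, hac.ne]
    obtain ⟨F, hFc, hF⟩ := hex ({a} ∪ {b, c}) (by
      have := Finset.card_union_le ({a} : Finset V) {b, c}
      have : ({a} : Finset V).card = 1 := Finset.card_singleton a
      omega)
    refine h.triangle_cycles (p := k - 1) (L := 2) hFc hF hAB
      (h.exists_mem hF ⟨a, by simp⟩ hAB hB)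
      (h.exists_mem (by rwa [Finset.union_comm]) ⟨b, by simp⟩ hAB.symm (by simp))
      (by omega) (by omega) (by omega) (by omega) ?_ ?_
    · intro u hu
      have h1 := hdg F _ _ hF u hu
      have h2 := dg_singleton_le (G := G) a u
      have h4 : 0 < dg G {a} u → ind (nbr G F {a}) u = 1 := ind_nbr_pos hu
      have h5 : 0 < dg G {b, c} u → ind (nbr G F {b, c}) u = 1 := ind_nbr_pos hu
      have h6 : dg G {b, c} u ≤ 1 := by
        rw [dg_pair hbc.ne]
        have h9 := dg_singleton_le (G := G) b u
        have h10 := dg_singleton_le (G := G) c u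
        by_contra hgt
        have hua : u ≠ a := by
          rintro rfl
          exact Finset.disjoint_left.1 hF.disj hu (by simp)
        exact hother u hua (hsing b u (by omega)) (hsing c u (by omega))
      omega
    · intro x hx y hy i hi
      obtain rfl : x = a := by simpa using hx
      have key : ∀ y y', G.Adj x y → G.Adj x y' → G.Adj y y' →
          ∃ S ⊆ ({x, y, y'} : Finset V), PathOn G S y x ∧ S.card = 2 + i := by
        intro y y' h1 h2 h3
        interval_cases i
        · obtain ⟨S, hS, h7⟩ := hp1 x y h1
          exact ⟨S, hS.trans (by intro z; simp; tauto), h7⟩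
        · exact ⟨_, by intro z; simp; tauto, hp2 x y' y h2 h3.symm h1.ne⟩
      simp only [Finset.mem_insert, Finset.mem_singleton] at hy
      rcases hy with rfl | rfl
      · obtain ⟨S, hS, h7⟩ := key y c hab hac hbc
        exact ⟨S, hS.trans (by intro z; simp; tauto), h7⟩
      · obtain ⟨S, hS, h7⟩ := key y b hac hab hbc.symm
        exact ⟨S, hS.trans (by intro z; simp; tauto), h7⟩

theorem NoSep.consec_of_not_triFree {k : ℕ} (h : NoSep G) (hk : 4 ≤ k)
    (hdeg : ∀ w, k ≤ dg G Finset.univ w) (hcard : k + 2 ≤ Fintype.card V) (ht : ¬ TriFree G) :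
    HasConsecCycles G k := by
  by_cases h4 : ∀ K, Clique G K → K.card ≤ 3
  · unfold TriFree at ht
    push Not at ht
    obtain ⟨a, b, c, hab, hbc, hac⟩ := ht
    exact h.consec_of_triangle hk hdeg hcard hab hac hbc h4
  · push Not at h4
    obtain ⟨K, hK, hKc⟩ := h4
    obtain ⟨B, hB, hKB, -, hmax⟩ := exists_max_finset (Clique G) (Finset.subset_univ K) hK
    exact h.consec_of_clique hdeg hcard hB (fun w hw => hmax w (Finset.mem_univ w) hw)
      (le_trans hKc (Finset.card_le_card hKB))

end Triangle
section OddCycles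
variable {V : Type*} [DecidableEq V] {G : SimpleGraph V} [DecidableRel G.Adj]

variable (G) in
/-- The subgraph induced on `U` is bipartite. -/
def Bip (U : Finset V) : Prop := ∃ f : V → Bool, ∀ a ∈ U, ∀ b ∈ U, G.Adj a b → f a ≠ f b

variable (G) in
/-- `C` is minimal among the sets inducing a nonbipartite subgraph. -/
def Crit (C : Finset V) : Prop := ¬ Bip G C ∧ ∀ C' ⊂ C, Bip G C'

theorem exists_crit {U : Finset V} (h : ¬ Bip G U) : ∃ C ⊆ U, Crit G C := by
  classical
  obtain ⟨C, hC, hmin⟩ := Finset.exists_min_image (U.powerset.filter (fun C => ¬ Bip G C))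
    Finset.card ⟨U, by simp [h]⟩
  simp only [Finset.mem_filter, Finset.mem_powerset] at hC hmin
  refine ⟨C, hC.1, hC.2, fun C' hC' => ?_⟩
  by_contra hb
  have := hmin C' ⟨hC'.1.trans hC.1, hb⟩
  have := Finset.card_lt_card hC'
  omega

theorem PathOn.parity {S : Finset V} {a b : V} (h : PathOn G S a b) {f : V → Bool}
    (hf : ∀ x ∈ S, ∀ y ∈ S, G.Adj x y → f x ≠ f y) : f a = f b ↔ S.card % 2 = 1 := by
  induction h with
  | single a => simp
  | @cons a b c S' hab ha hp ih =>
    have h1 := ih fun x hx y hy => hf x (by simp [hx]) y (by simp [hy])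
    have h2 := hf a (by simp) b (by simp [hp.left_mem]) hab
    rw [Finset.card_insert_of_notMem ha]
    cases hfa : f a <;> cases hfb : f b <;> cases hfc : f c <;> simp_all <;> omega

theorem not_bip_of_paths {S T U : Finset V} {a b c d : V} (hS : PathOn G S a b)
    (hT : PathOn G T c d) (hbc : G.Adj b c) (hda : G.Adj d a) (hodd : (S.card + T.card) % 2 = 1)
    (hSU : S ⊆ U) (hTU : T ⊆ U) : ¬ Bip G U := by
  rintro ⟨f, hf⟩
  have h1 := hS.parity (f := f) fun x hx y hy => hf x (hSU hx) y (hSU hy)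
  have h2 := hT.parity (f := f) fun x hx y hy => hf x (hTU hx) y (hTU hy)
  have h3 := hf b (hSU hS.right_mem) c (hTU hT.left_mem) hbc
  have h4 := hf d (hTU hT.right_mem) a (hSU hS.left_mem) hda
  cases hfa : f a <;> cases hfb : f b <;> cases hfc : f c <;> cases hfd : f d <;> simp_all <;> omega

theorem Crit.exists_path {C : Finset V} (h : Crit G C) : ∃ v x y P, v ∉ P ∧ insert v P = C ∧
    PathOn G P x y ∧ G.Adj v x ∧ G.Adj y v ∧ P.card % 2 = 0 := by
  classical
  obtain ⟨v, hv⟩ : C.Nonempty := by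
    rw [Finset.nonempty_iff_ne_empty]
    rintro rfl
    exact h.1 ⟨fun _ => true, by simp⟩
  obtain ⟨f, hf⟩ := h.2 _ (Finset.erase_ssubset hv)
  have key : ∃ x y P, P ⊆ C.erase v ∧ G.Adj v x ∧ G.Adj v y ∧ PathOn G P x y ∧ f x ≠ f y := by
    by_contra! hno
    refine h.1 ⟨fun w => if w = v then false else
      if ∃ x P, P ⊆ C.erase v ∧ G.Adj v x ∧ PathOn G P x w ∧ f x = false then !f w else f w, ?_⟩
    have hext : ∀ a ∈ C.erase v, ∀ b ∈ C.erase v, G.Adj a b →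
        (∃ x P, P ⊆ C.erase v ∧ G.Adj v x ∧ PathOn G P x a ∧ f x = false) →
        ∃ x P, P ⊆ C.erase v ∧ G.Adj v x ∧ PathOn G P x b ∧ f x = false := by
      rintro a ha b hb hab ⟨x, P, hP, hx, hp, hfx⟩
      obtain ⟨P', hP', hp'⟩ := (hp.conn.insert' hp.right_mem hab.symm).path
        (a := x) (b := b) (by simp [hp.left_mem]) (by simp)
      exact ⟨x, P', hP'.trans (Finset.insert_subset hb hP), hx, hp', hfx⟩
    have hnb : ∀ b ∈ C.erase v, G.Adj v b → (if b = v then false else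
        if ∃ x P, P ⊆ C.erase v ∧ G.Adj v x ∧ PathOn G P x b ∧ f x = false then !f b else f b)
        = true := by
      intro b hb hvb
      rw [if_neg (Finset.mem_erase.1 hb).1]
      split_ifs with hex
      · obtain ⟨x, P, hP, hx, hp, hfx⟩ := hex
        rw [← hno x b P hP hx hvb hp, hfx]
        rfl
      · by_contra hfb
        exact hex ⟨b, {b}, by simpa using hb, hvb, .single b, by simpa using hfb⟩
    intro a ha b hb hab
    by_cases hav : a = v
    · subst hav
      dsimp only
      rw [hnb b (Finset.mem_erase.2 ⟨hab.ne', hb⟩) hab]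
      simp
    · by_cases hbv : b = v
      · subst hbv
        dsimp only
        rw [hnb a (Finset.mem_erase.2 ⟨hab.ne, ha⟩) hab.symm]
        simp
      · have ha' := Finset.mem_erase.2 ⟨hav, ha⟩
        have hb' := Finset.mem_erase.2 ⟨hbv, hb⟩
        have h1 := hf a ha' b hb' hab
        have h2 := hext a ha' b hb' hab
        have h3 := hext b hb' a ha' hab.symm
        dsimp only
        rw [if_neg hav, if_neg hbv]
        by_cases hex : ∃ x P, P ⊆ C.erase v ∧ G.Adj v x ∧ PathOn G P x a ∧ f x = false
        · rw [if_pos hex, if_pos (h2 hex)]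
          simpa using h1
        · rw [if_neg hex, if_neg fun h => hex (h3 h)]
          exact h1
  obtain ⟨x, y, P, hP, hx, hy, hp, hxy⟩ := key
  have hvP : v ∉ P := fun h => (Finset.mem_erase.1 (hP h)).1 rfl
  have hpar := hp.parity (f := f) fun a ha b hb => hf a (hP ha) b (hP hb)
  have heven : P.card % 2 = 0 := by
    by_contra h
    exact hxy (hpar.2 (by omega))
  refine ⟨v, x, y, P, hvP, ?_, hp, hx, hy.symm, heven⟩
  have hsub : insert v P ⊆ C := Finset.insert_subset hv (hP.trans (Finset.erase_subset _ _))
  by_contra hne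
  exact not_bip_of_paths (.single v) hp hx hy.symm (by simp; omega) (U := insert v P) (by simp)
    (by simp) (h.2 _ (hsub.ssubset_of_ne hne))

theorem PathOn.exists_label {S : Finset V} {a b : V} (h : PathOn G S a b) : ∃ u : ℕ → V,
    u 0 = a ∧ u (S.card - 1) = b ∧ (∀ i < S.card, u i ∈ S) ∧ (∀ x ∈ S, ∃ i < S.card, u i = x) ∧
    (∀ i < S.card, ∀ j < S.card, u i = u j → i = j) ∧
    ∀ i, i + 1 < S.card → G.Adj (u i) (u (i + 1)) := by
  induction h with
  | single a =>
    refine ⟨fun _ => a, rfl, rfl, by simp, by simp, ?_, by simp⟩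
    intro i hi j hj _
    simp at hi hj
    omega
  | @cons a b c S' hab ha hp ih =>
    obtain ⟨u, h0, h1, h2, h3, h4, h5⟩ := ih
    have hpos := hp.card_pos
    rw [Finset.card_insert_of_notMem ha]
    refine ⟨fun i => if i = 0 then a else u (i - 1), by simp, ?_, ?_, ?_, ?_, ?_⟩
    · simp [hpos.ne', h1]
    · intro i hi
      dsimp only
      split_ifs with h
      · simp
      · exact Finset.mem_insert_of_mem (h2 _ (by omega))
    · intro x hx
      rcases Finset.mem_insert.1 hx with rfl | hx'
      · exact ⟨0, by omega, by simp⟩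
      · obtain ⟨i, hi, rfl⟩ := h3 x hx'
        exact ⟨i + 1, by omega, by simp⟩
    · intro i hi j hj hij
      dsimp only at hij
      split_ifs at hij with e1 e2 e2
      · omega
      · exact absurd (hij ▸ h2 (j - 1) (by omega)) ha
      · exact absurd (hij.symm ▸ h2 (i - 1) (by omega)) ha
      · have := h4 _ (by omega) _ (by omega) hij
        omega
    · intro i hi
      dsimp only
      rw [if_neg (Nat.succ_ne_zero i), Nat.add_sub_cancel]
      rcases i with _ | i
      · simpa [h0] using hab
      · rw [if_neg (Nat.succ_ne_zero i)]
        exact h5 i (by omega)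

variable (G) in
/-- `v` is a periodic labelling of the vertex set `C` along an odd cycle of length `n`. -/
structure Cyc (C : Finset V) (n : ℕ) (v : ℤ → V) : Prop where
  odd : n % 2 = 1
  per : ∀ i, v (i + n) = v i
  inj : ∀ i (t : ℕ), 0 < t → t < n → v (i + t) ≠ v i
  mem : ∀ x, x ∈ C ↔ ∃ i, v i = x
  adj : ∀ i, G.Adj (v i) (v (i + 1))

theorem Crit.exists_cyc {C : Finset V} (h : Crit G C) : ∃ n v, Cyc G C n v := by
  obtain ⟨w, x, y, P, hwP, rfl, hp, hwx, hyw, heven⟩ := h.exists_path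
  obtain ⟨u, h0, h1, h2, h3, h4, h5⟩ := (PathOn.cons hwx hwP hp).exists_label
  have hc := Finset.card_insert_of_notMem hwP
  have hpos := hp.card_pos
  have hlast : u ((insert w P).card - 1) = y := h1
  set n := (insert w P).card with hn
  have hn0 : (0 : ℤ) < n := by omega
  have hlt : ∀ i : ℤ, (i % n).toNat < n := fun i => by
    have := Int.emod_lt_of_pos i hn0
    have := Int.emod_nonneg i hn0.ne'
    omega
  have hstep : ∀ i : ℤ, ((i + 1) % n).toNat = (i % n).toNat + 1 ∨
      ((i + 1) % n).toNat = 0 ∧ (i % n).toNat = n - 1 := fun i => by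
    have h6 := Int.emod_lt_of_pos i hn0
    have h7 := Int.emod_nonneg i hn0.ne'
    rw [← Int.emod_add_emod]
    rcases eq_or_lt_of_le (show i % n + 1 ≤ n by omega) with h | h
    · right
      rw [h, Int.emod_self]
      omega
    · left
      rw [Int.emod_eq_of_lt (by omega) h]
      omega
  refine ⟨n, fun i => u (i % n).toNat, by omega, fun i => by simp, ?_, ?_, ?_⟩
  · intro i t ht0 htn he
    have := h4 _ (hlt _) _ (hlt _) he
    have h6 := Int.emod_nonneg (i + t) hn0.ne'
    have h7 := Int.emod_nonneg i hn0.ne'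
    have h8 : (i + t) % n = i % n := by omega
    have h9 : (n : ℤ) ∣ (i + t) - i := Int.emod_eq_emod_iff_emod_sub_eq_zero.1 h8 |> Int.dvd_of_emod_eq_zero
    rw [add_sub_cancel_left] at h9
    have := Int.le_of_dvd (by omega) h9
    omega
  · intro z
    constructor
    · intro hz
      obtain ⟨i, hi, rfl⟩ := h3 z hz
      refine ⟨i, ?_⟩
      rw [Int.emod_eq_of_lt (by omega) (by omega)]
      simp
    · rintro ⟨i, rfl⟩
      exact h2 _ (hlt i)
  · intro i
    rcases hstep i with h | ⟨h, h'⟩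
    · have h6 := hlt (i + 1)
      rw [h] at h6 ⊢
      exact h5 _ h6
    · rw [h, h', h0, hlast]
      exact hyw

end OddCycles
section CycleArcs
variable {V : Type*} [DecidableEq V] {G : SimpleGraph V} [DecidableRel G.Adj]

/-- The vertices `v l, …, v (l + t)`. -/
def arc (v : ℤ → V) (l : ℤ) (t : ℕ) : Finset V :=
  (Finset.range (t + 1)).image fun j : ℕ => v (l + j)

theorem mem_arc {v : ℤ → V} {l : ℤ} {t : ℕ} {x : V} :
    x ∈ arc v l t ↔ ∃ j : ℕ, j ≤ t ∧ v (l + j) = x := by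
  simp [arc]

variable {C : Finset V} {n : ℕ} {v : ℤ → V}

theorem Cyc.pos (h : Cyc G C n v) : 0 < n := by
  have := h.odd
  omega

theorem Cyc.three_le (h : Cyc G C n v) : 3 ≤ n := by
  have := h.odd
  by_contra hn
  obtain rfl : n = 1 := by omega
  have := h.per 0
  have h2 := h.adj 0
  simp at this h2
  rw [this] at h2
  exact G.loopless.irrefl _ h2

theorem Cyc.inj' (h : Cyc G C n v) {l : ℤ} {i j : ℕ} (hi : i < n) (hj : j < n)
    (he : v (l + i) = v (l + j)) : i = j := by
  rcases lt_trichotomy i j with hij | hij | hij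
  · refine absurd he.symm ?_
    have := h.inj (l + i) (j - i) (by omega) (by omega)
    rwa [show l + (i : ℤ) + (j - i : ℕ) = l + j by omega] at this
  · exact hij
  · refine absurd he ?_
    have := h.inj (l + j) (i - j) (by omega) (by omega)
    rwa [show l + (j : ℤ) + (i - j : ℕ) = l + i by omega] at this

theorem Cyc.rep (h : Cyc G C n v) {x : V} (hx : x ∈ C) (l : ℤ) : ∃ t < n, v (l + t) = x := by
  obtain ⟨i, rfl⟩ := (h.mem x).1 hx
  have hn : (0 : ℤ) < n := by exact_mod_cast h.pos
  have h1 := Int.emod_lt_of_pos (i - l) hn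
  have h2 := Int.emod_nonneg (i - l) hn.ne'
  refine ⟨((i - l) % n).toNat, by omega, ?_⟩
  have hper : Function.Periodic v (n : ℤ) := h.per
  rw [Int.toNat_of_nonneg h2, Int.emod_def, ← hper.int_mul ((i - l) / n)]
  congr 1
  push_cast
  ring

theorem Cyc.mem_self (h : Cyc G C n v) (i : ℤ) : v i ∈ C := (h.mem _).2 ⟨i, rfl⟩

theorem Cyc.arc_subset (h : Cyc G C n v) (l : ℤ) (t : ℕ) : arc v l t ⊆ C := by
  intro x hx
  obtain ⟨j, -, rfl⟩ := mem_arc.1 hx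
  exact h.mem_self _

theorem Cyc.mirror (h : Cyc G C n v) : Cyc G C n fun i => v (-i) := by
  refine ⟨h.odd, fun i => ?_, fun i t h0 ht => ?_, fun x => ?_, fun i => ?_⟩
  · have := h.per (-i - n)
    rw [show -(i + (n : ℤ)) = -i - n by ring, ← this]
    congr 1
    ring
  · have := h.inj (-(i + t)) t h0 ht
    rw [show -(i + (t : ℤ)) + t = -i by ring] at this
    exact this.symm
  · rw [h.mem x]
    exact ⟨fun ⟨i, hi⟩ => ⟨-i, by simpa using hi⟩, fun ⟨i, hi⟩ => ⟨-i, hi⟩⟩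
  · have := h.adj (-(i + 1))
    rw [show -(i + 1) + 1 = -i by ring] at this
    exact this.symm

theorem Cyc.arc_path (h : Cyc G C n v) (l : ℤ) {t : ℕ} (ht : t < n) :
    PathOn G (arc v l t) (v l) (v (l + t)) ∧ (arc v l t).card = t + 1 := by
  refine ⟨?_, ?_⟩
  · induction t generalizing l with
    | zero => simpa [arc] using PathOn.single (v l)
    | succ t ih =>
      have hs : arc v l (t + 1) = insert (v l) (arc v (l + 1) t) := by
        ext x
        rw [Finset.mem_insert, mem_arc, mem_arc]
        constructor
        · rintro ⟨j, hj, rfl⟩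
          rcases j with _ | j
          · left
            simp
          · right
            refine ⟨j, by omega, ?_⟩
            congr 1
            push_cast
            ring
        · rintro (rfl | ⟨j, hj, rfl⟩)
          · exact ⟨0, by omega, by simp⟩
          · refine ⟨j + 1, by omega, ?_⟩
            congr 1
            push_cast
            ring
      rw [hs]
      have hp := ih (l + 1) (by omega)
      rw [show l + 1 + (t : ℤ) = l + (t + 1 : ℕ) by push_cast; ring] at hp
      refine .cons (h.adj l) (fun hm => ?_) hp
      obtain ⟨j, hj, he⟩ := mem_arc.1 hm
      refine h.inj l (j + 1) (by omega) (by omega) ?_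
      rw [← he]
      congr 1
      push_cast
      ring
  · rw [arc, Finset.card_image_of_injOn, Finset.card_range]
    intro i hi j hj he
    simp only [Finset.coe_range, Set.mem_Iio] at hi hj
    exact h.inj' (by omega) (by omega) he

theorem Cyc.arc_path' (h : Cyc G C n v) (l : ℤ) {t : ℕ} (h0 : 0 < t) (ht : t < n) :
    PathOn G (arc v (l + t) (n - t)) (v (l + t)) (v l) ∧ (arc v (l + t) (n - t)).card = n - t + 1 := by
  have := h.arc_path (l + t) (t := n - t) (by omega)
  rwa [show l + (t : ℤ) + (n - t : ℕ) = l + n by omega, h.per] at this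

theorem Cyc.card (h : Cyc G C n v) : C.card = n := by
  have hp := h.pos
  have := (h.arc_path 0 (t := n - 1) (by omega)).2
  rw [show C = arc v 0 (n - 1) from ?_, this]
  · omega
  · refine (h.arc_subset 0 (n - 1)).antisymm' fun x hx => ?_
    obtain ⟨t, ht, he⟩ := h.rep hx 0
    exact mem_arc.2 ⟨t, by omega, he⟩

theorem Cyc.not_adj (h : Cyc G C n v) (hc : Crit G C) {i : ℤ} {t : ℕ} (h1 : 1 < t)
    (h2 : t + 1 < n) : ¬ G.Adj (v i) (v (i + t)) := fun hadj => by
  have hodd := h.odd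
  rcases Nat.even_or_odd t with ht | ht
  · have hp := h.arc_path (i + 1) (t := t - 1) (by omega)
    have e1 := Nat.even_iff.1 ht
    rw [show i + 1 + (t - 1 : ℕ) = i + t by omega] at hp
    have hs : insert (v i) (arc v (i + 1) (t - 1)) ⊂ C := by
      refine (Finset.insert_subset (h.mem_self _) (h.arc_subset _ _)).ssubset_of_ne fun he => ?_
      have hle := Finset.card_insert_le (v i) (arc v (i + 1) (t - 1))
      rw [he, hp.2, h.card] at hle
      omega
    exact not_bip_of_paths (.single (v i)) hp.1 (h.adj i) hadj.symm (by rw [hp.2]; simp; omega)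
      (U := insert (v i) (arc v (i + 1) (t - 1))) (by simp) (by simp) (hc.2 _ hs)
  · have hp := h.arc_path (i + t) (t := n - t - 1) (by omega)
    have e1 := Nat.odd_iff.1 ht
    rw [show i + t + (n - t - 1 : ℕ) = i - 1 + n by omega, h.per] at hp
    have hs : insert (v i) (arc v (i + t) (n - t - 1)) ⊂ C := by
      refine (Finset.insert_subset (h.mem_self _) (h.arc_subset _ _)).ssubset_of_ne fun he => ?_
      have hle := Finset.card_insert_le (v i) (arc v (i + t) (n - t - 1))
      rw [he, hp.2, h.card] at hle
      omega
    have ha := h.adj (i - 1)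
    rw [sub_add_cancel] at ha
    exact not_bip_of_paths (.single (v i)) hp.1 hadj ha (by rw [hp.2]; simp; omega)
      (U := insert (v i) (arc v (i + t) (n - t - 1))) (by simp) (by simp) (hc.2 _ hs)

theorem Cyc.five_le (h : Cyc G C n v) (ht : TriFree G) : 5 ≤ n := by
  have h3 := h.three_le
  have hodd := h.odd
  by_contra hn
  obtain rfl : n = 3 := by omega
  have h1 := h.adj 0
  have h2 := h.adj 1
  have h4 := h.adj 2
  have h5 := h.per 0
  norm_num at h1 h2 h4 h5
  rw [h5] at h4
  exact ht _ _ _ h1 h2 h4.symm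

/-- The degree of a cycle vertex into its own induced cycle is at most two. -/
theorem Cyc.dg_le (h : Cyc G C n v) (hc : Crit G C) (i : ℤ) : dg G C (v i) ≤ 2 := by
  have : nbr G C {v i} ⊆ {v (i + 1), v (i - 1)} := by
    intro x hx
    obtain ⟨hx, ha⟩ := mem_nbr_singleton.1 hx
    obtain ⟨t, ht, rfl⟩ := h.rep hx i
    have h0 : t ≠ 0 := by
      rintro rfl
      simp at ha
    by_cases h1 : t = 1
    · subst h1
      simp
    by_cases h2 : t + 1 = n
    · rw [show i + (t : ℤ) = i - 1 + n by omega, h.per]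
      simp
    exact absurd ha (h.not_adj hc (by omega) (by omega))
  refine (Finset.card_le_card ?_).trans ((Finset.card_le_card this).trans Finset.card_le_two)
  intro x hx
  simpa [mem_nbr_singleton] using hx

end CycleArcs
section NonSeparating
variable {V : Type*} [DecidableEq V] {G : SimpleGraph V} [DecidableRel G.Adj] [Fintype V]

theorem PathOn.subset_of_sep {S C M : Finset V} {x y : V} (h : PathOn G S x y)
    (hM : Sep G Finset.univ C M) (hS : Disjoint S C) (hx : x ∈ M) : S ⊆ M := by
  induction h with
  | single a => simpa using hx
  | @cons a b c S' hab ha hp ih =>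
    rw [Finset.disjoint_insert_left] at hS
    refine Finset.insert_subset hx (ih hS.2 ?_)
    exact (hM.closed a hx b (Finset.mem_univ b) hab).resolve_right
      (Finset.disjoint_left.1 hS.2 hp.left_mem)

open Classical in
variable (G) in
/-- The vertices reachable from `x` in the complement of `C`. -/
noncomputable def comp (C : Finset V) (x : V) : Finset V :=
  Finset.univ.filter fun y => ∃ S, Disjoint S C ∧ PathOn G S x y

theorem mem_comp {C : Finset V} {x y : V} :
    y ∈ comp G C x ↔ ∃ S, Disjoint S C ∧ PathOn G S x y := by
  simp [comp]

theorem Conn.subset_comp {C M : Finset V} {x : V} (h : Conn G M) (hd : Disjoint M C) (hx : x ∈ M) :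
    M ⊆ comp G C x := fun y hy => by
  obtain ⟨S, hS, hp⟩ := h.path hx hy
  exact mem_comp.2 ⟨S, Finset.disjoint_of_subset_left hS hd, hp⟩

theorem Conn.comp_eq {C M : Finset V} {x : V} (h : Conn G M) (hs : Sep G Finset.univ C M)
    (hx : x ∈ M) : comp G C x = M := by
  refine (h.subset_comp hs.disj hx).antisymm' fun y hy => ?_
  obtain ⟨S, hS, hp⟩ := mem_comp.1 hy
  exact hp.subset_of_sep hs hS hx hp.right_mem

variable (G) in
/-- A weight on vertex sets that favours large components of the complement. -/
noncomputable def weight (C : Finset V) : ℕ := ∑ x ∈ Finset.univ \ C, 3 ^ (comp G C x).card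

theorem weight_lt_of_ssubset {C C' : Finset V} (h : C' ⊂ C) : weight G C < weight G C' := by
  obtain ⟨z, hz, hz'⟩ := Finset.exists_of_ssubset h
  have h1 : weight G C ≤ ∑ x ∈ Finset.univ \ C, 3 ^ (comp G C' x).card := by
    refine Finset.sum_le_sum fun x hx => Nat.pow_le_pow_right (by norm_num) (Finset.card_le_card ?_)
    intro y hy
    obtain ⟨S, hS, hp⟩ := mem_comp.1 hy
    exact mem_comp.2 ⟨S, Finset.disjoint_of_subset_right h.1 hS, hp⟩
  refine h1.trans_lt ?_
  refine Finset.sum_lt_sum_of_subset (i := z) (Finset.sdiff_subset_sdiff le_rfl h.1) (by simpa using hz')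
    (by simpa using hz) (by positivity) fun _ _ _ => Nat.zero_le _

theorem weight_lt_of_component {C C' K M : Finset V} {z : V} (hK : Conn G K)
    (hKs : Sep G Finset.univ C K) (hM : Conn G M) (hMs : Sep G Finset.univ C M)
    (hKM : Disjoint K M) (hle : K.card ≤ M.card) (hz : z ∈ nbr G C M) (hzC : z ∉ C')
    (hC' : C' ⊆ C ∪ K) : weight G C < weight G C' := by
  obtain ⟨hzC', m, hm, hmz⟩ := mem_nbr.1 hz
  have hzM : z ∉ M := fun h => Finset.disjoint_left.1 hMs.disj h hzC'
  have hMC' : Disjoint M C' := Finset.disjoint_of_subset_right hC'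
    (Finset.disjoint_union_right.2 ⟨hMs.disj, hKM.symm⟩)
  set W := (Finset.univ \ C) \ (K ∪ M) with hW
  have hKsub : K ⊆ Finset.univ \ C := fun x hx => by
    simpa using Finset.disjoint_left.1 hKs.disj hx
  have hMsub : M ⊆ Finset.univ \ C := fun x hx => by
    simpa using Finset.disjoint_left.1 hMs.disj hx
  have h1 : weight G C = ∑ x ∈ W, 3 ^ (comp G C x).card + (K.card * 3 ^ K.card +
      M.card * 3 ^ M.card) := by
    rw [weight, ← Finset.sum_sdiff (Finset.union_subset hKsub hMsub), Finset.sum_union hKM]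
    congr 2
    · rw [Finset.sum_congr rfl fun x hx => by rw [hK.comp_eq hKs hx]]
      simp
    · rw [Finset.sum_congr rfl fun x hx => by rw [hM.comp_eq hMs hx]]
      simp
  have h2 : ∑ x ∈ W, 3 ^ (comp G C x).card + M.card * 3 ^ (M.card + 1) ≤ weight G C' := by
    have hd : Disjoint W M := by
      rw [hW]
      exact Finset.disjoint_of_subset_right Finset.subset_union_right Finset.sdiff_disjoint
    have hsub : W ∪ M ⊆ Finset.univ \ C' := by
      intro x hx
      rw [Finset.mem_sdiff]
      refine ⟨Finset.mem_univ x, fun hxC => ?_⟩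
      rcases Finset.mem_union.1 hx with hx | hx
      · have := hC' hxC
        simp only [hW, Finset.mem_sdiff, Finset.mem_union] at hx this
        tauto
      · exact Finset.disjoint_left.1 hMC' hx hxC
    refine le_trans ?_ (Finset.sum_le_sum_of_subset hsub)
    rw [Finset.sum_union hd]
    refine Nat.add_le_add (Finset.sum_le_sum fun x hx => Nat.pow_le_pow_right (by norm_num)
      (Finset.card_le_card ?_)) ?_
    · intro y hy
      obtain ⟨S, hS, hp⟩ := mem_comp.1 hy
      refine mem_comp.2 ⟨S, ?_, hp⟩
      refine Finset.disjoint_of_subset_right hC' (Finset.disjoint_union_right.2 ⟨hS, ?_⟩)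
      rw [Finset.disjoint_left]
      intro u hu huK
      obtain ⟨S₁, S₂, hS12, -, hp1, -⟩ := hp.split hu
      have : S₁ ⊆ K := hp1.symm.subset_of_sep hKs
        (Finset.disjoint_of_subset_left (by rw [← hS12]; exact Finset.subset_union_left) hS) huK
      have := this hp1.left_mem
      simp [hW, this] at hx
    · rw [← smul_eq_mul, ← Finset.sum_const]
      refine Finset.sum_le_sum fun x hx => Nat.pow_le_pow_right (by norm_num) ?_
      rw [← Finset.card_insert_of_notMem hzM]
      refine Finset.card_le_card (Conn.subset_comp (hM.insert' hm hmz.symm) ?_ (by simp [hx]))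
      exact Finset.disjoint_insert_left.2 ⟨hzC, hMC'⟩
  have hMpos : 0 < M.card := hM.1.card_pos
  have h3 : 3 ^ K.card ≤ 3 ^ M.card := Nat.pow_le_pow_right (by norm_num) hle
  have h4 : K.card * 3 ^ K.card ≤ M.card * 3 ^ M.card := Nat.mul_le_mul hle h3
  have h5 : 0 < M.card * 3 ^ M.card := by positivity
  have h6 : M.card * 3 ^ (M.card + 1) = 3 * (M.card * 3 ^ M.card) := by ring
  omega

theorem Cyc.exists_not_bip {C K : Finset V} {n : ℕ} {v : ℤ → V} (h : Cyc G C n v) (hK : Conn G K)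
    {f : V → Bool} (hf : ∀ a ∈ K, ∀ b ∈ K, G.Adj a b → f a ≠ f b) {i : ℤ} {t : ℕ} (ht : t < n)
    {x y : V} (hx : x ∈ K) (hy : y ∈ K) (hix : G.Adj x (v i)) (hiy : G.Adj y (v (i + t)))
    (hpar : t % 2 = 1 ↔ f x = f y) : ∃ P ⊆ K, ¬ Bip G (arc v i t ∪ P) := by
  obtain ⟨P, hP, hp⟩ := hK.path hy hx
  obtain ⟨h1, h2⟩ := h.arc_path i ht
  have h3 := hp.parity (f := f) fun a ha b hb => hf a (hP ha) b (hP hb)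
  refine ⟨P, hP, not_bip_of_paths h1 hp hiy.symm hix ?_ Finset.subset_union_left
    Finset.subset_union_right⟩
  rw [h2]
  rw [@eq_comm _ (f x), h3] at hpar
  omega

/-- Consecutive attachments of `K` along the cycle give a two-vertex separator. -/
theorem NoSep.exists_between (h : NoSep G) {C K : Finset V} {n : ℕ} {v : ℤ → V} (hv : Cyc G C n v)
    (hc : Crit G C) (hKs : Sep G Finset.univ C K) {r : V} (hrC : r ∉ C) (hrK : r ∉ K) {i : ℤ} {t : ℕ}
    (h0 : 0 < t) (ht : t < n)
    (harc : ∀ z ∈ C, (∃ a, a ∉ C ∧ a ∉ K ∧ G.Adj a z) → z ∈ arc v i t) :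
    ∃ j, 0 < j ∧ j < t ∧ v (i + j) ∈ nbr G C K := by
  by_contra! hno
  have hs : Sep G Finset.univ {v i, v (i + t)} (K ∪ C \ arc v i t) := by
    refine ⟨Finset.subset_univ _, hKs.ne.mono Finset.subset_union_left, ?_, ?_⟩
    · rw [Finset.disjoint_right]
      intro x hx hx'
      have hxC : x ∈ C ∧ x ∈ arc v i t := by
        simp only [Finset.mem_insert, Finset.mem_singleton] at hx
        rcases hx with rfl | rfl
        · exact ⟨hv.mem_self _, mem_arc.2 ⟨0, by omega, by simp⟩⟩
        · exact ⟨hv.mem_self _, mem_arc.2 ⟨t, le_rfl, rfl⟩⟩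
      rcases Finset.mem_union.1 hx' with hx' | hx'
      · exact Finset.disjoint_left.1 hKs.disj hx' hxC.1
      · exact (Finset.mem_sdiff.1 hx').2 hxC.2
    · intro a ha b _ hab
      rcases Finset.mem_union.1 ha with haK | haC
      · rcases hKs.closed a haK b (Finset.mem_univ _) hab with hb | hb
        · exact Or.inl (Finset.mem_union_left _ hb)
        · by_cases hbA : b ∈ arc v i t
          · right
            obtain ⟨j, hj, rfl⟩ := mem_arc.1 hbA
            rcases Nat.eq_zero_or_pos j with rfl | hj0
            · simp
            rcases hj.eq_or_lt with rfl | hj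
            · simp
            · exact absurd (mem_nbr.2 ⟨hb, a, haK, hab⟩) (hno j hj0 hj)
          · exact Or.inl (Finset.mem_union_right _ (Finset.mem_sdiff.2 ⟨hb, hbA⟩))
      · obtain ⟨haC, haA⟩ := Finset.mem_sdiff.1 haC
        by_cases hbK : b ∈ K
        · exact Or.inl (Finset.mem_union_left _ hbK)
        by_cases hbC : b ∈ C
        · by_cases hbA : b ∈ arc v i t
          · right
            obtain ⟨j, hj, rfl⟩ := mem_arc.1 hbA
            obtain ⟨j', hj', rfl⟩ := hv.rep haC i
            have hlt : t < j' := by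
              by_contra hle
              exact haA (mem_arc.2 ⟨j', by omega, rfl⟩)
            rcases Nat.eq_zero_or_pos j with rfl | hj0
            · simp
            rcases hj.eq_or_lt with rfl | hj
            · simp
            · have := hv.not_adj hc (i := i + j) (t := j' - j) (by omega) (by omega)
              rw [show i + (j : ℤ) + (j' - j : ℕ) = i + j' by omega] at this
              exact absurd hab.symm this
          · exact Or.inl (Finset.mem_union_right _ (Finset.mem_sdiff.2 ⟨hbC, hbA⟩))
        · exact absurd (harc a haC ⟨b, hbC, hbK, hab.symm⟩) haA
  rcases h.mem_or hs Finset.card_le_two r with hr | hr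
  · simp [hrC, hrK] at hr
  · simp only [Finset.mem_insert, Finset.mem_singleton] at hr
    rcases hr with rfl | rfl <;> exact hrC (hv.mem_self _)

theorem NoSep.conn_compl (h : NoSep G) (hdeg : ∀ w, 3 ≤ dg G Finset.univ w) {C : Finset V}
    (hnb : ¬ Bip G C) (hmax : ∀ C', ¬ Bip G C' → weight G C' ≤ weight G C) :
    Crit G C ∧ Conn G (Finset.univ \ C) := by
  have hcrit : Crit G C := ⟨hnb, fun C' hC' => by
    by_contra hb
    exact absurd (weight_lt_of_ssubset hC') (hmax C' hb).not_gt⟩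
  refine ⟨hcrit, ?_⟩
  obtain ⟨n, v, hv⟩ := hcrit.exists_cyc
  obtain ⟨x, hx, hxmin⟩ : ∃ x ∈ Finset.univ \ C, ∀ y ∈ Finset.univ \ C,
      (comp G C x).card ≤ (comp G C y).card := by
    refine Finset.exists_min_image _ _ ?_
    rw [Finset.nonempty_iff_ne_empty]
    intro he
    have : C = Finset.univ := by
      ext y
      by_contra hy
      have : y ∈ Finset.univ \ C := by simpa using hy
      simp [he] at this
    have h1 := hv.dg_le hcrit 0
    have h2 := hdeg (v 0)
    rw [this] at h1
    omega
  obtain ⟨K, hxK, hK, hKs⟩ := exists_component (G := G) (Finset.mem_univ x) (B := C)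
    (by simpa using hx)
  by_contra hconn
  obtain ⟨r, hrC, hrK⟩ : ∃ r, r ∉ C ∧ r ∉ K := by
    by_contra! hall
    refine hconn ?_
    have : Finset.univ \ C = K := by
      ext y
      simp only [Finset.mem_sdiff, Finset.mem_univ, true_and]
      exact ⟨hall y, fun hy => Finset.disjoint_left.1 hKs.disj hy⟩
    rwa [this]
  have hclaim : ∀ C', ¬ Bip G C' → C' ⊆ C ∪ K → ∀ z ∈ C, (∃ a, a ∉ C ∧ a ∉ K ∧ G.Adj a z) →
      z ∈ C' := by
    rintro C' hC' hsub z hz ⟨a, haC, haK, haz⟩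
    by_contra hzC
    obtain ⟨M, haM, hM, hMs⟩ := exists_component (G := G) (Finset.mem_univ a) haC
    have hKM : Disjoint K M := by
      rw [Finset.disjoint_left]
      intro y hyK hyM
      have : K = M := by rw [← hK.comp_eq hKs hyK, hM.comp_eq hMs hyM]
      exact haK (this ▸ haM)
    have hle := hxmin a (by simpa using haC)
    rw [hK.comp_eq hKs hxK, hM.comp_eq hMs haM] at hle
    exact (weight_lt_of_component hK hKs hM hMs hKM hle (mem_nbr.2 ⟨hz, a, haM, haz⟩) hzC
      hsub).not_ge (hmax C' hC')
  obtain ⟨z₀, hz₀C, hz₀⟩ : ∃ z ∈ C, ∃ a, a ∉ C ∧ a ∉ K ∧ G.Adj a z := by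
    by_contra! hno
    have hs : Sep G Finset.univ ∅ (Finset.univ \ (C ∪ K)) :=
      ⟨Finset.subset_univ _, ⟨r, by simp [hrC, hrK]⟩, by simp, fun a ha b _ hab => by
        simp only [Finset.mem_sdiff, Finset.mem_univ, Finset.mem_union, true_and, not_or] at ha ⊢
        refine Or.inl ⟨fun hb => hno b hb a ha.1 ha.2 hab, fun hb => ?_⟩
        exact (hKs.closed b hb a (Finset.mem_univ _) hab.symm).elim ha.2 ha.1⟩
    rcases h.mem_or hs (by simp) x with h' | h'
    · simp [hxK] at h'
    · simp at h'
  obtain ⟨f, hf⟩ : Bip G K := by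
    by_contra hb
    exact Finset.disjoint_left.1 hKs.disj
      (hclaim K hb Finset.subset_union_right z₀ hz₀C hz₀) hz₀C
  have hA : 2 < (nbr G C K).card := by
    by_contra hle
    have hs : Sep G Finset.univ (nbr G C K) K := hKs.shrink
      (Finset.disjoint_of_subset_right (nbr_subset _ _) hKs.disj) fun a ha b hb hbn hab =>
        hbn (mem_nbr.2 ⟨hb, a, ha, hab⟩)
    rcases h.mem_or hs (by omega) r with h' | h'
    · exact hrK h'
    · exact hrC (nbr_subset _ _ h')
  have hatt : ∀ a, ∃ y, a ∈ nbr G C K → y ∈ K ∧ G.Adj y a := fun a => by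
    by_cases ha : a ∈ nbr G C K
    · obtain ⟨-, y, hy, hya⟩ := mem_nbr.1 ha
      exact ⟨y, fun _ => ⟨hy, hya⟩⟩
    · exact ⟨a, fun h => absurd h ha⟩
  choose at' hat using hatt
  set g : V → Bool := fun a => f (at' a) with hg
  have hex : ∃ t, ∃ i, 0 < t ∧ t < n ∧ v i ∈ nbr G C K ∧ v (i + t) ∈ nbr G C K ∧
      (t % 2 = 1 ↔ g (v i) = g (v (i + t))) := by
    obtain ⟨a, ha, b, hb, hab⟩ := Finset.one_lt_card.1 (show 1 < (nbr G C K).card by omega)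
    obtain ⟨i, -, rfl⟩ := hv.rep (nbr_subset _ _ ha) 0
    obtain ⟨t, ht, rfl⟩ := hv.rep (nbr_subset _ _ hb) (0 + i)
    have ht0 : 0 < t := by
      rcases Nat.eq_zero_or_pos t with rfl | h0
      · simp at hab
      · exact h0
    have hodd := hv.odd
    by_cases hgd : (t % 2 = 1 ↔ g (v (0 + i)) = g (v (0 + i + t)))
    · exact ⟨t, 0 + i, ht0, ht, ha, hb, hgd⟩
    · have e : v (0 + i + t + (n - t : ℕ)) = v (0 + i) := by
        rw [show 0 + (i : ℤ) + t + (n - t : ℕ) = 0 + i + n by omega, hv.per]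
      refine ⟨n - t, 0 + i + t, by omega, by omega, hb, by rwa [e], ?_⟩
      rw [e, @eq_comm _ (g (v (0 + i + t)))]
      by_cases hgg : g (v (0 + i)) = g (v (0 + i + t)) <;> simp only [hgg, iff_true, iff_false] at hgd ⊢ <;> omega
  classical
  obtain ⟨i, ht0, htn, hvi, hvt, hpar⟩ := Nat.find_spec hex
  have hmin := fun m hm => Nat.find_min hex (m := m) hm
  set t := Nat.find hex
  obtain ⟨P, hP, hPb⟩ := hv.exists_not_bip hK hf htn (hat _ hvi).1 (hat _ hvt).1 (hat _ hvi).2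
    (hat _ hvt).2 hpar
  obtain ⟨j, hj0, hjt, hvj⟩ := h.exists_between hv hcrit hKs hrC hrK ht0 htn
    (fun z hz hz' => by
      have := hclaim _ hPb (Finset.union_subset_union (hv.arc_subset _ _) hP) z hz hz'
      refine (Finset.mem_union.1 this).resolve_right fun hzP => ?_
      exact Finset.disjoint_left.1 hKs.disj (hP hzP) hz)
  have e : i + (j : ℤ) + (t - j : ℕ) = i + t := by omega
  have h1 : ¬ (j % 2 = 1 ↔ g (v i) = g (v (i + j))) := fun hgd =>
    hmin j hjt ⟨i, hj0, by omega, hvi, hvj, hgd⟩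
  have h2 : ¬ ((t - j) % 2 = 1 ↔ g (v (i + j)) = g (v (i + t))) := fun hgd =>
    hmin (t - j) (by omega) ⟨i + j, by omega, by omega, hvj, by rwa [e], by rwa [e]⟩
  cases hga : g (v i) <;> cases hgb : g (v (i + j)) <;> cases hgc : g (v (i + t)) <;>
    simp only [hga, hgb, hgc, reduceCtorEq, iff_true, iff_false] at hpar h1 h2 <;> omega

theorem NoSep.exists_crit_conn (h : NoSep G) (hdeg : ∀ w, 3 ≤ dg G Finset.univ w)
    (hnb : ¬ Bip G Finset.univ) : ∃ C, Crit G C ∧ Conn G (Finset.univ \ C) := by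
  classical
  obtain ⟨C, hC, hmax⟩ := Finset.exists_max_image
    (Finset.univ.filter fun C : Finset V => ¬ Bip G C) (weight G) ⟨Finset.univ, by simpa using hnb⟩
  simp only [Finset.mem_filter, Finset.mem_univ, true_and] at hC hmax
  exact ⟨C, h.conn_compl hdeg hC hmax⟩

end NonSeparating
section CoreStructure
variable {V : Type*} [DecidableEq V] {G : SimpleGraph V} [DecidableRel G.Adj] [Fintype V]

theorem Conn.of_attached {U W : Finset V} (hU : Conn G U) (hUW : U ⊆ W)
    (h : ∀ x ∈ W, x ∉ U → ∃ u ∈ U, G.Adj x u) : Conn G W := by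
  refine ⟨hU.1.mono hUW, fun T hT => ?_⟩
  have hne : (T ∩ U).Nonempty := by
    obtain ⟨x, hx⟩ := hT.ne
    by_cases hxU : x ∈ U
    · exact ⟨x, by simp [hx, hxU]⟩
    · obtain ⟨u, hu, hxu⟩ := h x (hT.sub hx) hxU
      have := hT.closed x hx u (hUW hu) hxu
      exact ⟨u, by simpa [hu] using this⟩
  have hTU := hU.2 (T ∩ U) ⟨Finset.inter_subset_right, hne, by simp, fun a ha b hb hab => by
    have := hT.closed a (Finset.mem_inter.1 ha).1 b (hUW hb) hab
    simpa [hb] using this⟩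
  refine hT.sub.antisymm fun x hx => ?_
  by_cases hxU : x ∈ U
  · rw [← hTU] at hxU
    exact (Finset.mem_inter.1 hxU).1
  · obtain ⟨u, hu, hxu⟩ := h x hx hxU
    rw [← hTU] at hu
    have := hT.closed u (Finset.mem_inter.1 hu).1 x hx hxu.symm
    simpa using this

variable (G) in
/-- A shortest odd cycle `v` on `C` with connected complement `F` in a triangle-free graph. -/
structure Core (k : ℕ) (C F : Finset V) (s : ℕ) (v : ℤ → V) : Prop where
  tri : TriFree G
  noSep : NoSep G
  cyc : Cyc G C (2 * s + 1) v
  two_le_s : 2 ≤ s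
  disj : Disjoint C F
  cover : ∀ x, x ∈ C ∨ x ∈ F
  conn : Conn G F
  two_le : ∀ i, 2 ≤ dg G F (v i)
  deg : ∀ w, k ≤ dg G F w + dg G C w
  le : ∀ w ∈ F, Conn G (F.erase w) → ∀ C' ⊆ insert w C, ¬ Bip G C' → 2 * s + 1 ≤ C'.card

theorem NoSep.exists_core {k : ℕ} (h : NoSep G) (hk : 4 ≤ k) (hdeg : ∀ w, k ≤ dg G Finset.univ w)
    (ht : TriFree G) (hnb : ¬ Bip G Finset.univ) : ∃ C F s v, Core G k C F s v := by
  classical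
  obtain ⟨C₀, hC₀⟩ := h.exists_crit_conn (fun w => by have := hdeg w; omega) hnb
  obtain ⟨C, hC, hmin⟩ := Finset.exists_min_image
    (Finset.univ.filter fun C : Finset V => Crit G C ∧ Conn G (Finset.univ \ C)) Finset.card
    ⟨C₀, by simpa using hC₀⟩
  simp only [Finset.mem_filter, Finset.mem_univ, true_and] at hC hmin
  obtain ⟨hcrit, hconn⟩ := hC
  obtain ⟨n, v, hv⟩ := hcrit.exists_cyc
  have hodd := hv.odd
  have h5 := hv.five_le ht
  have hcard := hv.card
  obtain ⟨s, rfl⟩ : ∃ s, n = 2 * s + 1 := ⟨n / 2, by omega⟩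
  have hsum : ∀ w, dg G (Finset.univ \ C) w + dg G C w = dg G Finset.univ w := fun w =>
    dg_sdiff_add (G := G) (Finset.subset_univ C) w
  have htwo : ∀ i, 2 ≤ dg G (Finset.univ \ C) (v i) := fun i => by
    have h1 := hsum (v i)
    have h2 := hv.dg_le hcrit i
    have h3 := hdeg (v i)
    omega
  refine ⟨C, Finset.univ \ C, s, v, ht, h, hv, by omega, Finset.disjoint_sdiff, fun x => by
    by_cases hx : x ∈ C <;> simp [hx], hconn, htwo, fun w => (hdeg w).trans (hsum w).ge, ?_⟩
  intro w hw hFw C' hC' hnb'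
  obtain ⟨C'', hC'', hcr⟩ := exists_crit hnb'
  refine le_trans ?_ (Finset.card_le_card hC'')
  rw [← hcard]
  have hsub := hC''.trans hC'
  refine hmin C'' ⟨hcr, hFw.of_attached ?_ ?_⟩
  · intro x hx
    have hx' := Finset.mem_erase.1 hx
    simp only [Finset.mem_sdiff, Finset.mem_univ, true_and] at hx' ⊢
    intro hxC
    rcases Finset.mem_insert.1 (hsub hxC) with h1 | h1
    · exact hx'.1 h1
    · exact hx'.2 h1
  · intro x _ hx
    by_cases hxC : x ∈ C
    · obtain ⟨i, rfl⟩ := (hv.mem x).1 hxC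
      have h1 := htwo i
      have h2 := dg_sdiff_add (G := G) (U := Finset.univ \ C) (H := {w}) (by simpa using hw) (v i)
      have h3 := dg_singleton_le (G := G) w (v i)
      rw [Finset.erase_eq]
      exact dg_pos.1 (by omega)
    · have hxw : x = w := by
        by_contra hne
        exact hx (by simp [hne, hxC])
      subst hxw
      obtain ⟨a, ha, b, hb, hba, hab⟩ := hconn.exists_adj (Finset.erase_subset x _) hFw.1
        (fun he => by
          rw [← he] at hw
          exact Finset.notMem_erase _ _ hw)
      have : b = x := by
        by_contra hne
        exact hba (Finset.mem_erase.2 ⟨hne, hb⟩)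
      subst this
      exact ⟨a, ha, hab.symm⟩

variable {k s : ℕ} {C F : Finset V} {v : ℤ → V}

theorem Core.mem (h : Core G k C F s v) (i : ℤ) : v i ∈ C := h.cyc.mem_self i

theorem Core.eq_two (h : Core G k C F s v) {w : V} (hw : w ∈ F) (hFw : Conn G (F.erase w)) {i : ℤ}
    {t : ℕ} (h0 : 0 < t) (ht : t < 2 * s + 1) (h1 : G.Adj w (v i)) (h2 : G.Adj w (v (i + t))) :
    t = 2 ∨ t + 2 = 2 * s + 1 := by
  have hwC : w ∉ C := Finset.disjoint_right.1 h.disj hw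
  have hne1 : t ≠ 1 := by
    rintro rfl
    exact h.tri _ _ _ h1 (h.cyc.adj i) (by simpa using h2)
  rcases Nat.even_or_odd t with he | he
  · have he := Nat.even_iff.1 he
    obtain ⟨hp, hc⟩ := h.cyc.arc_path' i h0 ht
    have := h.le w hw hFw (insert w (arc v (i + t) (2 * s + 1 - t)))
      (Finset.insert_subset_insert _ (h.cyc.arc_subset _ _))
      (not_bip_of_paths (.single w) hp h2 h1.symm (by rw [hc]; simp; omega) (by simp) (by simp))
    have h3 := Finset.card_insert_le w (arc v (i + t) (2 * s + 1 - t))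
    rw [hc] at h3
    omega
  · have he := Nat.odd_iff.1 he
    obtain ⟨hp, hc⟩ := h.cyc.arc_path i ht
    have := h.le w hw hFw (insert w (arc v i t))
      (Finset.insert_subset_insert _ (h.cyc.arc_subset _ _))
      (not_bip_of_paths (.single w) hp h1 h2.symm (by rw [hc]; simp; omega) (by simp) (by simp))
    have h3 := Finset.card_insert_le w (arc v i t)
    rw [hc] at h3
    omega

theorem Core.exists_mid (h : Core G k C F s v) {w : V} (hw : w ∈ F) (hFw : Conn G (F.erase w))
    (hd : 1 < dg G C w) : ∃ l, G.Adj w (v (l - 1)) ∧ G.Adj w (v (l + 1)) := by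
  obtain ⟨a, ha, b, hb, hab⟩ := Finset.one_lt_card.1 hd
  rw [Finset.mem_filter] at ha hb
  obtain ⟨i, -, rfl⟩ := h.cyc.rep ha.1 0
  rw [zero_add] at ha hab
  obtain ⟨t, ht, rfl⟩ := h.cyc.rep hb.1 i
  have h0 : 0 < t := by
    rcases Nat.eq_zero_or_pos t with rfl | h0
    · simp at hab
    · exact h0
  rcases h.eq_two hw hFw h0 ht ha.2 hb.2 with rfl | h2
  · refine ⟨i + 1, by simpa using ha.2, ?_⟩
    rw [show (i : ℤ) + 1 + 1 = i + (2 : ℕ) by push_cast; ring]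
    exact hb.2
  · refine ⟨i - 1, ?_, by simpa using ha.2⟩
    have := h.cyc.per (i - 1 - 1)
    rw [show (i : ℤ) - 1 - 1 + (2 * s + 1 : ℕ) = i + t by omega] at this
    rw [← this]
    exact hb.2

theorem Core.dg_le (h : Core G k C F s v) {w : V} (hw : w ∈ F) (hFw : Conn G (F.erase w)) :
    dg G C w ≤ 2 := by
  by_contra! hd
  obtain ⟨a, b, c, ha, hb, hc, hab, hac, hbc⟩ := Finset.two_lt_card_iff.1 hd
  rw [Finset.mem_filter] at ha hb hc
  obtain ⟨i, -, rfl⟩ := h.cyc.rep ha.1 0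
  rw [zero_add] at ha hab hac
  obtain ⟨t, ht, rfl⟩ := h.cyc.rep hb.1 i
  obtain ⟨u, hu, rfl⟩ := h.cyc.rep hc.1 i
  have h0 : 0 < t := by
    rcases Nat.eq_zero_or_pos t with rfl | h0
    · simp at hab
    · exact h0
  have h1 : 0 < u := by
    rcases Nat.eq_zero_or_pos u with rfl | h0
    · simp at hac
    · exact h0
  have h2 := h.eq_two hw hFw h0 ht ha.2 hb.2
  have h3 := h.eq_two hw hFw h1 hu ha.2 hc.2
  have hs := h.two_le_s
  rcases lt_trichotomy t u with htu | rfl | htu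
  · have := h.eq_two hw hFw (t := u - t) (by omega) (by omega) hb.2 (by
      rw [show (i : ℤ) + t + (u - t : ℕ) = i + u by omega]
      exact hc.2)
    omega
  · exact hbc rfl
  · have := h.eq_two hw hFw (t := t - u) (by omega) (by omega) hc.2 (by
      rw [show (i : ℤ) + u + (t - u : ℕ) = i + t by omega]
      exact hb.2)
    omega

theorem Core.consec_of_pair (h : Core G k C F s v) {l : ℤ} {ε p : ℕ}
    (hg : Good ε p (Ord G F (nbr G F {v l}) (nbr G F {v (l + s)}))) (hp : 1 ≤ p)
    (h1 : k + 1 ≤ p + ε + 2) (h2 : k + 2 ≤ 2 * p + 2) : HasConsecCycles G k := by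
  refine consec_of_closings (s := s + 1) hg hp le_rfl h1 h2 (by have := h.two_le_s; omega) ?_
  intro a ha b hb i hi
  rw [Finset.mem_singleton] at ha hb
  subst ha hb
  have hs := h.two_le_s
  interval_cases i
  · obtain ⟨hS, hc⟩ := h.cyc.arc_path l (t := s) (by omega)
    exact ⟨_, Finset.disjoint_of_subset_left (h.cyc.arc_subset _ _) h.disj, hS.symm, by omega⟩
  · obtain ⟨hS, hc⟩ := h.cyc.arc_path' l (t := s) (by omega) (by omega)
    exact ⟨_, Finset.disjoint_of_subset_left (h.cyc.arc_subset _ _) h.disj, hS, by omega⟩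

theorem Core.consec_of_mid (h : Core G k C F s v) {w : V} {l : ℤ} {ε p : ℕ}
    (hw1 : G.Adj w (v (l - 1))) (hw2 : G.Adj w (v (l + 1)))
    (hg : Good ε p (Ord G F {w} (nbr G F {v (l + s)}))) (hp : 1 ≤ p)
    (h1 : k + 1 ≤ p + ε + 4) (h2 : k + 2 ≤ 2 * p + 4) : HasConsecCycles G k := by
  have hs := h.two_le_s
  have key : ∀ i < 4, ∃ S ⊆ C, ∃ a, PathOn G S (v (l + s)) a ∧ G.Adj a w ∧ S.card = s + i := by
    intro i hi
    interval_cases i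
    · obtain ⟨hS, hc⟩ := h.cyc.arc_path (l + 1) (t := s - 1) (by omega)
      rw [show l + 1 + (s - 1 : ℕ) = l + s by omega] at hS
      exact ⟨_, h.cyc.arc_subset _ _, _, hS.symm, hw2.symm, by omega⟩
    · obtain ⟨hS, hc⟩ := h.cyc.arc_path (l + s) (t := s) (by omega)
      rw [show l + (s : ℤ) + s = l - 1 + (2 * s + 1 : ℕ) by push_cast; ring, h.cyc.per] at hS
      exact ⟨_, h.cyc.arc_subset _ _, _, hS, hw1.symm, by omega⟩
    · obtain ⟨hS, hc⟩ := h.cyc.arc_path (l - 1) (t := s + 1) (by omega)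
      rw [show l - 1 + (s + 1 : ℕ) = l + s by push_cast; ring] at hS
      exact ⟨_, h.cyc.arc_subset _ _, _, hS.symm, hw1.symm, by omega⟩
    · obtain ⟨hS, hc⟩ := h.cyc.arc_path (l + s) (t := s + 2) (by omega)
      rw [show l + (s : ℤ) + (s + 2 : ℕ) = l + 1 + (2 * s + 1 : ℕ) by push_cast; ring,
        h.cyc.per] at hS
      exact ⟨_, h.cyc.arc_subset _ _, _, hS, hw2.symm, by omega⟩
  refine consec_of_good (s := s) hg hp (by omega) h1 h2 ?_
  rintro n ⟨T, x, y, hT, hx, hy, hTp, rfl⟩ i hi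
  obtain rfl : x = w := by simpa using hx
  have hy' := (mem_nbr_singleton.1 hy).2
  obtain ⟨S, hS, a, hSp, ha, hc⟩ := key i hi
  rw [← hc]
  refine cycle_of_paths hTp hSp (Finset.disjoint_of_subset_left hT
    (Finset.disjoint_of_subset_right hS h.disj.symm)) hy'.symm ha ?_
  have := hTp.card_pos
  omega

theorem Core.degOK (h : Core G k C F s v) {w : V} (hw : w ∈ F) (hFw : Conn G (F.erase w)) :
    k - 2 ≤ dg G F w := by
  have h1 := h.deg w
  have h2 := h.dg_le hw hFw
  omega

end CoreStructure
section EndBlocks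
variable {V : Type*} [DecidableEq V] {G : SimpleGraph V} [DecidableRel G.Adj] [Fintype V]

theorem card_nbr_singleton (U : Finset V) (c : V) : (nbr G U {c}).card = dg G U c := by
  unfold dg nbr
  simp

theorem Sep.eq_erase {F D : Finset V} {c : V} (hD : Sep G F {c} D) (hF : Conn G F)
    (hc : c ∈ F → Conn G (F.erase c)) : D = F.erase c := by
  have hcD : c ∉ D := by simpa using hD.disj
  by_cases hcF : c ∈ F
  · refine (hc hcF).2 D ⟨fun x hx => Finset.mem_erase.2 ⟨fun e => hcD (e ▸ hx), hD.sub hx⟩, hD.ne,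
      by simp, fun a ha b hb hab => ?_⟩
    have hb := Finset.mem_erase.1 hb
    exact Or.inl ((hD.closed a ha b hb.2 hab).resolve_right (by simpa using hb.1))
  · rw [Finset.erase_eq_of_notMem hcF]
    refine hF.2 D ⟨hD.sub, hD.ne, by simp, fun a ha b hb hab => ?_⟩
    refine Or.inl ((hD.closed a ha b hb hab).resolve_right ?_)
    rw [Finset.mem_singleton]
    rintro rfl
    exact hcF hb

theorem Ord.exit {D E U X Y : Finset V} {c : V} {n n' : ℕ} (h : n ∈ Ord G D X (nbr G D {c}))
    (h' : n' ∈ Ord G E {c} Y) (hD : D ⊆ U) (hE : E ⊆ U) (hDE : Disjoint D E) :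
    n + n' ∈ Ord G U X Y := by
  obtain ⟨S, a, b, hS, ha, hb, hp, hc⟩ := h
  refine Ord.glue hD hE hDE (fun x hx => ?_) h'
  obtain rfl : x = c := by simpa using hx
  exact ⟨b, (mem_nbr_singleton.1 hb).2.symm, S, a, b, hS, ha, by simp, hp, hc⟩

variable (G) in
/-- `D` is a smallest piece cut off from `F` by one vertex `c`. -/
structure EndBlock (F : Finset V) (c : V) (D : Finset V) : Prop where
  conn : Conn G F
  sep : Sep G F {c} D
  ne : ∃ e ∈ F, e ≠ c ∧ e ∉ D
  min : ∀ c' D', D' ⊂ D → ¬ Sep G F {c'} D'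

theorem exists_endBlock {F : Finset V} {w : V} (hF : Conn G F) (hne : (F.erase w).Nonempty)
    (hw : ¬ Conn G (F.erase w)) : ∃ c D, EndBlock G F c D := by
  classical
  have hex : ∃ q : V × Finset V, Sep G F {q.1} q.2 ∧ ∃ e ∈ F, e ≠ q.1 ∧ e ∉ q.2 := by
    obtain ⟨x, hx⟩ := hne
    have hx := Finset.mem_erase.1 hx
    obtain ⟨M, hxM, hM, hMs⟩ := exists_component (G := G) hx.2 (B := {w}) (by simpa using hx.1)
    refine ⟨(w, M), hMs, ?_⟩
    by_contra! hall
    refine hw ?_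
    rwa [← show M = F.erase w from ?_]
    ext y
    rw [Finset.mem_erase]
    refine ⟨fun hy => ⟨?_, hMs.sub hy⟩, fun hy => hall y hy.2 hy.1⟩
    rintro rfl
    exact Finset.disjoint_left.1 hMs.disj hy (by simp)
  obtain ⟨q₀, hq₀⟩ := hex
  obtain ⟨⟨c, D⟩, hq, hmin⟩ := Finset.exists_min_image
    (Finset.univ.filter fun q : V × Finset V => Sep G F {q.1} q.2 ∧ ∃ e ∈ F, e ≠ q.1 ∧ e ∉ q.2)
    (fun q => q.2.card) ⟨q₀, by simpa using hq₀⟩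
  simp only [Finset.mem_filter, Finset.mem_univ, true_and] at hq hmin
  obtain ⟨hs, e, he, hec, heD⟩ := hq
  refine ⟨c, D, hF, hs, ⟨e, he, hec, heD⟩, fun c' D' hlt hs' => ?_⟩
  have hcD : c ∉ D := by simpa using hs.disj
  have hcF : c ∈ F := by
    by_contra hcF
    have := hs.eq_erase hF fun h => absurd h hcF
    rw [Finset.erase_eq_of_notMem hcF] at this
    exact heD (this ▸ he)
  have hle := hmin (c', D') ⟨hs', by
    by_cases h : e = c'
    · exact ⟨c, hcF, by rw [← h]; exact hec.symm, fun h => hcD (hlt.1 h)⟩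
    · exact ⟨e, he, h, fun h => heD (hlt.1 h)⟩⟩
  exact (Finset.card_lt_card hlt).not_ge hle

variable {F D : Finset V} {c : V}

theorem EndBlock.notMem (h : EndBlock G F c D) : c ∉ D := by simpa using h.sep.disj

theorem EndBlock.mem (h : EndBlock G F c D) : c ∈ F := by
  by_contra hcF
  obtain ⟨e, he, hec, heD⟩ := h.ne
  have := h.sep.eq_erase h.conn fun h => absurd h hcF
  rw [Finset.erase_eq_of_notMem hcF] at this
  exact heD (this ▸ he)

theorem EndBlock.conn_piece (h : EndBlock G F c D) : Conn G D := by
  obtain ⟨x, hx⟩ := h.sep.ne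
  obtain ⟨M, hM, hxM, hMc, hMs⟩ := h.sep.exists_conn hx
  rcases hM.eq_or_ssubset with rfl | hlt
  · exact hMc
  · exact absurd hMs (h.min _ _ hlt)

theorem EndBlock.conn_rest (h : EndBlock G F c D) : Conn G (F \ D) := h.conn.sdiff h.sep h.mem

theorem EndBlock.exists_adj (h : EndBlock G F c D) : ∃ a ∈ D, G.Adj c a := by
  obtain ⟨a, ha, b, hb, hbD, hab⟩ := h.conn.exists_adj h.sep.sub h.sep.ne (by
    rintro rfl
    exact h.notMem h.mem)
  have : b = c := by simpa [hbD] using h.sep.closed a ha b hb hab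
  subst this
  exact ⟨a, ha, hab.symm⟩

theorem EndBlock.conn_insert (h : EndBlock G F c D) : Conn G (insert c D) := by
  obtain ⟨a, ha, hca⟩ := h.exists_adj
  exact h.conn_piece.insert' ha hca

theorem EndBlock.insert_subset (h : EndBlock G F c D) : insert c D ⊆ F :=
  Finset.insert_subset h.mem h.sep.sub

theorem EndBlock.closed (h : EndBlock G F c D) {a b : V} (ha : a ∈ D) (hb : b ∈ F)
    (hab : G.Adj a b) : b ∈ insert c D := by
  have := h.sep.closed a ha b hb hab
  rw [Finset.mem_insert]
  simpa [or_comm] using this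

theorem EndBlock.conn_erase (h : EndBlock G F c D) {w : V} (hw : w ∈ D) :
    Conn G ((insert c D).erase w) := by
  have hcw : c ≠ w := by
    rintro rfl
    exact h.notMem hw
  have key : ∀ T, Sep G ((insert c D).erase w) ∅ T → c ∈ T := fun T hT => by
    by_contra hcT
    have hwT : w ∉ T := fun hx => Finset.notMem_erase w _ (hT.sub hx)
    have hTD : T ⊆ D := fun x hx => by
      rcases Finset.mem_insert.1 (Finset.mem_of_mem_erase (hT.sub hx)) with rfl | hx'
      · exact absurd hx hcT
      · exact hx'
    refine h.min w T (hTD.ssubset_of_ne (by rintro rfl; exact hwT hw)) ⟨hTD.trans h.sep.sub, hT.ne,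
      by simpa using hwT, fun a ha b hb hab => ?_⟩
    by_cases hbw : b = w
    · simp [hbw]
    · exact Or.inl (by
        simpa using hT.closed a ha b (Finset.mem_erase.2 ⟨hbw, h.closed (hTD ha) hb hab⟩) hab)
  refine ⟨⟨c, by simp [hcw]⟩, fun T hT => hT.sub.antisymm fun x hx => ?_⟩
  by_contra hxT
  have h1 := key T hT
  have h2 := key ((insert c D).erase w \ T) ⟨Finset.sdiff_subset, ⟨x, by
    rw [Finset.mem_sdiff]
    exact ⟨hx, hxT⟩⟩, by simp, fun a ha b hb hab => by
      rw [Finset.mem_sdiff] at ha ⊢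
      refine Or.inl ⟨hb, fun hbT => ha.2 ?_⟩
      simpa using hT.closed b hbT a ha.1 hab.symm⟩
  exact (Finset.mem_sdiff.1 h2).2 h1

theorem EndBlock.noncut (h : EndBlock G F c D) {w : V} (hw : w ∈ D) : Conn G (F.erase w) := by
  have hcw : c ≠ w := by
    rintro rfl
    exact h.notMem hw
  have := (h.conn_erase hw).union h.conn_rest ⟨c, by simp [hcw], c, by simp [h.mem, h.notMem],
    Or.inl rfl⟩
  rwa [show F.erase w = (insert c D).erase w ∪ F \ D from ?_]
  ext x
  have h1 := h.insert_subset (x := x)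
  have h2 : x = w → x ∈ D := by
    rintro rfl
    exact hw
  simp only [Finset.mem_insert, Finset.mem_erase, Finset.mem_union, Finset.mem_sdiff] at h1 ⊢
  tauto

theorem EndBlock.dg_le (h : EndBlock G F c D) {w : V} (hw : w ∈ D) :
    dg G F w ≤ dg G D w + ind (nbr G D {c}) w := by
  rw [← dg_singleton_of_mem hw]
  exact dg_le_of_closed fun b hb hwb => h.sep.closed w hw b hb hwb

theorem EndBlock.not_disjoint (h : EndBlock G F c D) {c' : V} {D' : Finset V} (hlt : D' ⊂ D)
    (hs : Sep G D {c'} D') : ¬ Disjoint D' (nbr G D {c}) := fun hd => by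
  refine h.min c' D' hlt ((h.sep.trans hs).shrink hs.disj fun a ha b hb hbc hab => ?_)
  obtain rfl : b = c := by
    simp only [Finset.mem_union, Finset.mem_singleton] at hb hbc
    tauto
  exact Finset.disjoint_left.1 hd ha (mem_nbr_singleton.2 ⟨hs.sub ha, hab.symm⟩)

end EndBlocks
section CoreCases
variable {V : Type*} [DecidableEq V] {G : SimpleGraph V} [DecidableRel G.Adj] [Fintype V]
variable {k s : ℕ} {C F : Finset V} {v : ℤ → V}

theorem Core.consec_of_noncut (h : Core G k C F s v) (hk : 4 ≤ k)
    (hnc : ∀ w ∈ F, Conn G (F.erase w)) : HasConsecCycles G k := by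
  have hs := h.two_le_s
  by_cases hw : ∃ w ∈ F, 1 < dg G C w
  · obtain ⟨w, hw, hwC⟩ := hw
    obtain ⟨l, h1, h2⟩ := h.exists_mid hw (hnc w hw) hwC
    refine h.consec_of_mid (ε := 0) (p := k - 3) h1 h2 ?_ (by omega) (by omega) (by omega)
    have hsum : ∀ u, dg G (F.erase w) u + dg G {w} u = dg G F u := fun u => by
      rw [Finset.erase_eq]
      exact dg_sdiff_add (G := G) (by simpa using hw) u
    have hX : (nbr G (F.erase w) {w}).Nonempty := by
      rw [← Finset.card_pos, card_nbr_singleton]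
      have h3 := hsum w
      have h4 := h.degOK hw (hnc w hw)
      have h5 : dg G {w} w = 0 := by simp [dg_singleton]
      omega
    have hY : (nbr G (F.erase w) {v (l + s)}).Nonempty := by
      rw [← Finset.card_pos, card_nbr_singleton]
      have h3 := hsum (v (l + s))
      have h4 := h.two_le (l + s)
      have h5 := dg_singleton_le (G := G) w (v (l + s))
      omega
    refine Good.shift (pathThm_zero ((F.erase w).card + 1) (F.erase w) (nbr G (F.erase w) {w})
      (nbr G (F.erase w) {v (l + s)}) (k - 3) (Nat.lt_succ_self _) (by omega) (Or.inl rfl)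
      ⟨hnc w hw, nbr_subset _ _, nbr_subset _ _, hX, hY, ?_⟩ (Or.inr ?_)) 1 fun n hn => ?_
    · intro c D hD hDX _
      have hwD : w ∉ D := fun h => Finset.notMem_erase w _ (hD.sub h)
      have hD' : Sep G F {c} D := ⟨hD.sub.trans (Finset.erase_subset _ _), hD.ne, hD.disj,
        fun a ha b hb hab => by
          by_cases hbw : b = w
          · subst hbw
            exact absurd (mem_nbr_singleton.2 ⟨hD.sub ha, hab.symm⟩)
              (Finset.disjoint_left.1 hDX ha)
          · exact hD.closed a ha b (Finset.mem_erase.2 ⟨hbw, hb⟩) hab⟩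
      have he := hD'.eq_erase h.conn (hnc c)
      rw [he, Finset.mem_erase, not_and', not_not] at hwD
      obtain rfl := hwD hw
      obtain ⟨x, hx⟩ := hX
      exact Finset.disjoint_right.1 hDX hx (he ▸ nbr_subset _ _ hx)
    · intro u hu
      have hu' := Finset.mem_of_mem_erase hu
      have h3 := h.degOK hu' (hnc u hu')
      have h4 := hsum u
      rw [dg_singleton_of_mem hu] at h4
      omega
    · have e : 1 + n ∈ Ord G F {w} (nbr G (F.erase w) {v (l + s)}) :=
        Ord.cons (Finset.erase_subset _ _) hw (Finset.notMem_erase _ _) (Finset.mem_singleton_self w)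
          (fun x hx => (mem_nbr_singleton.1 hx).2) hn
      rw [add_comm n]
      refine Ord.mono e le_rfl le_rfl fun x hx => ?_
      rw [mem_nbr_singleton] at hx ⊢
      exact ⟨Finset.mem_of_mem_erase hx.1, hx.2⟩
  · push Not at hw
    refine h.consec_of_pair (l := 0) (ε := 1) (p := k - 2) ?_ (by omega) (by omega) (by omega)
    have hX : ∀ i, 2 ≤ (nbr G F {v i}).card := fun i => by
      rw [card_nbr_singleton]
      exact h.two_le i
    refine pathThm_one (F.card + 1) F _ _ (k - 2) (Nat.lt_succ_self _) (by omega)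
      (Or.inr ⟨rfl, h.tri, Or.inl (h.tri.indep_nbr _ _)⟩) ⟨h.conn, nbr_subset _ _, nbr_subset _ _,
      Finset.card_pos.1 ((hX 0).trans_lt' (by omega)), Finset.card_pos.1 ((hX _).trans_lt' (by omega)),
      fun c D hD hDX _ => ?_⟩ (Or.inr fun u hu => ?_)
    · have he := hD.eq_erase h.conn (hnc c)
      have hsub : nbr G F {v 0} ⊆ {c} := fun x hx => by
        by_contra hxc
        exact Finset.disjoint_right.1 hDX hx
          (he ▸ Finset.mem_erase.2 ⟨by simpa using hxc, nbr_subset _ _ hx⟩)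
      have := Finset.card_le_card hsub
      have := hX 0
      simp at *
      omega
    · have h1 := hw u hu
      have h2 := h.deg u
      omega

theorem Core.exists_split (h : Core G k C F s v) {P Q : V → Prop} (hPQ : ∀ i, P (v i) ∨ Q (v i))
    (hP : ∃ i, P (v i)) (hQ : ∃ i, Q (v i)) : ∃ i, P (v i) ∧ Q (v (i + s)) := by
  by_contra! hno
  obtain ⟨i, hi⟩ := hP
  obtain ⟨j, hj⟩ := hQ
  have hstep : ∀ i, P (v i) → P (v (i + s)) := fun i hi => (hPQ _).resolve_right (hno i hi)
  have hback : ∀ m : ℕ, P (v (i - m)) := fun m => by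
    induction m with
    | zero => simpa using hi
    | succ m ih =>
      have := hstep _ (hstep _ ih)
      rwa [show i - (m : ℤ) + s + s = i - (m + 1 : ℕ) + (2 * s + 1 : ℕ) by push_cast; ring,
        h.cyc.per] at this
  obtain ⟨t, -, ht⟩ := h.cyc.mirror.rep (h.mem (j - s)) (-i)
  have := hback t
  rw [show i - (t : ℤ) = -(-i + t) by ring] at this
  rw [ht] at this
  refine hno _ this ?_
  simpa using hj

variable {c : V} {D : Finset V}

theorem Core.sep_piece (h : Core G k C F s v) {D : Finset V} (hD : Sep G F {c} D) :
    Sep G Finset.univ (C ∪ {c}) D :=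
  ⟨Finset.subset_univ _, hD.ne, Finset.disjoint_union_right.2
    ⟨Finset.disjoint_of_subset_left hD.sub h.disj.symm, hD.disj⟩, fun a ha b _ hab => by
      rw [Finset.mem_union]
      rcases h.cover b with hb | hb
      · exact Or.inr (Or.inl hb)
      · exact (hD.closed a ha b hb hab).imp_right Or.inr⟩

theorem Core.exists_nbr (h : Core G k C F s v) {D : Finset V} (hc : c ∈ F) (hD : Sep G F {c} D) :
    ∃ i, (nbr G D {v i}).Nonempty := by
  obtain ⟨x, hx⟩ := h.noSep.exists_mem (h.sep_piece hD) ⟨v 0, h.mem 0⟩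
    (by simpa using Finset.disjoint_right.1 h.disj hc) (by simp)
  obtain ⟨hxD, r, hr, hrx⟩ := mem_nbr.1 hx
  obtain ⟨i, rfl⟩ := (h.cyc.mem r).1 hr
  exact ⟨i, x, mem_nbr_singleton.2 ⟨hxD, hrx⟩⟩

theorem Core.nbr_or (h : Core G k C F s v) (D : Finset V) (i : ℤ) :
    (nbr G D {v i}).Nonempty ∨ (nbr G (F \ D) {v i}).Nonempty := by
  have h1 := h.two_le i
  obtain ⟨x, hx, hix⟩ := dg_pos.1 (show 0 < dg G F (v i) by omega)
  by_cases hxD : x ∈ D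
  · exact Or.inl ⟨x, mem_nbr_singleton.2 ⟨hxD, hix⟩⟩
  · exact Or.inr ⟨x, mem_nbr_singleton.2 ⟨Finset.mem_sdiff.2 ⟨hx, hxD⟩, hix⟩⟩

theorem EndBlock.exists_exit (h : EndBlock G F c D) {a : V} (ha : (nbr G (F \ D) {a}).Nonempty) :
    ∃ m, m ∈ Ord G (F \ D) {c} (nbr G F {a}) := by
  refine h.conn_rest.ord ⟨c, by simp [h.mem, h.notMem]⟩ ?_
  obtain ⟨x, hx⟩ := ha
  obtain ⟨hx, hax⟩ := mem_nbr_singleton.1 hx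
  exact ⟨x, Finset.mem_inter.2 ⟨hx, mem_nbr_singleton.2 ⟨(Finset.mem_sdiff.1 hx).1, hax⟩⟩⟩

theorem Core.consec_of_endBlock_one (h : Core G k C F s v) (hk : 4 ≤ k) (hb : EndBlock G F c D)
    (hD : ∀ w ∈ D, dg G C w ≤ 1) : HasConsecCycles G k := by
  have hQ : ∃ i, (nbr G (F \ D) {v i}).Nonempty := by
    obtain ⟨e, he, hec, heD⟩ := hb.ne
    obtain ⟨i, hi⟩ := h.exists_nbr hb.mem (D := (F \ D).erase c)
      ⟨(Finset.erase_subset _ _).trans Finset.sdiff_subset, ⟨e, by simp [he, hec, heD]⟩, by simp,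
        fun a ha b hbF hab => by
          rw [Finset.mem_erase, Finset.mem_sdiff] at ha ⊢
          rw [Finset.mem_singleton]
          by_cases hbc : b = c
          · exact Or.inr hbc
          · refine Or.inl ⟨hbc, hbF, fun hbD => ?_⟩
            have := hb.closed hbD ha.2.1 hab.symm
            simp [ha.1, ha.2.2] at this⟩
    exact ⟨i, hi.mono (Finset.filter_subset_filter _ (Finset.erase_subset _ _))⟩
  obtain ⟨i, hiD, hiE⟩ := h.exists_split (P := fun x => (nbr G D {x}).Nonempty)
    (Q := fun x => (nbr G (F \ D) {x}).Nonempty) (h.nbr_or D) (h.exists_nbr hb.mem hb.sep) hQ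
  obtain ⟨m, hm⟩ := hb.exists_exit hiE
  refine h.consec_of_pair (l := i) (ε := 1) (p := k - 2) ?_ (by omega) (by omega) (by omega)
  refine Good.shift (pathThm_one (D.card + 1) D (nbr G D {v i}) (nbr G D {c}) (k - 2)
    (Nat.lt_succ_self _) (by omega) (Or.inr ⟨rfl, h.tri, Or.inl (h.tri.indep_nbr _ _)⟩)
    ⟨hb.conn_piece, nbr_subset _ _, nbr_subset _ _, hiD, ?_, ?_⟩ (Or.inr ?_)) m fun n hn => ?_
  · obtain ⟨a, ha, hca⟩ := hb.exists_adj
    exact ⟨a, mem_nbr_singleton.2 ⟨ha, hca⟩⟩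
  · intro c' D' hD' hX
    refine hb.not_disjoint (hD'.sub.ssubset_of_ne ?_) hD'
    rintro rfl
    obtain ⟨x, hx⟩ := hiD
    exact Finset.disjoint_right.1 hX hx (nbr_subset _ _ hx)
  · intro u hu
    have h1 := hD u hu
    have h2 := h.deg u
    have h3 := hb.dg_le hu
    omega
  · exact Ord.exit (Ord.mono hn le_rfl (Finset.filter_subset_filter _ hb.sep.sub) le_rfl) hm
      hb.sep.sub Finset.sdiff_subset Finset.disjoint_sdiff

theorem Core.consec_of_exit (h : Core G k C F s v) (hk : 4 ≤ k) (hb : EndBlock G F c D) {w : V}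
    (hw : w ∈ D) {l : ℤ} (h1 : G.Adj w (v (l - 1))) (h2 : G.Adj w (v (l + 1)))
    (hl : (nbr G (F \ D) {v (l + s)}).Nonempty) : HasConsecCycles G k := by
  obtain ⟨m, hm⟩ := hb.exists_exit hl
  have hcut : ∀ u ∈ D, k - 2 ≤ dg G F u := fun u hu => h.degOK (hb.sep.sub hu) (hb.noncut hu)
  obtain ⟨x, hx, hwx⟩ := dg_pos.1 (show 0 < dg G D w by
    have h3 := hb.dg_le hw
    have h4 := ind_le (nbr G D {c}) w
    have h5 := hcut w hw
    omega)
  obtain ⟨M, hxM, hM, hMs⟩ := exists_component (G := G) hx (B := {w}) (by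
    simpa using hwx.ne')
  have hwM : w ∉ M := by simpa using hMs.disj
  have hcM : c ∉ M := fun h => hb.notMem (hMs.sub h)
  have hlt : M ⊂ D := hMs.sub.ssubset_of_ne (by
    rintro rfl
    exact hwM hw)
  refine h.consec_of_mid (ε := 0) (p := k - 3) h1 h2 ?_ (by omega) (by omega) (by omega)
  refine Good.shift (pathThm_zero (M.card + 1) M (nbr G M {w}) (nbr G M {c}) (k - 3)
    (Nat.lt_succ_self _) (by omega) (Or.inl rfl) ⟨hM, nbr_subset _ _, nbr_subset _ _,
      ⟨x, mem_nbr_singleton.2 ⟨hxM, hwx⟩⟩, ?_, ?_⟩ (Or.inr ?_)) (1 + m) fun n hn => ?_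
  · obtain ⟨a, ha, ha'⟩ := Finset.not_disjoint_iff.1 (hb.not_disjoint hlt hMs)
    exact ⟨a, mem_nbr_singleton.2 ⟨ha, (mem_nbr_singleton.1 ha').2⟩⟩
  · intro c' D' hD' hX hY
    have hs : Sep G D {c'} D' := (hMs.trans hD').shrink hD'.disj fun a ha b hbm hbc hab => by
      obtain rfl : b = w := by
        simp only [Finset.mem_union, Finset.mem_singleton] at hbm hbc
        tauto
      exact Finset.disjoint_left.1 hX ha (mem_nbr_singleton.2 ⟨hD'.sub ha, hab.symm⟩)
    refine hb.not_disjoint (Finset.ssubset_of_subset_of_ssubset hD'.sub hlt) hs ?_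
    rw [Finset.disjoint_left] at hY ⊢
    intro a ha ha'
    exact hY ha (mem_nbr_singleton.2 ⟨hD'.sub ha, (mem_nbr_singleton.1 ha').2⟩)
  · intro u hu
    have h3 := hcut u (hMs.sub hu)
    have h4 := hb.dg_le (hMs.sub hu)
    have h5 : dg G D u ≤ dg G M u + dg G {w} u :=
      dg_le_of_closed fun b hbD hub => hMs.closed u hu b hbD hub
    rw [dg_singleton_of_mem hu] at h5
    rw [← dg_singleton_of_mem (hMs.sub hu), dg_singleton_of_mem hu] at h4
    omega
  · refine Ord.bridge (A := {w}) (q := w) (by simpa using hb.sep.sub hw) (hMs.sub.trans hb.sep.sub)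
      Finset.sdiff_subset (by simpa using hwM) (by simp [hw])
      (Finset.disjoint_of_subset_left hMs.sub Finset.disjoint_sdiff) ?_ hn hm
    exact Ord.single (a := w) (by simp) (by simp) (by simp)

theorem Core.consec_of_stay (h : Core G k C F s v) (hk : 4 ≤ k) (hb : EndBlock G F c D) {w : V}
    (hw : w ∈ D) {l : ℤ} (h1 : G.Adj w (v (l - 1))) (h2 : G.Adj w (v (l + 1)))
    (hl : ¬ (nbr G (F \ D) {v (l + s)}).Nonempty) : HasConsecCycles G k := by
  have hwc : w ≠ c := by
    rintro rfl
    exact hb.notMem hw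
  have hYD : nbr G F {v (l + s)} ⊆ D := fun x hx => by
    by_contra hxD
    obtain ⟨hxF, hxa⟩ := mem_nbr_singleton.1 hx
    exact hl ⟨x, mem_nbr_singleton.2 ⟨Finset.mem_sdiff.2 ⟨hxF, hxD⟩, hxa⟩⟩
  set Y := nbr G F {v (l + s)} with hY
  have hYc : 2 ≤ Y.card := by
    rw [hY, card_nbr_singleton]
    exact h.two_le _
  have hYne : Y.Nonempty := Finset.card_pos.1 (by omega)
  have hYU : Y ⊆ insert c D := hYD.trans (Finset.subset_insert _ _)
  have hdeg : ∀ u ∈ insert c D, u ≠ c → k - 2 ≤ dg G (insert c D) u := fun u hu huc => by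
    have hu' := (Finset.mem_insert.1 hu).resolve_left huc
    refine (h.degOK (hb.sep.sub hu') (hb.noncut hu')).trans ?_
    refine (dg_le_of_closed (B := ∅) fun b hbF hub => Or.inl (hb.closed hu' hbF hub)).trans ?_
    simp [dg]
  have hpiece : ∀ c' D', Sep G (insert c D) {c'} D' → Disjoint D' {w} → ¬ Disjoint D' Y := by
    intro c' D' hD' hwD' hYD'
    have hwD' : w ∉ D' := by simpa using hwD'
    by_cases hcD' : c ∈ D'
    · have he := hD'.eq_erase hb.conn_insert fun hc' => hb.conn_erase (by
        refine (Finset.mem_insert.1 hc').resolve_left ?_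
        rintro rfl
        exact Finset.disjoint_left.1 hD'.disj hcD' (by simp))
      have hwc' : w = c' := by
        by_contra hne
        exact hwD' (he ▸ Finset.mem_erase.2 ⟨hne, Finset.mem_insert_of_mem hw⟩)
      have hsub : Y ⊆ {c'} := fun x hx => by
        by_contra hxc
        exact Finset.disjoint_right.1 hYD' hx
          (he ▸ Finset.mem_erase.2 ⟨by simpa using hxc, hYU hx⟩)
      have := Finset.card_le_card hsub
      rw [Finset.card_singleton] at this
      omega
    · have hsub : D' ⊆ D := fun x hx => by
        refine (Finset.mem_insert.1 (hD'.sub hx)).resolve_left ?_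
        rintro rfl
        exact hcD' hx
      refine hb.min c' D' (hsub.ssubset_of_ne ?_) ⟨hsub.trans hb.sep.sub, hD'.ne, hD'.disj,
        fun a ha b hbF hab => hD'.closed a ha b (hb.closed (hsub ha) hbF hab) hab⟩
      rintro rfl
      exact hwD' hw
  have hinst : Inst G (insert c D) {w} Y := ⟨hb.conn_insert, by simp [hw], hYU, by simp, hYne, hpiece⟩
  have hord : ∀ n ∈ Ord G (insert c D) {w} Y, n + 0 ∈ Ord G F {w} Y := fun n hn =>
    Ord.mono hn hb.insert_subset le_rfl le_rfl
  obtain rfl | rfl | hk6 : k = 4 ∨ k = 5 ∨ 6 ≤ k := by omega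
  · obtain ⟨n, hn⟩ := hb.conn_insert.ord (X := {w}) (Y := Y) ⟨w, by simp [hw]⟩ (by
      rw [Finset.inter_eq_right.2 hYU]
      exact hYne)
    exact h.consec_of_mid (ε := 0) (p := 1) h1 h2 (Good.of_one (hord n hn) le_rfl) le_rfl
      (by omega) (by omega)
  · have ht : TwoInst G (insert c D) {w} {w, c} Y := by
      refine ⟨hb.conn_insert, hYU, hYne, by simp, ?_, by simp, Finset.card_le_two, ?_, hpiece, ?_,
        Or.inl (by simp)⟩
      · intro x hx
        rcases Finset.mem_insert.1 hx with rfl | hx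
        · simp [hw]
        · simp [Finset.mem_singleton.1 hx]
      · intro u hu huZ
        have := hdeg u hu (by
          rintro rfl
          simp at huZ)
        omega
      · obtain ⟨y, hy, hyw⟩ := Finset.exists_mem_ne (by omega : 1 < Y.card) w
        refine ⟨y, ?_⟩
        have hyc : y ≠ c := by
          rintro rfl
          exact hb.notMem (hYD hy)
        simp [hYU hy, hyw, hyc]
    obtain ⟨z, hz, m, g, hg, hm, hmg⟩ := ht.two
    obtain rfl : z = w := by simpa using hz
    refine h.consec_of_mid (ε := 0) (p := 2) h1 h2 ?_ (by omega) (by omega) (by omega)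
    rcases hg with rfl | rfl
    · refine Or.inr ⟨m, fun i hi => ?_⟩
      interval_cases i
      · exact hord m hm
      · exact hord _ hmg
    · refine Or.inl ⟨m, fun i hi => ?_⟩
      interval_cases i
      · exact hord m hm
      · exact hord _ hmg
  · have hg := hinst.good_of_exception (p := k - 3) (z := c) (w := w) h.tri
      (by
        intro a ha b hb' hab
        rw [Finset.mem_singleton] at ha hb'
        subst ha hb'
        exact G.loopless.irrefl _ hab)
      (by simp) (by simp [hw]) hwc (fun u hu huc => by
        have := hdeg u hu huc
        omega) (by omega)
    exact h.consec_of_mid h1 h2 (hg.shift 0 hord) (by omega) (by omega) (by omega)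

theorem Core.consec (h : Core G k C F s v) (hk : 4 ≤ k) : HasConsecCycles G k := by
  by_cases hnc : ∀ w ∈ F, Conn G (F.erase w)
  · exact h.consec_of_noncut hk hnc
  push Not at hnc
  obtain ⟨w, hw, hcut⟩ := hnc
  have hne : (F.erase w).Nonempty := by
    rw [← Finset.card_pos, Finset.card_erase_of_mem hw]
    have h1 := h.two_le 0
    rw [← card_nbr_singleton] at h1
    have := Finset.card_le_card (nbr_subset (G := G) F {v 0})
    omega
  obtain ⟨c, D, hb⟩ := exists_endBlock h.conn hne hcut
  by_cases hD : ∀ w ∈ D, dg G C w ≤ 1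
  · exact h.consec_of_endBlock_one hk hb hD
  push Not at hD
  obtain ⟨u, hu, huC⟩ := hD
  obtain ⟨l, h1, h2⟩ := h.exists_mid (hb.sep.sub hu) (hb.noncut hu) huC
  by_cases hl : (nbr G (F \ D) {v (l + s)}).Nonempty
  · exact h.consec_of_exit hk hb hu h1 h2 hl
  · exact h.consec_of_stay hk hb hu h1 h2 hl

end CoreCases
section Main
variable {V : Type*} [DecidableEq V] {G : SimpleGraph V} [DecidableRel G.Adj] [Fintype V]

theorem noSep_of_kConnected (h : KConnected G 3) : NoSep G := by
  intro B D hs hB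
  by_contra hne
  obtain ⟨x, hx⟩ := hs.ne
  obtain ⟨y, hy⟩ : ∃ y, y ∉ D ∪ B := by
    by_contra! hall
    exact hne (Finset.eq_univ_iff_forall.2 hall)
  rw [Finset.mem_union, not_or] at hy
  have hconn := h.2 (B : Set V) B.finite_toSet (by rw [Set.ncard_coe_finset]; omega)
  have key : ∀ (a b : ((B : Set V)ᶜ : Set V)), (G.induce (B : Set V)ᶜ).Walk a b → a.1 ∈ D →
      b.1 ∈ D := by
    intro a b w
    induction w with
    | nil => exact id
    | @cons _ c _ hab _ ih =>
      exact fun ha => ih ((hs.closed _ ha _ (Finset.mem_univ _) hab).resolve_right c.2)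
  obtain ⟨w⟩ := hconn.preconnected ⟨x, by simpa using Finset.disjoint_left.1 hs.disj hx⟩
    ⟨y, by simpa using hy.2⟩
  exact hy.1 (key _ _ w hx)

theorem Bip.colorable (h : Bip G Finset.univ) : G.Colorable 2 := by
  obtain ⟨f, hf⟩ := h
  exact (Coloring.mk f fun {a b} hab =>
    hf a (Finset.mem_univ a) b (Finset.mem_univ b) hab).colorable

theorem dg_univ_eq_ncard (w : V) : dg G Finset.univ w = (G.neighborSet w).ncard := by
  rw [dg, ← Set.ncard_coe_finset]
  congr 1
  ext x
  simp

end Main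
end ConsecCycles

/-- For every `k ≥ 4`, every 3-connected nonbipartite graph of minimum degree at
least `k` and order at least `k + 2` contains `k` cycles of consecutive lengths. -/
theorem consec_cycles_main {V : Type*} [Fintype V] (G : SimpleGraph V) (k : ℕ) (hk : 4 ≤ k)
    (h3 : KConnected G 3) (hnb : ¬ G.Colorable 2)
    (hdeg : ∀ v, k ≤ (G.neighborSet v).ncard) (hcard : k + 2 ≤ Nat.card V) :
    HasConsecCycles G k := by
  classical
  have h := ConsecCycles.noSep_of_kConnected h3
  have hdeg' : ∀ w, k ≤ ConsecCycles.dg G Finset.univ w := fun w => by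
    rw [ConsecCycles.dg_univ_eq_ncard]
    exact hdeg w
  by_cases ht : ConsecCycles.TriFree G
  · obtain ⟨C, F, s, v, hc⟩ := h.exists_core hk hdeg' ht fun hb => hnb hb.colorable
    exact hc.consec hk
  · exact h.consec_of_not_triFree hk hdeg' (by rwa [← Nat.card_eq_fintype_card]) ht
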